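/- arXiv:2412.07974 — 2 statements merged into one kernel-verified Lean document; each statement's English description precedes it below -/
import Mathlib

section
/- Assume n > 2k and k ≥ 5. Let F be an intersecting family of k-element subsets of [n] with γ(F) = |F(1̄)|, let M ⊆ F(1̄) be minimal with respect to common intersection with |∩_{M∈M} M| = t ≥ 3, and let F' := M ∪ {A ∈ C([n],k) : 1 ∈ A and A∩M ≠ ∅ for every M ∈ M}. If |F| = |F'|, then F is isomorphic to F', i.e., some permutation of [n] maps F onto F'. -/
/-- A family is intersecting if any two of its members intersect. -/
def Intersecting (F : Finset (Finset ℕ)) : Prop :=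
  ∀ A ∈ F, ∀ B ∈ F, (A ∩ B).Nonempty

/-- The diversity `γ(F) = min_{i ∈ [n]} |F(ī)|`. -/
noncomputable def diversity (n : ℕ) (F : Finset (Finset ℕ)) : ℕ :=
  sInf ((fun i => (F.filter (fun A => i ∉ A)).card) '' (Set.Icc 1 n))

/-- The common intersection `∩_{A ∈ M} A` of a family of subsets of `[n]`. -/
def famInter (n : ℕ) (M : Finset (Finset ℕ)) : Finset ℕ :=
  (Finset.Icc 1 n).filter (fun x => ∀ A ∈ M, x ∈ A)

/-- `M` is minimal w.r.t. common intersection: removing any member strictly increases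
the common intersection. -/
def MinimalWrtCommonInt (n : ℕ) (M : Finset (Finset ℕ)) : Prop :=
  ∀ M' ∈ M, (famInter n M).card < (famInter n (M.erase M')).card

/-- The unique inclusion-maximal intersecting family `F'` in `C([n],k)` with `F'(1̄) = M`. -/
def maxExt (n k : ℕ) (M : Finset (Finset ℕ)) : Finset (Finset ℕ) :=
  M ∪ (Finset.powersetCard k (Finset.Icc 1 n)).filter
    (fun A => 1 ∈ A ∧ ∀ B ∈ M, (A ∩ B).Nonempty)

/-- Two families are isomorphic if some permutation of `[n]` maps one onto the other. -/
def Isomorphic (n : ℕ) (F G : Finset (Finset ℕ)) : Prop :=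
  ∃ σ : Equiv.Perm ℕ, (∀ x ∈ Finset.Icc 1 n, σ x ∈ Finset.Icc 1 n) ∧
    F.image (fun A => A.image σ) = G

section Part1

namespace Div5
open Finset

lemma choose_lt_step {n r : ℕ} (h : 2 * r + 1 < n) : n.choose r < n.choose (r + 1) := by
  have h1 := Nat.choose_succ_right_eq n r
  have h2 : 0 < n.choose r := Nat.choose_pos (by omega)
  by_contra hc
  push Not at hc
  have h3 : n.choose (r+1) * (r+1) ≤ n.choose r * (r+1) := Nat.mul_le_mul_right _ hc
  have h4 : n.choose r * (r+1) < n.choose r * (n - r) := Nat.mul_lt_mul_of_pos_left (by omega) h2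
  omega

lemma choose_lt_half {n a b : ℕ} (hab : a < b) (hb : 2 * b ≤ n) : n.choose a < n.choose b := by
  induction b, hab using Nat.le_induction with
  | base => exact choose_lt_step (by omega)
  | succ b hb' ih => exact (ih (by omega)).trans (choose_lt_step (by omega))

lemma choose_lt {n a b : ℕ} (hab : a < b) (h : a + b < n) : n.choose a < n.choose b := by
  by_cases hb : 2 * b ≤ n
  · exact choose_lt_half hab hb
  · rw [← Nat.choose_symm_of_eq_add (n := n) (a := n - b) (b := b) (by omega)]
    exact choose_lt_half (by omega) (by omega)

lemma choose_le' {n a b : ℕ} (hab : a ≤ b) (h : a + b ≤ n) : n.choose a ≤ n.choose b := by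
  rcases hab.eq_or_lt with rfl | hab
  · exact le_rfl
  rcases h.eq_or_lt with h | h
  · rw [Nat.choose_symm_of_eq_add (n := n) (a := a) (b := b) (by omega)]
  · exact (choose_lt hab h).le

variable {α : Type*} [DecidableEq α]

/-- The `b`-subsets of `U` disjoint from some member of `S`. -/
def nb (U : Finset α) (b : ℕ) (S : Finset (Finset α)) : Finset (Finset α) :=
  (powersetCard b U).filter (fun B => ∃ A ∈ S, Disjoint A B)

lemma mem_nb {U : Finset α} {b : ℕ} {S : Finset (Finset α)} {B : Finset α} :
    B ∈ nb U b S ↔ (B ⊆ U ∧ B.card = b) ∧ ∃ A ∈ S, Disjoint A B := by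
  simp [nb, mem_powersetCard]

lemma nb_mono {U : Finset α} {b : ℕ} {S S' : Finset (Finset α)} (h : S ⊆ S') :
    nb U b S ⊆ nb U b S' := by
  intro B hB
  rw [mem_nb] at *
  obtain ⟨h1, A, hA, h2⟩ := hB
  exact ⟨h1, A, h hA, h2⟩

lemma filter_disj {U A : Finset α} (b : ℕ) :
    (powersetCard b U).filter (fun B => Disjoint A B) = powersetCard b (U \ A) := by
  ext B
  simp only [mem_filter, mem_powersetCard, subset_sdiff, disjoint_comm (a := A)]
  tauto

lemma choose_swap {N a b : ℕ} (h : a + b ≤ N) :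
    N.choose a * (N - a).choose b = N.choose b * (N - b).choose a := by
  have h1 := Nat.choose_mul_factorial_mul_factorial (n := N) (k := a) (by omega)
  have h2 := Nat.choose_mul_factorial_mul_factorial (n := N - a) (k := b) (by omega)
  have h3 := Nat.choose_mul_factorial_mul_factorial (n := N) (k := b) (by omega)
  have h4 := Nat.choose_mul_factorial_mul_factorial (n := N - b) (k := a) (by omega)
  rw [show N - b - a = N - a - b by omega] at h4
  have hp : 0 < a.factorial * b.factorial * (N - a - b).factorial := by positivity
  apply Nat.eq_of_mul_eq_mul_right hp
  calc _ = N.choose a * a.factorial * ((N-a).choose b * b.factorial * (N-a-b).factorial) := by ring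
    _ = N.choose b * b.factorial * ((N-b).choose a * a.factorial * (N-a-b).factorial) := by
        rw [h2, h1, h4, h3]
    _ = _ := by ring

/-- normalized matching, raw form -/
lemma nb_raw {U : Finset α} {a b : ℕ} {S : Finset (Finset α)} (hS : S ⊆ powersetCard a U) :
    S.card * (U.card - a).choose b ≤ (nb U b S).card * (U.card - b).choose a := by
  apply card_mul_le_card_mul (fun A B => Disjoint A B)
  · intro A hA
    have hA' := mem_powersetCard.1 (hS hA)
    have : (nb U b S).bipartiteAbove (fun A B => Disjoint A B) A = powersetCard b (U \ A) := by
      rw [← filter_disj]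
      ext B
      simp only [bipartiteAbove, mem_filter, mem_nb, mem_powersetCard]
      constructor
      · tauto
      · rintro ⟨h1, h2⟩
        exact ⟨⟨h1, A, hA, h2⟩, h2⟩
    rw [this, card_powersetCard, card_sdiff_of_subset hA'.1, hA'.2]
  · intro B hB
    have hB' := (mem_nb.1 hB).1
    have : S.bipartiteBelow (fun A B => Disjoint A B) B ⊆ powersetCard a (U \ B) := by
      rw [← filter_disj]
      intro A hA
      simp only [bipartiteBelow, mem_filter] at hA ⊢
      exact ⟨hS hA.1, hA.2.symm⟩
    refine (card_le_card this).trans ?_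
    rw [card_powersetCard, card_sdiff_of_subset hB'.1, hB'.2]

lemma nb_lym {U : Finset α} {a b : ℕ} {S : Finset (Finset α)} (hS : S ⊆ powersetCard a U)
    (h : a + b ≤ U.card) :
    S.card * U.card.choose b ≤ (nb U b S).card * U.card.choose a := by
  have h1 := nb_raw (b := b) hS
  have h2 := choose_swap h
  have hp : 0 < (U.card - b).choose a := Nat.choose_pos (by omega)
  apply Nat.le_of_mul_le_mul_right _ hp
  calc _ = S.card * (U.card.choose b * (U.card - b).choose a) := by ring
    _ = (S.card * (U.card - a).choose b) * U.card.choose a := by rw [← h2]; ring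
    _ ≤ ((nb U b S).card * (U.card - b).choose a) * U.card.choose a := Nat.mul_le_mul_right _ h1
    _ = _ := by ring

lemma nb_le {U : Finset α} {a b : ℕ} {S : Finset (Finset α)} (hS : S ⊆ powersetCard a U)
    (hab : a ≤ b) (h : a + b ≤ U.card) : S.card ≤ (nb U b S).card := by
  have h1 := nb_lym hS h
  have h2 := choose_le' hab h
  have hp : 0 < U.card.choose a := Nat.choose_pos (by omega)
  apply Nat.le_of_mul_le_mul_right _ hp
  exact (Nat.mul_le_mul_left _ h2).trans h1

lemma swap_closed {U : Finset α} {a : ℕ} {S : Finset (Finset α)} (hS : S ⊆ powersetCard a U)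
    (hcl : ∀ A ∈ S, ∀ x ∈ A, ∀ y ∈ U, y ∉ A → insert y (A.erase x) ∈ S)
    (hne : S.Nonempty) : S = powersetCard a U := by
  apply Subset.antisymm hS
  intro B hB
  rw [mem_powersetCard] at hB
  have key : ∀ d, ∀ A ∈ S, (B \ A).card = d → B ∈ S := by
    intro d
    induction d with
    | zero =>
      intro A hA h0
      have h1 : B ⊆ A := by
        rw [card_eq_zero, sdiff_eq_empty_iff_subset] at h0; exact h0
      have hA' := mem_powersetCard.1 (hS hA)
      have : B = A := eq_of_subset_of_card_le h1 (by omega)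
      rwa [this]
    | succ d ih =>
      intro A hA hd
      have hA' := mem_powersetCard.1 (hS hA)
      obtain ⟨y, hy⟩ : (B \ A).Nonempty := card_pos.1 (by omega)
      have hAB : (A \ B).card = (B \ A).card := by
        have := card_sdiff_add_card_inter A B
        have := card_sdiff_add_card_inter B A
        rw [inter_comm] at this
        omega
      obtain ⟨x, hx⟩ : (A \ B).Nonempty := card_pos.1 (by omega)
      rw [mem_sdiff] at hx hy
      apply ih _ (hcl A hA x hx.1 y (hB.1 hy.1) hy.2)
      have : B \ insert y (A.erase x) = (B \ A).erase y := by
        ext z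
        simp only [mem_sdiff, mem_insert, mem_erase]
        constructor
        · rintro ⟨h1, h2⟩
          push Not at h2
          exact ⟨h2.1, h1, fun h => h2.2 (fun hzx => hx.2 (hzx ▸ h1)) h⟩
        · rintro ⟨h1, h2, h3⟩
          exact ⟨h2, fun h => h.elim h1 (fun h => h3 h.2)⟩
      rw [this, card_erase_of_mem (mem_sdiff.2 hy), hd]
      rfl
  obtain ⟨A, hA⟩ := hne
  exact key _ A hA rfl

lemma nb_lt_eq {U : Finset α} {a : ℕ} {S : Finset (Finset α)} (hS : S ⊆ powersetCard a U)
    (h : a + a < U.card) (hne : S.Nonempty) (hlt : S.card < U.card.choose a) :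
    S.card < (nb U a S).card := by
  by_contra hc
  push Not at hc
  have heq : S.card = (nb U a S).card := le_antisymm (nb_le hS le_rfl h.le) hc
  -- neighbours of nb are in S
  have hS2 : S ⊆ nb U a (nb U a S) := by
    intro A hA
    have hA' := mem_powersetCard.1 (hS hA)
    rw [mem_nb]
    refine ⟨hA', ?_⟩
    obtain ⟨B, hB1, hB2⟩ := exists_subset_card_eq (s := U \ A) (n := a)
      (by rw [card_sdiff_of_subset hA'.1]; omega)
    rw [subset_sdiff] at hB1
    exact ⟨B, mem_nb.2 ⟨⟨hB1.1, hB2⟩, A, hA, hB1.2.symm⟩, hB1.2⟩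
  have key : ∀ B ∈ nb U a S, S.bipartiteBelow (fun A B => Disjoint A B) B
      = powersetCard a (U \ B) := by
    have hsum := sum_card_bipartiteAbove_eq_sum_card_bipartiteBelow
      (s := S) (t := nb U a S) (fun A B => Disjoint A B)
    have hl : ∀ A ∈ S, ((nb U a S).bipartiteAbove (fun A B => Disjoint A B) A).card
        = (U.card - a).choose a := by
      intro A hA
      have hA' := mem_powersetCard.1 (hS hA)
      have : (nb U a S).bipartiteAbove (fun A B => Disjoint A B) A = powersetCard a (U \ A) := by
        rw [← filter_disj]
        ext B
        simp only [bipartiteAbove, mem_filter, mem_nb, mem_powersetCard]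
        constructor
        · tauto
        · rintro ⟨h1, h2⟩
          exact ⟨⟨h1, A, hA, h2⟩, h2⟩
      rw [this, card_powersetCard, card_sdiff_of_subset hA'.1, hA'.2]
    have hsub : ∀ B ∈ nb U a S, S.bipartiteBelow (fun A B => Disjoint A B) B
        ⊆ powersetCard a (U \ B) := by
      intro B hB
      rw [← filter_disj]
      intro A hA
      simp only [bipartiteBelow, mem_filter] at hA ⊢
      exact ⟨hS hA.1, hA.2.symm⟩
    have hcd : ∀ B ∈ nb U a S, (powersetCard a (U \ B)).card = (U.card - a).choose a := by
      intro B hB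
      have hB' := (mem_nb.1 hB).1
      rw [card_powersetCard, card_sdiff_of_subset hB'.1, hB'.2]
    rw [sum_congr rfl hl, sum_const, heq, ← sum_const, ← sum_congr rfl hcd] at hsum
    have := (sum_eq_sum_iff_of_le (fun B hB => card_le_card (hsub B hB))).1 hsum.symm
    intro B hB
    exact eq_of_subset_of_card_le (hsub B hB) (this B hB).ge
  have hfull : S = powersetCard a U := by
    apply swap_closed hS _ hne
    intro A hA x hx y hy hyA
    have hA' := mem_powersetCard.1 (hS hA)
    have hins : (insert y A) ⊆ U := insert_subset hy hA'.1
    obtain ⟨B, hB1, hB2⟩ := exists_subset_card_eq (s := U \ insert y A) (n := a)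
      (by rw [card_sdiff_of_subset hins, card_insert_of_notMem hyA]; omega)
    rw [subset_sdiff] at hB1
    have hBm : B ∈ nb U a S := mem_nb.2 ⟨⟨hB1.1, hB2⟩, A, hA,
      (hB1.2.mono_right (subset_insert _ _)).symm⟩
    have : insert y (A.erase x) ∈ powersetCard a (U \ B) := by
      have h1 : insert y (A.erase x) ⊆ insert y A := insert_subset_insert _ (erase_subset _ _)
      rw [mem_powersetCard, subset_sdiff]
      refine ⟨⟨h1.trans hins, (hB1.2.mono_right h1).symm⟩, ?_⟩
      rw [card_insert_of_notMem (fun h => hyA (mem_of_mem_erase h)), card_erase_of_mem hx]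
      have : 0 < A.card := card_pos.2 ⟨x, hx⟩
      omega
    rw [← key B hBm] at this
    exact (mem_filter.1 this).1
  rw [hfull, card_powersetCard] at hlt
  exact lt_irrefl _ hlt

lemma nb_lt {U : Finset α} {a b : ℕ} {S : Finset (Finset α)} (hS : S ⊆ powersetCard a U)
    (hab : a ≤ b) (h : a + b < U.card) (hne : S.Nonempty) (hlt : S.card < U.card.choose b) :
    S.card < (nb U b S).card := by
  rcases hab.eq_or_lt with rfl | hab
  · exact nb_lt_eq hS h hne hlt
  have h1 := nb_lym hS h.le
  have h2 := choose_lt hab h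
  have h3 : 0 < S.card := card_pos.2 hne
  by_contra hc
  push Not at hc
  have := Nat.mul_le_mul_right (U.card.choose a) hc
  have := Nat.mul_lt_mul_of_pos_left h2 h3
  omega

end Div5

end Part1

section Part2

namespace Div5
open Finset
open scoped FinsetFamily

lemma exists_initSeg_card (N r g : ℕ) (hg : g ≤ N.choose r) :
    ∃ C : Finset (Finset (Fin N)), Finset.Colex.IsInitSeg C r ∧ C.card = g := by
  induction g with
  | zero => exact ⟨∅, Finset.Colex.isInitSeg_empty, rfl⟩
  | succ g ih =>
    obtain ⟨C, hC, hcard⟩ := ih (by omega)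
    have hsub : C ⊆ powersetCard r univ := by
      intro A hA
      exact mem_powersetCard.2 ⟨subset_univ _, hC.1 hA⟩
    have hne : (powersetCard r (univ : Finset (Fin N)) \ C).Nonempty := by
      rw [← card_pos, card_sdiff_of_subset hsub, card_powersetCard, card_univ, Fintype.card_fin]
      omega
    obtain ⟨A, hA, hmin⟩ := exists_min_image _ (fun A => toColex A) hne
    rw [mem_sdiff, mem_powersetCard] at hA
    refine ⟨insert A C, ⟨?_, ?_⟩, by rw [card_insert_of_notMem hA.2, hcard]⟩
    · intro B hB
      rcases mem_insert.1 (mem_coe.1 hB) with rfl | hB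
      · exact hA.1.2
      · exact hC.1 hB
    · rintro s t hs ⟨hlt, ht⟩
      rcases mem_insert.1 hs with rfl | hs
      · by_contra hn
        have := hmin t (mem_sdiff.2 ⟨mem_powersetCard.2 ⟨subset_univ _, ht⟩,
          fun h => hn (mem_insert_of_mem h)⟩)
        exact absurd hlt (not_lt.2 this)
      · exact mem_insert_of_mem (hC.2 hs ⟨hlt, ht⟩)

/-- first `x` elements of `Fin N` -/
def Rx (N x : ℕ) : Finset (Fin N) := univ.filter (fun i => i.val < x)

lemma mem_Rx {N x : ℕ} {i : Fin N} : i ∈ Rx N x ↔ i.val < x := by simp [Rx]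

lemma card_Rx {N x : ℕ} (h : x ≤ N) : (Rx N x).card = x := by
  simp [Rx, Fin.card_filter_val_lt, h]

lemma isInitSeg_Rx (N x r : ℕ) : Finset.Colex.IsInitSeg (powersetCard r (Rx N x)) r := by
  constructor
  · intro A hA
    exact (mem_powersetCard.1 (mem_coe.1 hA)).2
  · rintro s t hs ⟨hlt, ht⟩
    rw [mem_powersetCard] at hs ⊢
    refine ⟨?_, ht⟩
    intro i hi
    by_cases hx : x < N
    · have := Finset.Colex.forall_lt_mono (a := (⟨x, hx⟩ : Fin N)) hlt.le
        (fun b hb => by simpa [Fin.lt_def] using mem_Rx.1 (hs.1 hb)) i hi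
      exact mem_Rx.2 (by simpa [Fin.lt_def] using this)
    · exact mem_Rx.2 (by have := i.2; omega)

lemma small_sub {N x r : ℕ} (hx : x ≤ N) {C : Finset (Finset (Fin N))}
    (hC : Finset.Colex.IsInitSeg C r) (h : C.card ≤ x.choose r) : C ⊆ powersetCard r (Rx N x) := by
  rcases hC.total (isInitSeg_Rx N x r) with h1 | h1
  · exact h1
  · exact (eq_of_subset_of_card_le h1 (by rwa [card_powersetCard, card_Rx hx])).ge

lemma big_sub {N x r : ℕ} (hx : x ≤ N) {C : Finset (Finset (Fin N))}
    (hC : Finset.Colex.IsInitSeg C r) (h : x.choose r ≤ C.card) : powersetCard r (Rx N x) ⊆ C := by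
  rcases hC.total (isInitSeg_Rx N x r) with h1 | h1
  · exact (eq_of_subset_of_card_le h1 (by rwa [card_powersetCard, card_Rx hx])).ge
  · exact h1

/-- complements inside `R` -/
def compl {α : Type*} [DecidableEq α] (R : Finset α) (C : Finset (Finset α)) : Finset (Finset α) :=
  C.image (fun A => R \ A)

lemma card_compl {α : Type*} [DecidableEq α] {R : Finset α} {C : Finset (Finset α)} {r : ℕ}
    (hC : C ⊆ powersetCard r R) : (compl R C).card = C.card := by
  apply card_image_of_injOn
  intro A hA B hB hAB
  have h1 := (mem_powersetCard.1 (hC hA)).1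
  have h2 := (mem_powersetCard.1 (hC hB)).1
  simp only at hAB
  rw [← Finset.sdiff_sdiff_eq_self h1, hAB, Finset.sdiff_sdiff_eq_self h2]

lemma compl_sub {α : Type*} [DecidableEq α] {R : Finset α} {C : Finset (Finset α)} {r : ℕ}
    (hC : C ⊆ powersetCard r R) : compl R C ⊆ powersetCard (R.card - r) R := by
  intro A hA
  obtain ⟨B, hB, rfl⟩ := mem_image.1 hA
  have h1 := (mem_powersetCard.1 (hC hB))
  rw [mem_powersetCard, card_sdiff_of_subset h1.1, h1.2]
  exact ⟨sdiff_subset, rfl⟩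

lemma nb_sub_shadow {α : Type*} [DecidableEq α] {R : Finset α} {C : Finset (Finset α)} {r l : ℕ}
    (hlr : l ≤ r) (hC : C ⊆ powersetCard r R) : nb R l (compl R C) ⊆ ∂^[r - l] C := by
  intro B hB
  rw [mem_nb] at hB
  obtain ⟨⟨h1, h2⟩, A', hA', h3⟩ := hB
  obtain ⟨A, hA, rfl⟩ := mem_image.1 hA'
  rw [mem_shadow_iterate_iff_exists_mem_card_add]
  refine ⟨A, hA, ?_, ?_⟩
  · intro y hy
    by_contra hn
    exact (disjoint_left.1 h3 (mem_sdiff.2 ⟨h1 hy, hn⟩)) hy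
  · rw [(mem_powersetCard.1 (hC hA)).2, h2]; omega

theorem kk_transfer {α : Type*} [DecidableEq α] {U : Finset α} {a b : ℕ} {S : Finset (Finset α)}
    (hS : S ⊆ powersetCard a U) (hab : a + b ≤ U.card)
    {C : Finset (Finset (Fin U.card))} (hC : Finset.Colex.IsInitSeg C (U.card - a))
    (hle : C.card ≤ S.card) : (∂^[U.card - a - b] C).card ≤ (nb U b S).card := by
  classical
  let e := U.equivFin
  let f : Finset α → Finset (Fin U.card) := fun A => univ.filter (fun i => (e.symm i).1 ∉ A)
  let g : Fin U.card ↪ α := ⟨fun i => (e.symm i).1, fun i j h => e.symm.injective (Subtype.ext h)⟩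
  have hfmap : ∀ A, (f A).map g = U \ A := by
    intro A
    ext y
    simp only [mem_map, f, g, mem_filter, mem_univ, true_and, Function.Embedding.coeFn_mk, mem_sdiff]
    constructor
    · rintro ⟨i, hi, rfl⟩
      exact ⟨(e.symm i).2, hi⟩
    · rintro ⟨hy, hyA⟩
      have h0 : (e.symm (e ⟨y, hy⟩)).1 = y := by rw [Equiv.symm_apply_apply]
      exact ⟨e ⟨y, hy⟩, by rw [h0]; exact hyA, h0⟩
  have hinj : Set.InjOn f S := by
    intro A hA B hB hAB
    have h1 := (mem_powersetCard.1 (hS hA)).1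
    have h2 := (mem_powersetCard.1 (hS hB)).1
    rw [← Finset.sdiff_sdiff_eq_self h1, ← hfmap A, hAB, hfmap, Finset.sdiff_sdiff_eq_self h2]
  have hsz : ((S.image f : Finset (Finset (Fin U.card))) : Set (Finset (Fin U.card))).Sized
      (U.card - a) := by
    intro B hB
    obtain ⟨A, hA, rfl⟩ := mem_image.1 (mem_coe.1 hB)
    have h1 := mem_powersetCard.1 (hS hA)
    rw [← card_map g, hfmap, card_sdiff_of_subset h1.1, h1.2]
  have h1 := iterated_kk (k := U.card - a - b) hsz (by rwa [card_image_of_injOn hinj]) hC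
  refine h1.trans ?_
  apply card_le_card_of_injOn (fun B => B.map g)
  · intro B hB
    obtain ⟨A', hA', hBA, hc⟩ := mem_shadow_iterate_iff_exists_mem_card_add.1 (mem_coe.1 hB)
    have hsA := hsz (mem_coe.2 hA')
    obtain ⟨A, hA, rfl⟩ := mem_image.1 hA'
    have hsub : B.map g ⊆ U \ A := by rw [← hfmap]; exact map_subset_map.2 hBA
    rw [subset_sdiff] at hsub
    exact mem_coe.2 (mem_nb.2 ⟨⟨hsub.1, by rw [card_map]; omega⟩, A, hA, hsub.2.symm⟩)
  · intro B _ B' _ h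
    exact map_injective g h

variable {α : Type*} [DecidableEq α]

lemma card_le_choose {U : Finset α} {a : ℕ} {S : Finset (Finset α)} (hS : S ⊆ powersetCard a U) :
    S.card ≤ U.card.choose a := by
  rw [← card_powersetCard]; exact card_le_card hS

lemma exists_seg {U : Finset α} {a : ℕ} {S : Finset (Finset α)}
    (hS : S ⊆ powersetCard a U) (ha : a ≤ U.card) :
    ∃ C : Finset (Finset (Fin U.card)), Finset.Colex.IsInitSeg C (U.card - a) ∧ C.card = S.card :=
  exists_initSeg_card _ _ _ (by rw [Nat.choose_symm ha]; exact card_le_choose hS)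

lemma kk1 {U : Finset α} {a b j : ℕ} {S : Finset (Finset α)}
    (hS : S ⊆ powersetCard a U) (hab : a + b ≤ U.card) (hj : j ≤ a) (hb : a ≤ b + j)
    (hc : S.card ≤ (U.card - j).choose (a - j)) : S.card ≤ (nb U b S).card := by
  obtain ⟨C, hC, hcard⟩ := exists_seg hS (by omega)
  have hx : U.card - j ≤ U.card := by omega
  have hsub := small_sub hx hC (by
    rw [hcard, ← Nat.choose_symm (by omega : U.card - a ≤ U.card - j)]
    convert hc using 2; omega)
  have h1 := nb_le (b := b) (compl_sub hsub) (by rw [card_Rx hx]; omega) (by rw [card_Rx hx]; omega)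
  rw [card_compl hsub, hcard] at h1
  refine h1.trans ((card_le_card (nb_sub_shadow (by omega) hsub)).trans ?_)
  exact kk_transfer hS hab hC hcard.le

lemma kk1_lt {U : Finset α} {a b j : ℕ} {S : Finset (Finset α)}
    (hS : S ⊆ powersetCard a U) (hab : a + b < U.card) (hj : j ≤ a) (hb : a = b + j)
    (hne : S.Nonempty)
    (hc : S.card < (U.card - j).choose b) : S.card < (nb U b S).card := by
  obtain ⟨C, hC, hcard⟩ := exists_seg hS (by omega)
  have hx : U.card - j ≤ U.card := by omega
  have hsub := small_sub hx hC (by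
    rw [hcard, ← Nat.choose_symm (by omega : U.card - a ≤ U.card - j)]
    rw [show U.card - j - (U.card - a) = b by omega]; exact hc.le)
  have h1 := nb_lt (b := b) (compl_sub hsub) (by rw [card_Rx hx]; omega) (by rw [card_Rx hx]; omega)
    (by rw [← card_pos, card_compl hsub, hcard, card_pos]; exact hne)
    (by rw [card_compl hsub, hcard, card_Rx hx]; exact hc)
  rw [card_compl hsub, hcard] at h1
  refine h1.trans_le ((card_le_card (nb_sub_shadow (by omega) hsub)).trans ?_)
  exact kk_transfer hS hab.le hC hcard.le

/-- Lovasz form. -/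
lemma kk0 {U : Finset α} {a b j : ℕ} {S : Finset (Finset α)}
    (hS : S ⊆ powersetCard a U) (hab : a + b ≤ U.card) (hj : j ≤ a)
    (hc : (U.card - j).choose (a - j) ≤ S.card) : (U.card - j).choose b ≤ (nb U b S).card := by
  have hx : U.card - j ≤ U.card := by omega
  have hcc : (powersetCard (U.card - a) (Rx U.card (U.card - j))).card ≤ S.card := by
    rw [card_powersetCard, card_Rx hx, ← Nat.choose_symm (by omega : U.card - a ≤ U.card - j)]
    convert hc using 2; omega
  refine le_trans ?_ (kk_transfer hS hab (isInitSeg_Rx _ (U.card - j) _) hcc)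
  have : powersetCard b (Rx U.card (U.card - j)) ⊆
      ∂^[U.card - a - b] (powersetCard (U.card - a) (Rx U.card (U.card - j))) := by
    intro B hB
    rw [mem_powersetCard] at hB
    rw [mem_shadow_iterate_iff_exists_mem_card_add]
    obtain ⟨A, hBA, hA, hAc⟩ := exists_subsuperset_card_eq hB.1 (n := U.card - a) (by omega)
      (by rw [card_Rx hx]; omega)
    exact ⟨A, mem_powersetCard.2 ⟨hA, hAc⟩, hBA, by omega⟩
  have := card_le_card this
  rwa [card_powersetCard, card_Rx hx] at this

lemma kk2 {U : Finset α} {a b j : ℕ} {S : Finset (Finset α)}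
    (hS : S ⊆ powersetCard a U) (hab : a + b ≤ U.card) (hj1 : 1 ≤ j) (hj : j ≤ a)
    (hb : a + 2 ≤ b + j) (hjU : a < U.card)
    (hc : (U.card - j).choose (a - j) ≤ S.card)
    (hc2 : S.card ≤ (U.card - j + 1).choose (a - j + 1)) :
    (U.card - j).choose b + S.card ≤ (nb U b S).card + (U.card - j).choose (a - j) := by
  obtain ⟨C, hC, hcard⟩ := exists_seg hS (by omega)
  obtain ⟨x, hxdef⟩ : ∃ x, x = U.card - j := ⟨_, rfl⟩
  rw [← hxdef] at hc hc2 ⊢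
  have hx : x ≤ U.card := by omega
  have hx1 : x + 1 ≤ U.card := by omega
  have hsub := small_sub hx1 hC (by
    rw [hcard, ← Nat.choose_symm (by omega : U.card - a ≤ x + 1)]
    convert hc2 using 2; omega)
  have hchoose : x.choose (U.card - a) = x.choose (a - j) := by
    rw [← Nat.choose_symm (by omega : U.card - a ≤ x)]
    congr 1; omega
  have hbig := big_sub hx hC (by rw [hcard, hchoose]; exact hc)
  let p : Fin U.card := ⟨x, by omega⟩
  have hpR : p ∉ Rx U.card x := by rw [mem_Rx]; simp [p]
  have hRx1 : ∀ i ∈ Rx U.card (x+1), i ≠ p → i ∈ Rx U.card x := by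
    intro i hi hip
    rw [mem_Rx] at *
    have : i.val ≠ x := fun h => hip (Fin.ext h)
    omega
  let D := C.memberSubfamily p
  have hD : D ⊆ powersetCard (U.card - a - 1) (Rx U.card x) := by
    intro A hA
    rw [mem_memberSubfamily] at hA
    have h1 := mem_powersetCard.1 (hsub hA.1)
    rw [card_insert_of_notMem hA.2] at h1
    refine mem_powersetCard.2 ⟨fun i hi => hRx1 i (h1.1 (mem_insert_of_mem hi))
      (fun h => hA.2 (h ▸ hi)), by omega⟩
  have hnm : C.nonMemberSubfamily p = powersetCard (U.card - a) (Rx U.card x) := by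
    ext A
    rw [mem_nonMemberSubfamily]
    constructor
    · rintro ⟨h1, h2⟩
      have h3 := mem_powersetCard.1 (hsub h1)
      exact mem_powersetCard.2 ⟨fun i hi => hRx1 i (h3.1 hi) (fun h => h2 (h ▸ hi)), h3.2⟩
    · intro h
      exact ⟨hbig h, fun hp => hpR ((mem_powersetCard.1 h).1 hp)⟩
  have hDc : D.card + x.choose (a - j) = S.card := by
    have := card_memberSubfamily_add_card_nonMemberSubfamily p C
    rw [hnm, card_powersetCard, card_Rx hx, hchoose, hcard] at this
    exact this
  have h1 := nb_le (b := b - 1) (compl_sub hD) (by rw [card_Rx hx]; omega)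
    (by rw [card_Rx hx]; omega)
  rw [card_compl hD] at h1
  have h2 : x.choose b + (nb (Rx U.card x) (b-1) (compl (Rx U.card x) D)).card ≤ (∂^[U.card - a - b] C).card := by
    have e1 := card_memberSubfamily_add_card_nonMemberSubfamily p (∂^[U.card - a - b] C)
    have e2 : nb (Rx U.card x) (b-1) (compl (Rx U.card x) D) ⊆ (∂^[U.card - a - b] C).memberSubfamily p := by
      intro B hB
      have hBR := (mem_nb.1 hB).1
      have hpB : p ∉ B := fun h => hpR (hBR.1 h)
      have := nb_sub_shadow (by omega) hD hB
      obtain ⟨A, hA, hBA, hcd⟩ := mem_shadow_iterate_iff_exists_mem_card_add.1 this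
      rw [mem_memberSubfamily, mem_shadow_iterate_iff_exists_mem_card_add]
      refine ⟨⟨insert p A, (mem_memberSubfamily.1 hA).1, insert_subset_insert _ hBA, ?_⟩, hpB⟩
      rw [card_insert_of_notMem hpB, card_insert_of_notMem (mem_memberSubfamily.1 hA).2]
      omega
    have e3 : powersetCard b (Rx U.card x) ⊆ (∂^[U.card - a - b] C).nonMemberSubfamily p := by
      intro B hB
      rw [mem_powersetCard] at hB
      rw [mem_nonMemberSubfamily, mem_shadow_iterate_iff_exists_mem_card_add]
      obtain ⟨A, hBA, hA, hAc⟩ := exists_subsuperset_card_eq hB.1 (n := U.card - a) (by omega)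
        (by rw [card_Rx hx]; omega)
      exact ⟨⟨A, hbig (mem_powersetCard.2 ⟨hA, hAc⟩), hBA, by omega⟩, fun h => hpR (hB.1 h)⟩
    have e4 := card_le_card e2
    have e5 := card_le_card e3
    rw [card_powersetCard, card_Rx hx] at e5
    omega
  have h3 := kk_transfer hS hab hC hcard.le
  omega

end Div5

end Part2

section Part3

namespace Div5
open Finset

variable {α : Type*} [DecidableEq α]

/-- members containing `P` and avoiding `Q` -/
def sub (S : Finset (Finset α)) (P Q : Finset α) : Finset (Finset α) :=
  S.filter (fun A => P ⊆ A ∧ Disjoint Q A)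

lemma mem_sub {S : Finset (Finset α)} {P Q A : Finset α} :
    A ∈ sub S P Q ↔ A ∈ S ∧ P ⊆ A ∧ Disjoint Q A := by
  simp [sub]

lemma sub_empty (S : Finset (Finset α)) : sub S ∅ ∅ = S := by
  ext A; simp [mem_sub]

lemma sub_sub (S : Finset (Finset α)) (P Q : Finset α) : sub S P Q ⊆ S := filter_subset _ _

lemma branch (S : Finset (Finset α)) (P Q : Finset α) (z : α) :
    (sub S P Q).card = (sub S (insert z P) Q).card + (sub S P (insert z Q)).card := by
  rw [← card_filter_add_card_filter_not (s := sub S P Q) (fun A => z ∈ A)]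
  congr 2
  · ext A
    simp only [mem_filter, mem_sub, insert_subset_iff]
    tauto
  · ext A
    simp only [mem_filter, mem_sub, disjoint_insert_left]
    tauto

lemma leaf_data {U : Finset α} {a b : ℕ} {S : Finset (Finset α)} {P Q : Finset α}
    (hS : S ⊆ powersetCard a U) (hQ : Q ⊆ U) (hPQ : Disjoint P Q) (hQb : Q.card ≤ b) :
    ∃ S' : Finset (Finset α), S' ⊆ powersetCard (a - P.card) (U \ (P ∪ Q)) ∧
      S'.card = (sub S P Q).card ∧
      (nb (U \ (P ∪ Q)) (b - Q.card) S').card ≤ (sub (nb U b S) Q P).card := by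
  refine ⟨(sub S P Q).image (fun A => A \ P), ?_, ?_, ?_⟩
  · intro A' hA'
    obtain ⟨A, hA, rfl⟩ := mem_image.1 hA'
    rw [mem_sub] at hA
    have h := mem_powersetCard.1 (hS hA.1)
    rw [mem_powersetCard, card_sdiff_of_subset hA.2.1, h.2]
    refine ⟨?_, rfl⟩
    intro y hy
    rw [mem_sdiff] at hy
    rw [mem_sdiff, mem_union]
    exact ⟨h.1 hy.1, fun h' => h'.elim hy.2 (fun h'' => disjoint_left.1 hA.2.2 h'' hy.1)⟩
  · apply card_image_of_injOn
    intro A hA B hB hAB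
    have h1 := (mem_sub.1 (mem_coe.1 hA)).2.1
    have h2 := (mem_sub.1 (mem_coe.1 hB)).2.1
    simp only at hAB
    rw [← sdiff_union_of_subset h1, hAB, sdiff_union_of_subset h2]
  · apply card_le_card_of_injOn (fun B => B ∪ Q)
    · intro B hB
      obtain ⟨⟨h1, h2⟩, A', hA', h3⟩ := mem_nb.1 (mem_coe.1 hB)
      obtain ⟨A, hA, rfl⟩ := mem_image.1 hA'
      rw [mem_sub] at hA
      rw [subset_sdiff, disjoint_union_right] at h1
      apply mem_coe.2
      rw [mem_sub, mem_nb]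
      refine ⟨⟨⟨union_subset h1.1 hQ, ?_⟩, A, hA.1, ?_⟩, subset_union_right, ?_⟩
      · rw [card_union_of_disjoint h1.2.2]; omega
      · rw [disjoint_union_right]
        refine ⟨?_, hA.2.2.symm⟩
        have : A = (A \ P) ∪ P := (sdiff_union_of_subset hA.2.1).symm
        rw [this, disjoint_union_left]
        exact ⟨h3, h1.2.1.symm⟩
      · rw [disjoint_union_right]
        exact ⟨h1.2.1.symm, hPQ⟩
    · intro B hB B' hB' h
      have h1 := (mem_nb.1 (mem_coe.1 hB)).1.1
      have h2 := (mem_nb.1 (mem_coe.1 hB')).1.1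
      rw [subset_sdiff, disjoint_union_right] at h1 h2
      simp only at h
      have := congrArg (· \ Q) h
      simp only [union_sdiff_right] at this
      rwa [sdiff_eq_self_of_disjoint h1.2.2, sdiff_eq_self_of_disjoint h2.2.2] at this

lemma card_rest {U P Q : Finset α} (hP : P ⊆ U) (hQ : Q ⊆ U) (hPQ : Disjoint P Q) :
    (U \ (P ∪ Q)).card = U.card - P.card - Q.card := by
  rw [card_sdiff_of_subset (union_subset hP hQ), card_union_of_disjoint hPQ]; omega

lemma leaf_weak {U : Finset α} {a b : ℕ} {S : Finset (Finset α)} {P Q : Finset α}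
    (hS : S ⊆ powersetCard a U) (hQ : Q ⊆ U) (hP : P ⊆ U) (hPQ : Disjoint P Q)
    (hab : a + b ≤ U.card) (h : a + Q.card ≤ b + P.card) :
    (sub S P Q).card ≤ (sub (nb U b S) Q P).card := by
  rcases (sub S P Q).eq_empty_or_nonempty with h0 | ⟨A, hA⟩
  · rw [h0]; simp
  rw [mem_sub] at hA
  have h1 := card_le_card hA.2.1
  rw [(mem_powersetCard.1 (hS hA.1)).2] at h1
  obtain ⟨S', h2, h3, h4⟩ := leaf_data (b := b) hS hQ hPQ (by omega)
  have h5 := nb_le (b := b - Q.card) h2 (by omega) (by rw [card_rest hP hQ hPQ]; omega)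
  omega

/-- strict comparison unless empty -/
def Gd (S N : Finset (Finset α)) (P Q : Finset α) : Prop :=
  sub S P Q = ∅ ∨ (sub S P Q).card < (sub N Q P).card

lemma Gd.le {S N : Finset (Finset α)} {P Q : Finset α} (h : Gd S N P Q) :
    (sub S P Q).card ≤ (sub N Q P).card := by
  rcases h with h | h
  · rw [h]; simp
  · exact h.le

lemma Gd.branch {S N : Finset (Finset α)} {P Q : Finset α} (z : α)
    (h1 : Gd S N (insert z P) Q) (h2 : Gd S N P (insert z Q)) : Gd S N P Q := by
  have e1 := Div5.branch S P Q z
  have e2 := Div5.branch N Q P z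
  have l1 := h1.le
  have l2 := h2.le
  rcases h1 with h1 | h1
  · rcases h2 with h2 | h2
    · left
      rw [h1, h2] at e1
      exact card_eq_zero.1 (by simpa using e1)
    · right; omega
  · right; omega

lemma leaf_strict {U : Finset α} {a b : ℕ} {S : Finset (Finset α)} {P Q : Finset α}
    (hS : S ⊆ powersetCard a U) (hQ : Q ⊆ U) (hP : P ⊆ U) (hPQ : Disjoint P Q)
    (hab : a + b < U.card) (h : a + Q.card ≤ b + P.card)
    (hc : (sub S P Q).card < (U.card - P.card - Q.card).choose (b - Q.card)) :
    Gd S (nb U b S) P Q := by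
  rcases (sub S P Q).eq_empty_or_nonempty with h0 | ⟨A, hA⟩
  · left; exact h0
  right
  have hpos := card_pos.2 ⟨A, hA⟩
  rw [mem_sub] at hA
  have h1 := card_le_card hA.2.1
  rw [(mem_powersetCard.1 (hS hA.1)).2] at h1
  obtain ⟨S', h2, h3, h4⟩ := leaf_data (b := b) hS hQ hPQ (by omega)
  have h5 := nb_lt (b := b - Q.card) h2 (by omega) (by rw [card_rest hP hQ hPQ]; omega)
    (card_pos.1 (by omega)) (by rw [h3, card_rest hP hQ hPQ]; exact hc)
  omega

lemma leaf_strict' {U : Finset α} {a b : ℕ} {S : Finset (Finset α)} {P Q : Finset α}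
    (hS : S ⊆ powersetCard a U) (hQ : Q ⊆ U) (hP : P ⊆ U) (hPQ : Disjoint P Q)
    (hab : a + b < U.card) (h : a + Q.card < b + P.card) :
    Gd S (nb U b S) P Q := by
  rcases (sub S P Q).eq_empty_or_nonempty with h0 | ⟨A, hA⟩
  · left; exact h0
  rw [mem_sub] at hA
  have h1 := card_le_card hA.2.1
  rw [(mem_powersetCard.1 (hS hA.1)).2] at h1
  apply leaf_strict hS hQ hP hPQ hab h.le
  obtain ⟨S', h2, h3, h4⟩ := leaf_data (b := b) hS hQ hPQ (by omega)
  rw [← h3]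
  refine (card_le_choose h2).trans_lt ?_
  rw [card_rest hP hQ hPQ]
  exact choose_lt (by omega) (by omega)

/-- leaf using Kruskal-Katona -/
lemma leaf_kk {U : Finset α} {a b j : ℕ} {S : Finset (Finset α)} {P Q : Finset α}
    (hS : S ⊆ powersetCard a U) (hQ : Q ⊆ U) (hP : P ⊆ U) (hPQ : Disjoint P Q)
    (hab : a + b < U.card) (h : a + Q.card = b + P.card + j) (hQb : Q.card ≤ b)
    (hPa : P.card + j ≤ a)
    (hc : (sub S P Q).card < (U.card - P.card - Q.card - j).choose (b - Q.card)) :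
    Gd S (nb U b S) P Q := by
  rcases (sub S P Q).eq_empty_or_nonempty with h0 | hne
  · left; exact h0
  right
  have hpos := card_pos.2 hne
  obtain ⟨S', h2, h3, h4⟩ := leaf_data (b := b) hS hQ hPQ (by omega)
  have h5 := kk1_lt (b := b - Q.card) (j := j) h2 (by rw [card_rest hP hQ hPQ]; omega) (by omega)
    (by omega) (card_pos.1 (by omega)) (by rw [h3, card_rest hP hQ hPQ]; exact hc)
  omega

end Div5

end Part3

section Part4

namespace Div5
open Finset

variable {α : Type*} [DecidableEq α]

/-- neighbours which meet every member of `M` -/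
def tn (U : Finset α) (b : ℕ) (M S : Finset (Finset α)) : Finset (Finset α) :=
  (nb U b S).filter (fun B => ∀ A ∈ M, ¬ Disjoint A B)

lemma sub_tn {U : Finset α} {b : ℕ} {M S : Finset (Finset α)} {P Q : Finset α}
    (h : ∀ A ∈ M, ¬ Disjoint A Q) : sub (tn U b M S) Q P = sub (nb U b S) Q P := by
  ext B
  simp only [mem_sub, tn, mem_filter]
  constructor
  · tauto
  · rintro ⟨h1, h2, h3⟩
    exact ⟨⟨h1, fun A hA hd => h A hA (hd.mono_right h2)⟩, h2, h3⟩

lemma Gd_tn {U : Finset α} {b : ℕ} {M S : Finset (Finset α)} {P Q : Finset α}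
    (h : ∀ A ∈ M, ¬ Disjoint A Q) (hg : Gd S (nb U b S) P Q) : Gd S (tn U b M S) P Q := by
  rw [Gd, sub_tn h]; exact hg

lemma PQ_le {U P Q : Finset α} (hP : P ⊆ U) (hQ : Q ⊆ U) (hPQ : Disjoint P Q) :
    P.card + Q.card ≤ U.card := by
  rw [← card_union_of_disjoint hPQ]; exact card_le_card (union_subset hP hQ)

lemma card_sub_le {U : Finset α} {a : ℕ} {S : Finset (Finset α)} {P Q : Finset α}
    (hS : S ⊆ powersetCard a U) (hQ : Q ⊆ U) (hP : P ⊆ U) (hPQ : Disjoint P Q) :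
    (sub S P Q).card ≤ (U.card - P.card - Q.card).choose (a - P.card) := by
  obtain ⟨S', h2, h3, _⟩ := leaf_data (b := Q.card) hS hQ hPQ le_rfl
  rw [← h3, ← card_rest hP hQ hPQ]
  exact card_le_choose h2

lemma claim1 {U : Finset α} {k : ℕ} {M S : Finset (Finset α)} (hk : 1 ≤ k)
    (hU : 2 * k ≤ U.card) (hM : M ⊆ powersetCard k U) (hS : S ⊆ powersetCard k U)
    (hSM : ∀ A ∈ S, A ∉ M) (d : ℕ) : ∀ (P Q : Finset α), U.card - P.card - Q.card = d →
    P ⊆ U → Q ⊆ U → Disjoint P Q →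
    Q.card + (M.filter (fun A => Disjoint A Q)).card + 2 ≤ P.card →
    Gd S (tn U (k-1) M S) P Q := by
  induction d using Nat.strong_induction_on with
  | _ d ih =>
    intro P Q hd hP hQ hPQ h
    rcases (M.filter (fun A => Disjoint A Q)).eq_empty_or_nonempty with h0 | ⟨A, hA⟩
    · apply Gd_tn
      · intro A hA hn
        have : A ∈ M.filter (fun A => Disjoint A Q) := mem_filter.2 ⟨hA, hn⟩
        rw [h0] at this
        exact absurd this (notMem_empty _)
      · exact leaf_strict' hS hQ hP hPQ (by omega) (by omega)
    · have hA' := mem_filter.1 hA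
      have hAk := mem_powersetCard.1 (hM hA'.1)
      by_cases hAP : A ⊆ P
      · left
        rw [eq_empty_iff_forall_notMem]
        intro B hB
        rw [mem_sub] at hB
        have hBk := mem_powersetCard.1 (hS hB.1)
        have : A = B := eq_of_subset_of_card_le (hAP.trans hB.2.1) (by omega)
        exact hSM B hB.1 (this ▸ hA'.1)
      · obtain ⟨z, hzA, hzP⟩ := not_subset.1 hAP
        have hzU := hAk.1 hzA
        have hzQ : z ∉ Q := fun hz => disjoint_left.1 hA'.2 hzA hz
        have hP' : insert z P ⊆ U := insert_subset hzU hP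
        have hQ' : insert z Q ⊆ U := insert_subset hzU hQ
        have d1 : Disjoint (insert z P) Q := disjoint_insert_left.2 ⟨hzQ, hPQ⟩
        have d2 : Disjoint P (insert z Q) := disjoint_insert_right.2 ⟨hzP, hPQ⟩
        have e1 := card_insert_of_notMem hzP
        have e2 := card_insert_of_notMem hzQ
        have l1 := PQ_le hP' hQ d1
        apply Gd.branch z
        · exact ih _ (by omega) _ _ rfl hP' hQ d1 (by omega)
        · refine ih _ (by omega) _ _ rfl hP hQ' d2 ?_
          have : (M.filter (fun A => Disjoint A (insert z Q))).card
              < (M.filter (fun A => Disjoint A Q)).card := by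
            apply card_lt_card
            rw [ssubset_iff_of_subset]
            · refine ⟨A, hA, fun h => ?_⟩
              exact disjoint_left.1 (mem_filter.1 h).2 hzA (mem_insert_self _ _)
            · intro B hB
              rw [mem_filter] at hB ⊢
              exact ⟨hB.1, hB.2.mono_right (subset_insert _ _)⟩
          omega

lemma claim2 {U : Finset α} {k : ℕ} {M S : Finset (Finset α)} (hk : 1 ≤ k)
    (hU : 2 * k ≤ U.card) (hM : M ⊆ powersetCard k U) (hS : S ⊆ powersetCard k U)
    (hSM : ∀ A ∈ S, A ∉ M) (T : Finset α) (hT : T.card = 3) (hTM : ∀ A ∈ M, T ⊆ A)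
    (x : Finset α → α) (hx : ∀ A ∈ M, x A ∈ U ∧ x A ∉ A ∧ ∀ B ∈ M, B ≠ A → x A ∈ B)
    (d : ℕ) : ∀ (P : Finset α), U.card - P.card = d →
    P ⊆ U → T ⊆ P → 4 ≤ P.card →
    Gd S (tn U (k-1) M S) P ∅ := by
  induction d using Nat.strong_induction_on with
  | _ d ih =>
    intro P hd hP hTP h4
    by_cases hall : M.image x ⊆ P
    · apply claim1 hk hU hM hS hSM _ _ _ rfl hP (empty_subset _) (disjoint_empty_right _)
      have h1 : (M.image x).card = M.card := by
        apply card_image_of_injOn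
        intro A hA B hB hAB
        by_contra hne
        exact (hx A hA).2.1 (hAB ▸ (hx B hB).2.2 A hA hne)
      have h2 : Disjoint (M.image x) T := by
        rw [disjoint_left]
        intro y hy hyT
        obtain ⟨A, hA, rfl⟩ := mem_image.1 hy
        exact (hx A hA).2.1 (hTM A hA hyT)
      have h3 := PQ_le hall hTP h2
      have h4 := card_filter_le M (fun A => Disjoint A ∅)
      rw [card_empty]
      omega
    · obtain ⟨y, hy, hyP⟩ := not_subset.1 hall
      obtain ⟨A, hA, rfl⟩ := mem_image.1 hy
      have hxA := hx A hA
      have e1 := card_insert_of_notMem hyP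
      have hP' : insert (x A) P ⊆ U := insert_subset hxA.1 hP
      have l1 := card_le_card hP'
      apply Gd.branch (x A)
      · exact ih _ (by omega) _ rfl hP' (hTP.trans (subset_insert _ _)) (by omega)
      · apply claim1 hk hU hM hS hSM _ _ _ rfl hP
        · simpa using hxA.1
        · simpa using hyP
        · have : M.filter (fun B => Disjoint B (insert (x A) ∅)) ⊆ {A} := by
            intro B hB
            rw [mem_filter] at hB
            rw [mem_singleton]
            by_contra hne
            exact disjoint_left.1 hB.2 (hxA.2.2 B hB.1 hne) (mem_insert_self _ _)
          have := card_le_card this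
          simp only [insert_empty_eq, card_singleton] at *
          omega

theorem lemmaE {U : Finset α} {k : ℕ} {M S : Finset (Finset α)} (hk : 5 ≤ k)
    (hU : 2 * k ≤ U.card) (hM : M ⊆ powersetCard k U) (hS : S ⊆ powersetCard k U)
    (hSM : ∀ A ∈ S, A ∉ M) (T : Finset α) (hTU : T ⊆ U) (hT : T.card = 3) (hTM : ∀ A ∈ M, T ⊆ A)
    (hx : ∀ A ∈ M, ∃ x ∈ U, x ∉ A ∧ ∀ B ∈ M, B ≠ A → x ∈ B)
    (hne : S.Nonempty) (hc : S.card ≤ (U.card - 3).choose (k - 3)) :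
    S.card < (tn U (k-1) M S).card := by
  classical
  have hx' : ∀ A, ∃ x, A ∈ M → x ∈ U ∧ x ∉ A ∧ ∀ B ∈ M, B ≠ A → x ∈ B := by
    intro A
    by_cases hA : A ∈ M
    · obtain ⟨x, h⟩ := hx A hA
      exact ⟨x, fun _ => h⟩
    · obtain ⟨y, _⟩ : U.Nonempty := card_pos.1 (by omega)
      exact ⟨y, fun h => absurd h hA⟩
  choose x hx using hx'
  have hlt : (U.card - 3).choose (k-3) < (U.card - 3).choose (k-2) :=
    choose_lt (by omega) (by omega)
  have hcs : ∀ P Q, (sub S P Q).card < (U.card - 3).choose (k-2) := fun P Q =>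
    (card_le_card (sub_sub S P Q)).trans_lt (hc.trans_lt hlt)
  have hTg : Gd S (tn U (k-1) M S) T ∅ := by
    rcases M.eq_empty_or_nonempty with h0 | ⟨A, hA⟩
    · apply claim1 (by omega) hU hM hS hSM _ _ _ rfl hTU (empty_subset _) (disjoint_empty_right _)
      rw [h0, hT]; simp
    have hxA := hx A hA
    have hAk := mem_powersetCard.1 (hM hA)
    have hTA := hTM A hA
    have hxT : x A ∉ T := fun h => hxA.2.1 (hTA h)
    obtain ⟨z, hz, z', hz', hzz⟩ := one_lt_card.1
      (by rw [card_sdiff_of_subset hTA]; omega : 1 < (A \ T).card)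
    rw [mem_sdiff] at hz hz'
    have hfil : M.filter (fun B => Disjoint B {x A}) ⊆ {A} := by
      intro B hB
      rw [mem_filter] at hB
      rw [mem_singleton]
      by_contra hne
      exact disjoint_left.1 hB.2 (hxA.2.2 B hB.1 hne) (mem_singleton_self _)
    have hfc := card_le_card hfil
    rw [card_singleton] at hfc
    have hside : ∀ w ∈ A, w ∉ T → Gd S (tn U (k-1) M S) (insert w T) {x A} := by
      intro w hw hwT
      apply claim1 (by omega) hU hM hS hSM _ _ _ rfl (insert_subset (hAk.1 hw) hTU)
      · simpa using hxA.1
      · rw [disjoint_singleton_right, mem_insert]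
        exact fun h => h.elim (fun h => hxA.2.1 (h ▸ hw)) hxT
      · rw [card_insert_of_notMem hwT, card_singleton]; omega
    have hhit : ∀ w ∈ A, ∀ B ∈ M, ¬ Disjoint B {w, x A} := by
      intro w hw B hB hd
      by_cases hBA : B = A
      · exact disjoint_left.1 hd (hBA ▸ hw) (by simp)
      · exact disjoint_left.1 hd (hxA.2.2 B hB hBA) (by simp)
    have hcard2 : ∀ w ∈ A, ({w, x A} : Finset α).card = 2 := fun w hw =>
      card_pair (fun h => hxA.2.1 (h ▸ hw))
    have hsub2 : ∀ w ∈ A, ({w, x A} : Finset α) ⊆ U := fun w hw =>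
      insert_subset (hAk.1 hw) (by simpa using hxA.1)
    have hdis2 : ∀ w, w ∉ T → Disjoint T {w, x A} := by
      intro w hw
      rw [disjoint_insert_right, disjoint_singleton_right]; exact ⟨hw, hxT⟩
    apply Gd.branch (x A)
    · apply claim2 (by omega) hU hM hS hSM T hT hTM x (fun A => hx A) _ _ rfl
        (insert_subset hxA.1 hTU) (subset_insert _ _)
      rw [card_insert_of_notMem hxT]; omega
    · rw [insert_empty_eq]
      by_cases hlt2 : (sub S T {z, x A}).card < (U.card - 3 - 2).choose (k-3)
      · refine Gd.branch z (hside z hz.1 hz.2) (Gd_tn (hhit z hz.1) ?_)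
        apply leaf_strict hS (hsub2 z hz.1) hTU (hdis2 z hz.2) (by omega)
          (by rw [hcard2 z hz.1]; omega)
        rw [hcard2 z hz.1, hT, show k - 1 - 2 = k - 3 by omega]
        exact hlt2
      · have b1 := branch S T {z, x A} z'
        have hz3 : z' ∉ ({z, x A} : Finset α) := by
          rw [mem_insert, mem_singleton]
          exact fun h => h.elim (fun h => hzz h.symm) (fun h => hxA.2.1 (h ▸ hz'.1))
        have b2 := card_sub_le (P := T) (Q := insert z' {z, x A}) hS
          (insert_subset (hAk.1 hz'.1) (hsub2 z hz.1)) hTU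
          (disjoint_insert_right.2 ⟨hz'.2, hdis2 z hz.2⟩)
        rw [hT, card_insert_of_notMem hz3, hcard2 z hz.1] at b2
        have b3 : (U.card - 3 - (2+1)).choose (k-3) < (U.card - 3 - 2).choose (k-3) := by
          obtain ⟨p, hp⟩ : ∃ p, U.card = p + 6 := ⟨U.card - 6, by omega⟩
          obtain ⟨q, hq⟩ : ∃ q, k = q + 4 := ⟨k - 4, by omega⟩
          rw [show U.card - 3 - (2+1) = p by omega, show U.card - 3 - 2 = p + 1 by omega,
            show k - 3 = q + 1 by omega, Nat.choose_succ_succ']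
          have : 0 < p.choose q := Nat.choose_pos (by omega)
          omega
        obtain ⟨B, hB⟩ : (sub S (insert z' T) {z, x A}).Nonempty := card_pos.1 (by omega)
        have hB' : B ∈ sub S (insert z' T) {x A} := by
          rw [mem_sub] at hB ⊢
          exact ⟨hB.1, hB.2.1, hB.2.2.mono_left (subset_insert _ _)⟩
        have h1 : (sub S (insert z' T) {x A}).card <
            (sub (tn U (k-1) M S) {x A} (insert z' T)).card := by
          rcases hside z' hz'.1 hz'.2 with h | h
          · rw [h] at hB'; exact absurd hB' (notMem_empty _)
          · exact h
        have h2 := leaf_weak hS (hsub2 z' hz'.1) hTU (hdis2 z' hz'.2) (b := k - 1) (by omega)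
          (by rw [hcard2 z' hz'.1, hT]; omega)
        rw [← sub_tn (M := M) (hhit z' hz'.1)] at h2
        have c1 := branch S T {x A} z'
        have c2 := branch (tn U (k-1) M S) {x A} T z'
        right
        omega
  obtain ⟨t1, t2, t3, h12, h13, h23, rfl⟩ := card_eq_three.1 hT
  have ht1 : t1 ∈ U := hTU (by simp)
  have ht2 : t2 ∈ U := hTU (by simp)
  have ht3 : t3 ∈ U := hTU (by simp)
  have hit : ∀ t ∈ ({t1, t2, t3} : Finset α), ∀ A ∈ M, ¬ Disjoint A {t} := by
    intro t ht A hA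
    rw [disjoint_singleton_right, not_not]
    exact hTM A hA ht
  have g3 : Gd S (tn U (k-1) M S) {t1, t2} {t3} := by
    apply Gd_tn (hit _ (by simp))
    apply leaf_strict hS (by simpa using ht3) (by simp [insert_subset_iff, ht1, ht2])
      (by simp [h13.symm, h23.symm]) (by omega) (by rw [card_pair h12, card_singleton]; omega)
    rw [card_pair h12, card_singleton]
    exact hcs _ _
  have g2 : Gd S (tn U (k-1) M S) {t1} {t2} := by
    apply Gd_tn (hit _ (by simp))
    apply leaf_kk (j := 1) hS (by simpa using ht2) (by simpa using ht1)
      (by simpa using h12) (by omega) (by simp only [card_singleton]; omega)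
      (by simp only [card_singleton]; omega) (by simp only [card_singleton]; omega)
    simp only [card_singleton]
    exact hcs _ _
  have g1 : Gd S (tn U (k-1) M S) ∅ {t1} := by
    apply Gd_tn (hit _ (by simp))
    apply leaf_kk (j := 2) hS (by simpa using ht1) (empty_subset _)
      (disjoint_empty_left _) (by omega) (by simp only [card_singleton, card_empty]; omega)
      (by simp only [card_singleton]; omega) (by simp only [card_empty]; omega)
    simp only [card_singleton, card_empty]
    exact hcs _ _
  have f2 : Gd S (tn U (k-1) M S) {t1, t2} ∅ := by
    apply Gd.branch t3
    · convert hTg using 1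
      ext y; simp only [mem_insert, mem_singleton]; tauto
    · exact g3
  have f1 : Gd S (tn U (k-1) M S) {t1} ∅ := by
    apply Gd.branch t2
    · convert f2 using 1
      ext y; simp only [mem_insert, mem_singleton]; tauto
    · exact g2
  have f0 : Gd S (tn U (k-1) M S) ∅ ∅ := Gd.branch t1 f1 g1
  rw [Gd, sub_empty, sub_empty] at f0
  rcases f0 with h | h
  · rw [h] at hne; exact absurd hne (by simp)
  · exact h

end Div5

end Part4

section Part5

namespace Div5
open Finset

variable {α : Type*} [DecidableEq α]

/-- cross intersecting -/
def Cr (S R : Finset (Finset α)) : Prop := ∀ A ∈ S, ∀ B ∈ R, ¬ Disjoint A B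

lemma cross_card {U : Finset α} {b : ℕ} {S R : Finset (Finset α)} (hR : R ⊆ powersetCard b U)
    (h : Cr S R) : R.card + (nb U b S).card ≤ U.card.choose b := by
  have hd : Disjoint R (nb U b S) := by
    rw [disjoint_left]
    intro B hB hB'
    obtain ⟨_, A, hA, hAB⟩ := mem_nb.1 hB'
    exact h A hA B hB hAB
  rw [← card_union_of_disjoint hd, ← card_powersetCard]
  apply card_le_card
  exact union_subset hR (filter_subset _ _)

lemma nonMem_sub {V : Finset α} {k : ℕ} {F : Finset (Finset α)} (hF : F ⊆ powersetCard k V)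
    (i : α) : F.nonMemberSubfamily i ⊆ powersetCard k (V.erase i) := by
  intro A hA
  rw [mem_nonMemberSubfamily] at hA
  have := mem_powersetCard.1 (hF hA.1)
  exact mem_powersetCard.2 ⟨subset_erase.2 ⟨this.1, hA.2⟩, this.2⟩

lemma mem_sub' {V : Finset α} {k : ℕ} {F : Finset (Finset α)} (hF : F ⊆ powersetCard k V)
    (i : α) : F.memberSubfamily i ⊆ powersetCard (k-1) (V.erase i) := by
  intro A hA
  rw [mem_memberSubfamily] at hA
  have := mem_powersetCard.1 (hF hA.1)
  rw [card_insert_of_notMem hA.2] at this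
  exact mem_powersetCard.2 ⟨subset_erase.2 ⟨(subset_insert _ _).trans this.1, hA.2⟩, by omega⟩

lemma cr_mem_nonMem {F : Finset (Finset α)} (h : Cr F F) (i : α) :
    Cr (F.nonMemberSubfamily i) (F.memberSubfamily i) := by
  intro A hA B hB hd
  rw [mem_nonMemberSubfamily] at hA
  rw [mem_memberSubfamily] at hB
  exact h A hA.1 _ hB.1 (disjoint_insert_right.2 ⟨hA.2, hd⟩)

/-- the bound `h` -/
def HB (n k c : ℕ) : Prop :=
  c + (n-4).choose (k-1) ≤ (n-1).choose (k-1) + (n-4).choose (k-3)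

theorem lemmaL {V : Finset α} {k : ℕ} {F : Finset (Finset α)} (hk : 3 ≤ k)
    (hn : 2 * k < V.card) (hF : F ⊆ powersetCard k V) (hint : Cr F F) (i : α) (hi : i ∈ V)
    (h1 : (V.card - 4).choose (k-3) ≤ (F.nonMemberSubfamily i).card)
    (h2 : (F.nonMemberSubfamily i).card ≤ (V.card - 3).choose (k-2)) :
    HB V.card k F.card := by
  have hc : (V.erase i).card = V.card - 1 := card_erase_of_mem hi
  have e1 : V.card - 1 - 3 = V.card - 4 := by omega
  have e2 : V.card - 4 + 1 = V.card - 3 := by omega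
  have e3 : k - 3 + 1 = k - 2 := by omega
  have := kk2 (b := k - 1) (j := 3) (nonMem_sub hF i) (by omega) (by omega) hk (by omega) (by omega)
    (by rw [hc, e1]; exact h1) (by rw [hc, e1, e2, e3]; exact h2)
  have h3 := cross_card (mem_sub' hF i) (cr_mem_nonMem hint i)
  have h4 := card_memberSubfamily_add_card_nonMemberSubfamily i F
  rw [hc, e1] at this
  rw [hc] at h3
  unfold HB
  omega

lemma lemmaX0 {U : Finset α} {k : ℕ} {P R : Finset (Finset α)} (hk : 3 ≤ k)
    (hU : 2 * (k-1) < U.card) (hP : P ⊆ powersetCard (k-1) U) (hR : R ⊆ powersetCard (k-1) U)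
    (hPR : Cr P R) (h1 : (U.card - 2).choose (k-3) ≤ P.card)
    (h2 : P.card ≤ (U.card - 1).choose (k-2)) :
    P.card + R.card + (U.card - 2).choose (k-1) ≤
      U.card.choose (k-1) + (U.card - 2).choose (k-3) := by
  have e1 : k - 1 - 2 = k - 3 := by omega
  have e2 : U.card - 2 + 1 = U.card - 1 := by omega
  have e3 : k - 3 + 1 = k - 2 := by omega
  have := kk2 (b := k - 1) (j := 2) hP (by omega) (by omega) (by omega) (by omega) (by omega)
    (by rw [e1]; exact h1) (by rw [e1, e2, e3]; exact h2)
  rw [e1] at this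
  have h3 := cross_card hR hPR
  omega

theorem lemmaX {U : Finset α} {k : ℕ} {P R : Finset (Finset α)} (hk : 3 ≤ k)
    (hU : 2 * (k-1) < U.card) (hP : P ⊆ powersetCard (k-1) U) (hR : R ⊆ powersetCard (k-1) U)
    (hPR : Cr P R) (h1 : (U.card - 2).choose (k-3) ≤ P.card)
    (h2 : (U.card - 2).choose (k-3) ≤ R.card) :
    P.card + R.card + (U.card - 2).choose (k-1) ≤
      U.card.choose (k-1) + (U.card - 2).choose (k-3) := by
  by_cases hc : P.card ≤ (U.card - 1).choose (k-2)
  · exact lemmaX0 hk hU hP hR hPR h1 hc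
  by_cases hc' : R.card ≤ (U.card - 1).choose (k-2)
  · have := lemmaX0 hk hU hR hP (fun A hA B hB hd => hPR B hB A hA hd.symm) h2 hc'
    omega
  push Not at hc hc'
  obtain ⟨P', hP', hcard⟩ := exists_subset_card_eq hc.le
  obtain ⟨p, hp⟩ : ∃ p, U.card = p + 2 := ⟨U.card - 2, by omega⟩
  obtain ⟨q, rfl⟩ : ∃ q, k = q + 3 := ⟨k - 3, by omega⟩
  have a1 := Nat.choose_succ_succ' (p+1) (q+1)
  have a2 := Nat.choose_succ_succ' p (q+1)
  have a3 := Nat.choose_succ_succ' p q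
  have := lemmaX0 hk hU (hP'.trans hP) hR (fun A hA => hPR A (hP' hA))
    (by rw [hcard, hp]; simp only [Nat.add_sub_cancel, show q + 3 - 2 = q + 1 by omega,
          show p + 2 - 1 = p + 1 by omega]; omega) hcard.le
  rw [hcard] at this
  simp only [hp, Nat.add_sub_cancel, show q + 3 - 2 = q + 1 by omega,
    show q + 3 - 1 = q + 1 + 1 by omega, show p + 2 - 1 = p + 1 by omega,
    show p + 2 = p + 1 + 1 by omega, show p + 1 + 1 - 2 = p by omega] at *
  omega

theorem lemmaY {U : Finset α} {k : ℕ} {C Q : Finset (Finset α)} (hk : 3 ≤ k)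
    (hU : 2 * (k-1) < U.card) (hC : C ⊆ powersetCard k U) (hQ : Q ⊆ powersetCard (k-2) U)
    (hCQ : Cr C Q) (h1 : C.card ≤ (U.card - 2).choose (k-2)) :
    C.card + Q.card ≤ U.card.choose (k-2) := by
  have := kk1 (b := k - 2) (j := 2) hC (by omega) (by omega) (by omega) h1
  have h3 := cross_card hQ hCQ
  omega

/-- neither -/
def fC (F : Finset (Finset α)) (i j : α) := (F.nonMemberSubfamily i).nonMemberSubfamily j
/-- `i` only -/
def fP (F : Finset (Finset α)) (i j : α) := (F.memberSubfamily i).nonMemberSubfamily j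
/-- `j` only -/
def fR (F : Finset (Finset α)) (i j : α) := (F.nonMemberSubfamily i).memberSubfamily j
/-- both -/
def fQ (F : Finset (Finset α)) (i j : α) := (F.memberSubfamily i).memberSubfamily j

lemma card4 (F : Finset (Finset α)) (i j : α) :
    (fC F i j).card + (fQ F i j).card + ((fP F i j).card + (fR F i j).card) = F.card := by
  have h1 := card_memberSubfamily_add_card_nonMemberSubfamily i F
  have h2 := card_memberSubfamily_add_card_nonMemberSubfamily j (F.memberSubfamily i)
  have h3 := card_memberSubfamily_add_card_nonMemberSubfamily j (F.nonMemberSubfamily i)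
  unfold fC fQ fP fR
  omega

lemma card_ni (F : Finset (Finset α)) (i j : α) :
    (fC F i j).card + (fR F i j).card = (F.nonMemberSubfamily i).card := by
  have h3 := card_memberSubfamily_add_card_nonMemberSubfamily j (F.nonMemberSubfamily i)
  unfold fC fR
  omega

lemma card_nj (F : Finset (Finset α)) {i j : α} (hij : i ≠ j) :
    (fC F i j).card + (fP F i j).card = (F.nonMemberSubfamily j).card := by
  have h3 := card_memberSubfamily_add_card_nonMemberSubfamily i (F.nonMemberSubfamily j)
  have e1 : (F.nonMemberSubfamily j).nonMemberSubfamily i = fC F i j := by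
    ext A; simp only [fC, mem_nonMemberSubfamily]; tauto
  have e2 : (F.nonMemberSubfamily j).memberSubfamily i = fP F i j := by
    ext A
    simp only [fP, mem_nonMemberSubfamily, mem_memberSubfamily, mem_insert]
    constructor
    · rintro ⟨⟨h1, h2⟩, h3⟩; tauto
    · rintro ⟨⟨h1, h2⟩, h3⟩
      exact ⟨⟨h1, fun h => h.elim (fun h => hij h.symm) h3⟩, h2⟩
  rw [e1, e2] at h3
  omega

lemma card_W {V : Finset α} {i j : α} (hi : i ∈ V) (hj : j ∈ V) (hij : i ≠ j) :
    ((V.erase i).erase j).card = V.card - 2 := by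
  rw [card_erase_of_mem (mem_erase.2 ⟨hij.symm, hj⟩), card_erase_of_mem hi]; omega

lemma fC_sub {V : Finset α} {k : ℕ} {F : Finset (Finset α)} (hF : F ⊆ powersetCard k V) (i j : α) :
    fC F i j ⊆ powersetCard k ((V.erase i).erase j) := nonMem_sub (nonMem_sub hF i) j
lemma fP_sub {V : Finset α} {k : ℕ} {F : Finset (Finset α)} (hF : F ⊆ powersetCard k V) (i j : α) :
    fP F i j ⊆ powersetCard (k-1) ((V.erase i).erase j) := nonMem_sub (mem_sub' hF i) j
lemma fR_sub {V : Finset α} {k : ℕ} {F : Finset (Finset α)} (hF : F ⊆ powersetCard k V) (i j : α) :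
    fR F i j ⊆ powersetCard (k-1) ((V.erase i).erase j) := mem_sub' (nonMem_sub hF i) j
lemma fQ_sub {V : Finset α} {k : ℕ} {F : Finset (Finset α)} (hF : F ⊆ powersetCard k V) (i j : α) :
    fQ F i j ⊆ powersetCard (k-2) ((V.erase i).erase j) := mem_sub' (mem_sub' hF i) j

lemma cr_PR {F : Finset (Finset α)} (h : Cr F F) {i j : α} :
    Cr (fP F i j) (fR F i j) := by
  intro A hA B hB hd
  simp only [fP, fR, mem_nonMemberSubfamily, mem_memberSubfamily] at hA hB
  refine h _ hA.1.1 _ hB.1.1 ?_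
  rw [disjoint_insert_left]
  refine ⟨hB.1.2, ?_⟩
  rw [disjoint_insert_right]
  exact ⟨hA.2, hd⟩

lemma cr_CQ {F : Finset (Finset α)} (h : Cr F F) {i j : α} :
    Cr (fC F i j) (fQ F i j) := by
  intro A hA B hB hd
  simp only [fC, fQ, mem_nonMemberSubfamily, mem_memberSubfamily] at hA hB
  refine h _ hA.1.1 _ hB.1.1 ?_
  rw [disjoint_insert_right, disjoint_insert_right]
  exact ⟨hA.1.2, hA.2, hd⟩

lemma combine {n k : ℕ} (hk : 3 ≤ k) (hn : 2 * k < n) {c q p r f : ℕ} (hf : c + q + (p + r) = f)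
    (h1 : c + q ≤ (n-2).choose (k-2))
    (h2 : p + r + (n-2-2).choose (k-1) ≤ (n-2).choose (k-1) + (n-2-2).choose (k-3)) :
    HB n k f := by
  unfold HB
  obtain ⟨m, rfl⟩ : ∃ m, n = m + 2 := ⟨n - 2, by omega⟩
  obtain ⟨q, rfl⟩ : ∃ q, k = q + 2 := ⟨k - 2, by omega⟩
  have a1 := Nat.choose_succ_succ' m q
  rw [show m + 2 - 4 = m + 2 - 2 - 2 by omega]
  simp only [Nat.add_sub_cancel, show q + 2 - 1 = q + 1 by omega,
    show m + 2 - 1 = m + 1 by omega] at *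
  omega

end Div5

end Part5

section Part6

namespace Div5
open Finset

/-- shift of a set -/
def sh (i j : ℕ) (A : Finset ℕ) : Finset ℕ := if i ∉ A ∧ j ∈ A then insert i (A.erase j) else A

/-- shift of a family -/
def shf (i j : ℕ) (F : Finset (Finset ℕ)) : Finset (Finset ℕ) :=
  F.filter (fun A => sh i j A ∈ F) ∪ (F.filter (fun A => sh i j A ∉ F)).image (sh i j)

lemma sh_pos {i j : ℕ} {A : Finset ℕ} (h : i ∉ A ∧ j ∈ A) : sh i j A = insert i (A.erase j) :=
  if_pos h

lemma sh_neg {i j : ℕ} {A : Finset ℕ} (h : ¬ (i ∉ A ∧ j ∈ A)) : sh i j A = A := if_neg h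

lemma moved {i j : ℕ} {F : Finset (Finset ℕ)} {A : Finset ℕ} (hA : A ∈ F) (h : sh i j A ∉ F) :
    i ∉ A ∧ j ∈ A := by
  by_contra hn
  rw [sh_neg hn] at h
  exact h hA

lemma sh_inv {i j : ℕ} {A : Finset ℕ} (h : i ∉ A ∧ j ∈ A) :
    insert j ((sh i j A).erase i) = A := by
  rw [sh_pos h, erase_insert (fun h' => h.1 (mem_of_mem_erase h')), insert_erase h.2]

lemma sh_injOn (i j : ℕ) (F : Finset (Finset ℕ)) :
    Set.InjOn (sh i j) (F.filter (fun A => sh i j A ∉ F) : Finset (Finset ℕ)) := by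
  intro A hA B hB h
  have hA := mem_filter.1 (mem_coe.1 hA)
  have hB := mem_filter.1 (mem_coe.1 hB)
  rw [← sh_inv (moved hA.1 hA.2), h, sh_inv (moved hB.1 hB.2)]

lemma shf_disj (i j : ℕ) (F : Finset (Finset ℕ)) :
    Disjoint (F.filter (fun A => sh i j A ∈ F))
      ((F.filter (fun A => sh i j A ∉ F)).image (sh i j)) := by
  rw [disjoint_left]
  intro A hA hA'
  obtain ⟨B, hB, rfl⟩ := mem_image.1 hA'
  exact (mem_filter.1 hB).2 (mem_filter.1 hA).1

lemma card_shf (i j : ℕ) (F : Finset (Finset ℕ)) : (shf i j F).card = F.card := by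
  rw [shf, card_union_of_disjoint (shf_disj i j F), card_image_of_injOn (sh_injOn i j F),
    card_filter_add_card_filter_not]

lemma mem_shf {i j : ℕ} {F : Finset (Finset ℕ)} {B : Finset ℕ} : B ∈ shf i j F ↔
    (B ∈ F ∧ sh i j B ∈ F) ∨ (B ∉ F ∧ ∃ A ∈ F, sh i j A = B) := by
  simp only [shf, mem_union, mem_filter, mem_image]
  constructor
  · rintro (h | ⟨A, ⟨h1, h2⟩, rfl⟩)
    · exact Or.inl h
    · exact Or.inr ⟨h2, A, h1, rfl⟩
  · rintro (h | ⟨h1, A, h2, rfl⟩)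
    · exact Or.inl h
    · exact Or.inr ⟨A, ⟨h2, h1⟩, rfl⟩

lemma shf_sub {i j k : ℕ} {V : Finset ℕ} {F : Finset (Finset ℕ)} (hi : i ∈ V)
    (hF : F ⊆ powersetCard k V) : shf i j F ⊆ powersetCard k V := by
  intro B hB
  rcases mem_shf.1 hB with ⟨h, _⟩ | ⟨h, A, hA, rfl⟩
  · exact hF h
  · have hm := moved hA h
    have := mem_powersetCard.1 (hF hA)
    rw [sh_pos hm, mem_powersetCard, card_insert_of_notMem (fun h' => hm.1 (mem_of_mem_erase h')),
      card_erase_of_mem hm.2]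
    have hp : 0 < A.card := card_pos.2 ⟨j, hm.2⟩
    exact ⟨insert_subset hi ((erase_subset _ _).trans this.1), by omega⟩

lemma shf_cr_aux {i j : ℕ} {F : Finset (Finset ℕ)} (h : Cr F F) {B A : Finset ℕ} (hB : B ∈ F)
    (hB' : sh i j B ∈ F) (hA : A ∈ F) (hA' : sh i j A ∉ F) : ¬ Disjoint B (sh i j A) := by
  intro hd
  have hm := moved hA hA'
  rw [sh_pos hm, disjoint_insert_right] at hd
  have hjB : j ∈ B := by
    by_contra hj
    apply h B hB A hA
    rw [← insert_erase hm.2, disjoint_insert_right]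
    exact ⟨hj, hd.2⟩
  rw [sh_pos ⟨hd.1, hjB⟩] at hB'
  apply h _ hB' A hA
  rw [disjoint_insert_left]
  refine ⟨hm.1, ?_⟩
  rw [disjoint_left] at hd ⊢
  intro y hy hyA
  rw [mem_erase] at hy
  exact hd.2 hy.2 (mem_erase.2 ⟨hy.1, hyA⟩)

lemma shf_cr {i j : ℕ} {F : Finset (Finset ℕ)} (h : Cr F F) : Cr (shf i j F) (shf i j F) := by
  intro B1 h1 B2 h2
  rcases mem_shf.1 h1 with ⟨a1, b1⟩ | ⟨a1, A1, hA1, rfl⟩ <;>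
  rcases mem_shf.1 h2 with ⟨a2, b2⟩ | ⟨a2, A2, hA2, rfl⟩
  · exact h _ a1 _ a2
  · exact shf_cr_aux h a1 b1 hA2 a2
  · intro hd; exact shf_cr_aux h a2 b2 hA1 a1 hd.symm
  · intro hd
    rw [sh_pos (moved hA1 a1), sh_pos (moved hA2 a2)] at hd
    exact disjoint_left.1 hd (mem_insert_self _ _) (mem_insert_self _ _)

lemma shf_nonMem {i j p : ℕ} (hp : p ≠ i) (F : Finset (Finset ℕ)) :
    (F.nonMemberSubfamily p).card ≤ ((shf i j F).nonMemberSubfamily p).card := by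
  rw [← card_shf i j (F.nonMemberSubfamily p)]
  apply card_le_card
  have key : ∀ A : Finset ℕ, p ∉ A → p ∉ sh i j A := by
    intro A hA
    unfold sh
    split_ifs
    · rw [mem_insert, mem_erase]; tauto
    · exact hA
  intro B hB
  rw [mem_nonMemberSubfamily, mem_shf]
  rcases mem_shf.1 hB with ⟨h1, h2⟩ | ⟨h1, A, hA, rfl⟩
  · rw [mem_nonMemberSubfamily] at h1 h2
    exact ⟨Or.inl ⟨h1.1, h2.1⟩, h1.2⟩
  · rw [mem_nonMemberSubfamily] at h1 hA
    have := key A hA.2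
    exact ⟨Or.inr ⟨fun h => h1 ⟨h, this⟩, A, hA.1, rfl⟩, this⟩

lemma fC_shf (i j : ℕ) (F : Finset (Finset ℕ)) :
    (fC F i j).card ≤ ((shf i j F).nonMemberSubfamily i).card := by
  apply card_le_card
  intro A hA
  simp only [fC, mem_nonMemberSubfamily] at hA ⊢
  refine ⟨mem_shf.2 (Or.inl ⟨hA.1.1, ?_⟩), hA.1.2⟩
  rw [sh_neg (fun h => hA.2 h.2)]; exact hA.1.1

/-- total weight -/
def mu (F : Finset (Finset ℕ)) : ℕ := ∑ A ∈ F, ∑ x ∈ A, x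

lemma mu_shf {i j : ℕ} (hij : i < j) {F : Finset (Finset ℕ)} (h : ∃ A ∈ F, sh i j A ∉ F) :
    mu (shf i j F) < mu F := by
  unfold mu
  rw [shf, sum_union (shf_disj i j F), sum_image (sh_injOn i j F),
    ← sum_filter_add_sum_filter_not F (fun A => sh i j A ∈ F)]
  apply Nat.add_lt_add_left
  apply sum_lt_sum_of_nonempty
  · obtain ⟨A, h1, h2⟩ := h
    exact ⟨A, mem_filter.2 ⟨h1, h2⟩⟩
  · intro A hA
    rw [mem_filter] at hA
    have hm := moved hA.1 hA.2
    rw [sh_pos hm, sum_insert (fun h' => hm.1 (mem_of_mem_erase h')),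
      ← add_sum_erase A (fun x => x) hm.2]
    omega

/-- shiftedness -/
def Shd (n : ℕ) (F : Finset (Finset ℕ)) : Prop :=
  ∀ i ∈ Icc 1 n, ∀ j ∈ Icc 1 n, i < j → ∀ A ∈ F, sh i j A ∈ F

theorem thmG {n k : ℕ} (hk : 3 ≤ k) (hn : 2 * k < n)
    (hsh : ∀ F : Finset (Finset ℕ), F ⊆ powersetCard k (Icc 1 n) → Cr F F → Shd n F →
      (∀ p ∈ Icc 1 n, (n-3).choose (k-2) < (F.nonMemberSubfamily p).card) → HB n k F.card)
    (m : ℕ) : ∀ F : Finset (Finset ℕ), mu F = m → F ⊆ powersetCard k (Icc 1 n) → Cr F F →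
      (∀ p ∈ Icc 1 n, (n-3).choose (k-2) < (F.nonMemberSubfamily p).card) → HB n k F.card := by
  induction m using Nat.strong_induction_on with
  | _ m ih =>
    intro F hmu hF hcr hdiv
    by_cases hs : Shd n F
    · exact hsh F hF hcr hs hdiv
    unfold Shd at hs
    push Not at hs
    obtain ⟨i, hi, j, hj, hij, hA⟩ := hs
    have hV : (Icc 1 n).card = n := by simp
    have hG := shf_sub (j := j) hi hF
    have hGc := shf_cr (i := i) (j := j) hcr
    rw [← card_shf i j F]
    by_cases h1 : (n-3).choose (k-2) < ((shf i j F).nonMemberSubfamily i).card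
    · refine ih _ (hmu ▸ mu_shf hij hA) _ rfl hG hGc ?_
      intro p hp
      by_cases hpi : p = i
      · rw [hpi]; exact h1
      · exact (hdiv p hp).trans_le (shf_nonMem hpi F)
    push Not at h1
    by_cases h2 : (n-4).choose (k-3) ≤ ((shf i j F).nonMemberSubfamily i).card
    · have := lemmaL hk (by omega) hG hGc i hi (by rw [hV]; exact h2) (by rw [hV]; exact h1)
      rwa [hV] at this
    push Not at h2
    rw [card_shf]
    have hW := card_W hi hj hij.ne
    rw [hV] at hW
    have c1 := fC_shf i j F
    have c2 := card_ni F i j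
    have c3 := card_nj F hij.ne
    have d1 := hdiv i hi
    have d2 := hdiv j hj
    have p1 : (n-3).choose (k-2) = (n-4).choose (k-3) + (n-4).choose (k-2) := by
      obtain ⟨m, rfl⟩ : ∃ m, n = m + 4 := ⟨n - 4, by omega⟩
      obtain ⟨q, rfl⟩ : ∃ q, k = q + 3 := ⟨k - 3, by omega⟩
      exact Nat.choose_succ_succ' m q
    have p2 : (n-4).choose (k-3) ≤ (n-4).choose (k-2) := choose_le' (by omega) (by omega)
    have e : n - 2 - 2 = n - 4 := by omega
    have x1 := lemmaX hk (by omega) (fP_sub hF i j) (fR_sub hF i j) (cr_PR hcr)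
      (by rw [hW, e]; omega) (by rw [hW, e]; omega)
    have y1 := lemmaY hk (by omega) (fC_sub hF i j) (fQ_sub hF i j) (cr_CQ hcr)
      (by rw [hW, e]; omega)
    rw [hW] at x1 y1
    exact combine hk hn (card4 F i j) y1 x1

end Div5

end Part6

section Part7

namespace Div5
open Finset

lemma majority {n k : ℕ} {F : Finset (Finset ℕ)} (hF : F ⊆ powersetCard k (Icc 1 n))
    (hcr : Cr F F) (hs : Shd n F) {A : Finset ℕ} (hA : A ∈ F) :
    ∃ j, (Icc 1 j \ A).card < (A ∩ Icc 1 j).card := by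
  by_contra hno
  push Not at hno
  have key : ∀ j, j ≤ n → ∃ E, E ⊆ Icc 1 j \ A ∧ E.card = (A ∩ Icc 1 j).card ∧
      (A \ Icc 1 j) ∪ E ∈ F := by
    intro j
    induction j with
    | zero =>
      intro _
      exact ⟨∅, by simp, by simp, by simpa using hA⟩
    | succ j ih =>
      intro hj
      obtain ⟨E, h1, h2, h3⟩ := ih (by omega)
      have hI : Icc 1 (j+1) = insert (j+1) (Icc 1 j) := by
        ext y; simp only [mem_Icc, mem_insert]; omega
      have hnI : j + 1 ∉ Icc 1 j := by simp
      by_cases hjA : j + 1 ∈ A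
      · have e1 : (A ∩ Icc 1 (j+1)).card = (A ∩ Icc 1 j).card + 1 := by
          rw [hI, inter_insert_of_mem hjA, card_insert_of_notMem (by simp)]
        have e2 : Icc 1 (j+1) \ A = Icc 1 j \ A := by
          rw [hI, insert_sdiff_of_mem _ hjA]
        have := hno (j+1)
        rw [e1, e2] at this
        obtain ⟨e, he, heE⟩ := exists_mem_notMem_of_card_lt_card
          (by omega : E.card < (Icc 1 j \ A).card)
        have he' := mem_sdiff.1 he
        have he'' := mem_Icc.1 he'.1
        have heB : e ∉ (A \ Icc 1 j) ∪ E := by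
          rw [mem_union, mem_sdiff]; tauto
        have hjB : j + 1 ∈ (A \ Icc 1 j) ∪ E := by
          rw [mem_union, mem_sdiff]; tauto
        have hsB := hs e (mem_Icc.2 (by omega)) (j+1) (mem_Icc.2 (by omega)) (by omega) _ h3
        rw [sh_pos ⟨heB, hjB⟩] at hsB
        refine ⟨insert e E, ?_, ?_, ?_⟩
        · rw [e2]; exact insert_subset he h1
        · rw [card_insert_of_notMem heE, e1, h2]
        · convert hsB using 1
          have hjE : j + 1 ∉ E := fun h => hnI (mem_sdiff.1 (h1 h)).1
          rw [hI]
          ext y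
          simp only [mem_union, mem_sdiff, mem_insert, mem_erase]
          constructor
          · rintro (⟨h1, h2⟩ | h | h)
            · tauto
            · tauto
            · right; exact ⟨fun h' => hjE (h' ▸ h), Or.inr h⟩
          · tauto
      · have e1 : A ∩ Icc 1 (j+1) = A ∩ Icc 1 j := by
          rw [hI, inter_insert_of_notMem hjA]
        have e3 : A \ Icc 1 (j+1) = A \ Icc 1 j := by
          rw [hI]; ext y; simp only [mem_sdiff, mem_insert]
          constructor
          · tauto
          · rintro ⟨h1, h2⟩
            exact ⟨h1, fun h => h.elim (fun h => hjA (h ▸ h1)) h2⟩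
        refine ⟨E, ?_, by rw [e1, h2], by rw [e3]; exact h3⟩
        exact h1.trans (sdiff_subset_sdiff (by rw [hI]; exact subset_insert _ _) le_rfl)
  obtain ⟨E, h1, _, h3⟩ := key n le_rfl
  have hAV := (mem_powersetCard.1 (hF hA)).1
  rw [sdiff_eq_empty_iff_subset.2 hAV, empty_union] at h3
  apply hcr A hA E h3
  exact disjoint_right.2 (fun y hy => (mem_sdiff.1 (h1 hy)).2)

lemma alpha_tree {n k : ℕ} {F : Finset (Finset ℕ)} (hk : 3 ≤ k) (hn : 2 * k < n)
    (hF : F ⊆ powersetCard k (Icc 1 n))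
    (hcr : Cr F F) (hs : Shd n F) {C : Finset (Finset ℕ)} (hCF : C ⊆ F)
    (hC : C ⊆ powersetCard k (Icc 3 n)) (d : ℕ) :
    ∀ (j : ℕ) (P Q : Finset ℕ), n - j = d → 2 ≤ j → j ≤ n → P ∪ Q = Icc 3 j → Disjoint P Q →
      (∀ l, (P ∩ Icc 1 l).card ≤ (Q ∩ Icc 1 l).card + 2) →
      (sub C P Q).card ≤ (sub (nb (Icc 3 n) (k-2) C) Q P).card := by
  induction d with
  | zero =>
    intro j P Q hd hj hjn hPQ hdis hinv
    obtain rfl : j = n := by omega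
    rcases (sub C P Q).eq_empty_or_nonempty with h0 | ⟨A, hA⟩
    · rw [h0]; simp
    exfalso
    rw [mem_sub] at hA
    have hAP : A = P := by
      apply Subset.antisymm _ hA.2.1
      intro y hy
      have : y ∈ P ∪ Q := by rw [hPQ]; exact (mem_powersetCard.1 (hC hA.1)).1 hy
      rcases mem_union.1 this with h | h
      · exact h
      · exact absurd hy (disjoint_left.1 hA.2.2 h)
    subst hAP
    have hP3 : A ⊆ Icc 3 j := hPQ ▸ subset_union_left
    have hQ3 : Q ⊆ Icc 3 j := hPQ ▸ subset_union_right
    obtain ⟨l, hl⟩ := majority hF hcr hs (hCF hA.1)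
    by_cases hl2 : l < 2
    · have : A ∩ Icc 1 l = ∅ := by
        rw [eq_empty_iff_forall_notMem]
        intro y hy
        rw [mem_inter, mem_Icc] at hy
        have := mem_Icc.1 (hP3 hy.1)
        omega
      rw [this] at hl
      simp at hl
    · have hsub : insert 1 (insert 2 (Q ∩ Icc 1 l)) ⊆ Icc 1 l \ A := by
        intro y hy
        simp only [mem_insert, mem_inter, mem_sdiff, mem_Icc] at hy ⊢
        rcases hy with rfl | rfl | hy
        · exact ⟨by omega, fun h => by have := mem_Icc.1 (hP3 h); omega⟩
        · exact ⟨by omega, fun h => by have := mem_Icc.1 (hP3 h); omega⟩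
        · exact ⟨hy.2, fun h => disjoint_left.1 hdis h hy.1⟩
      have hc := card_le_card hsub
      have h2 : 2 ∉ Q ∩ Icc 1 l := fun h => by
        have := mem_Icc.1 (hQ3 (mem_inter.1 h).1); omega
      have h1 : 1 ∉ insert 2 (Q ∩ Icc 1 l) := fun h => by
        rcases mem_insert.1 h with h | h
        · omega
        · have := mem_Icc.1 (hQ3 (mem_inter.1 h).1); omega
      rw [card_insert_of_notMem h1, card_insert_of_notMem h2] at hc
      have := hinv l
      omega
  | succ d ih =>
    intro j P Q hd hj hjn hPQ hdis hinv
    have hP3 : P ⊆ Icc 3 j := hPQ ▸ subset_union_left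
    have hQ3 : Q ⊆ Icc 3 j := hPQ ▸ subset_union_right
    have hI : Icc 3 (j+1) = insert (j+1) (Icc 3 j) := by
      ext y; simp only [mem_Icc, mem_insert]; omega
    have hIn : Icc 3 (j+1) ⊆ Icc 3 n := Icc_subset_Icc le_rfl (by omega)
    have hnI : j + 1 ∉ Icc 3 j := by simp
    have hzP : j + 1 ∉ P := fun h => hnI (hP3 h)
    have hzQ : j + 1 ∉ Q := fun h => hnI (hQ3 h)
    have hW : (Icc 3 n).card = n - 2 := by simp
    rw [branch C P Q (j+1), branch _ Q P (j+1), add_comm (card (sub _ (insert _ Q) _))]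
    apply Nat.add_le_add
    · by_cases hc : P.card + 1 ≤ Q.card + 2
      · apply ih (j+1) _ _ (by omega) (by omega) (by omega)
        · rw [insert_union, hPQ, hI]
        · exact disjoint_insert_left.2 ⟨hzQ, hdis⟩
        · intro l
          by_cases hl : l < j + 1
          · rw [insert_inter_of_notMem (by rw [mem_Icc]; omega)]
            exact hinv l
          · have : Q ∩ Icc 1 l = Q := inter_eq_left.2 (hQ3.trans (Icc_subset_Icc (by omega) (by omega)))
            rw [this]
            have h1 := card_le_card (inter_subset_left (s₁ := insert (j+1) P) (s₂ := Icc 1 l))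
            rw [card_insert_of_notMem hzP] at h1
            omega
      · apply leaf_weak hC
        · exact hQ3.trans (Icc_subset_Icc le_rfl hjn)
        · exact (insert_subset_insert _ hP3).trans (hI ▸ hIn)
        · exact disjoint_insert_left.2 ⟨hzQ, hdis⟩
        · omega
        · rw [card_insert_of_notMem hzP]; omega
    · apply ih (j+1) _ _ (by omega) (by omega) (by omega)
      · rw [union_insert, hPQ, hI]
      · exact disjoint_insert_right.2 ⟨hzP, hdis⟩
      · intro l
        refine (hinv l).trans ?_
        have := card_le_card (inter_subset_inter_right (u := Icc 1 l) (subset_insert (j+1) Q))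
        omega

theorem shifted_case {n k : ℕ} (hk : 3 ≤ k) (hn : 2 * k < n)
    (F : Finset (Finset ℕ)) (hF : F ⊆ powersetCard k (Icc 1 n)) (hcr : Cr F F) (hs : Shd n F)
    (hdiv : ∀ p ∈ Icc 1 n, (n-3).choose (k-2) < (F.nonMemberSubfamily p).card) :
    HB n k F.card := by
  have hWe : ((Icc 1 n).erase 1).erase 2 = Icc 3 n := by
    ext y; simp only [mem_erase, mem_Icc]; omega
  have hW : (Icc 3 n).card = n - 2 := by simp
  have hCs := fC_sub hF 1 2
  have hPs := fP_sub hF 1 2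
  have hRs := fR_sub hF 1 2
  have hQs := fQ_sub hF 1 2
  rw [hWe] at hCs hPs hRs hQs
  have h1 : (fC F 1 2).card ≤ (nb (Icc 3 n) (k-2) (fC F 1 2)).card := by
    have := alpha_tree hk hn hF hcr hs (C := fC F 1 2)
      (fun A hA => (mem_nonMemberSubfamily.1 (mem_nonMemberSubfamily.1 hA).1).1) hCs _ 2 ∅ ∅ rfl
      le_rfl (by omega) (by ext y; simp) (disjoint_empty_left _) (by simp)
    rwa [sub_empty, sub_empty] at this
  have h2 := cross_card hQs (cr_CQ hcr)
  rw [hW] at h2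
  have hRP : fR F 1 2 ⊆ fP F 1 2 := by
    intro B hB
    simp only [fR, fP, mem_nonMemberSubfamily, mem_memberSubfamily] at hB ⊢
    have := hs 1 (mem_Icc.2 (by omega)) 2 (mem_Icc.2 (by omega)) (by omega) _ hB.1.1
    rw [sh_pos ⟨hB.1.2, mem_insert_self _ _⟩, erase_insert hB.2] at this
    exact ⟨⟨this, fun h => hB.1.2 (mem_insert_of_mem h)⟩, hB.2⟩
  have hRPc := card_le_card hRP
  have e : n - 2 - 2 = n - 4 := by omega
  refine combine hk hn (card4 F 1 2) (by omega) ?_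
  by_cases hR : (n-2-2).choose (k-3) ≤ (fR F 1 2).card
  · have := lemmaX hk (by omega) hPs hRs (cr_PR hcr) (by rw [hW]; omega) (by rw [hW]; omega)
    rwa [hW] at this
  push Not at hR
  have c2 := card_ni F 1 2
  have d1 := hdiv 1 (mem_Icc.2 (by omega))
  have p1 : (n-3).choose (k-2) = (n-2-2).choose (k-3) + (n-2-2).choose (k-2) := by
    obtain ⟨m, rfl⟩ : ∃ m, n = m + 4 := ⟨n - 4, by omega⟩
    obtain ⟨q, rfl⟩ : ∃ q, k = q + 3 := ⟨k - 3, by omega⟩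
    exact Nat.choose_succ_succ' m q
  have h3 := kk0 (b := k - 1) (j := 2) hCs (by omega) (by omega) (by rw [hW]; omega)
  have hCP : Cr (fC F 1 2) (fP F 1 2) := by
    intro A hA B hB hd
    simp only [fC, fP, mem_nonMemberSubfamily, mem_memberSubfamily] at hA hB
    exact hcr _ hA.1.1 _ hB.1.1 (disjoint_insert_right.2 ⟨hA.1.2, hd⟩)
  have h4 := cross_card hPs hCP
  rw [hW] at h3 h4
  omega

theorem thmG' {n k : ℕ} (hk : 3 ≤ k) (hn : 2 * k < n)
    (F : Finset (Finset ℕ)) (hF : F ⊆ powersetCard k (Icc 1 n)) (hcr : Cr F F)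
    (hdiv : ∀ p ∈ Icc 1 n, (n-3).choose (k-2) < (F.nonMemberSubfamily p).card) :
    HB n k F.card :=
  thmG hk hn (fun F h1 h2 h3 h4 => shifted_case hk hn F h1 h2 h3 h4) _ F rfl hF hcr hdiv

end Div5

end Part7

namespace Div5
open Finset

/-- transversal part of the link -/
def tr (n k : ℕ) (M : Finset (Finset ℕ)) : Finset (Finset ℕ) :=
  (powersetCard (k-1) ((Icc 1 n).erase 1)).filter (fun B => ∀ A ∈ M, ¬ Disjoint A B)

lemma maxExt_ge {n k : ℕ} (hk : 1 ≤ k) (hn : 1 ≤ n) {M : Finset (Finset ℕ)}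
    (hM : ∀ A ∈ M, 1 ∉ A) : M.card + (tr n k M).card ≤ (maxExt n k M).card := by
  unfold maxExt
  rw [card_union_of_disjoint]
  · apply Nat.add_le_add_left
    apply card_le_card_of_injOn (fun B => insert 1 B)
    · intro B hB
      simp only [tr, coe_filter, Set.mem_ofPred_eq, mem_powersetCard, subset_erase] at hB
      obtain ⟨⟨⟨h1, h2⟩, h3⟩, h4⟩ := hB
      simp only [coe_filter, Set.mem_ofPred_eq, mem_powersetCard]
      refine ⟨⟨insert_subset (mem_Icc.2 ⟨le_rfl, hn⟩) h1, ?_⟩, mem_insert_self _ _, ?_⟩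
      · rw [card_insert_of_notMem h2]; omega
      · intro A hA
        have := h4 A hA
        rw [not_disjoint_iff] at this
        obtain ⟨y, hy, hyB⟩ := this
        exact ⟨y, mem_inter.2 ⟨mem_insert_of_mem hyB, hy⟩⟩
    · intro B hB B' hB' h
      simp only [tr, coe_filter, Set.mem_ofPred_eq, mem_powersetCard, subset_erase] at hB hB'
      simp only at h
      rw [← erase_insert hB.1.1.2, h, erase_insert hB'.1.1.2]
  · rw [disjoint_left]
    intro A hA hA'
    exact hM A hA (mem_filter.1 hA').2.1

lemma maxExt_gt {n k : ℕ} (hk : 5 ≤ k) (hn : 2 * k < n) {M : Finset (Finset ℕ)}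
    (hM : M ⊆ powersetCard k ((Icc 1 n).erase 1)) (T : Finset ℕ) (hTU : T ⊆ (Icc 1 n).erase 1)
    (hT : T.card = 3) (hTM : ∀ A ∈ M, T ⊆ A)
    (hx : ∀ A ∈ M, ∃ x ∈ (Icc 1 n).erase 1, x ∉ A ∧ ∀ B ∈ M, B ≠ A → x ∈ B) :
    (n-1).choose (k-1) + (n-4).choose (k-3) < (maxExt n k M).card + (n-4).choose (k-1) := by
  have hM1 : ∀ A ∈ M, 1 ∉ A := fun A hA h1 =>
    (mem_erase.1 ((mem_powersetCard.1 (hM hA)).1 h1)).1 rfl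
  have hge := maxExt_ge (n := n) (k := k) (by omega) (by omega) hM1
  have hUc : ((Icc 1 n).erase 1).card = n - 1 := by
    rw [card_erase_of_mem (mem_Icc.2 (by omega))]; simp
  unfold tr at hge
  generalize (Icc 1 n).erase 1 = U at *
  let TT := (powersetCard k U).filter (fun A => T ⊆ A)
  have hMT : M ⊆ TT := fun A hA => mem_filter.2 ⟨hM hA, hTM A hA⟩
  have hUT : (U \ T).card = n - 4 := by rw [card_sdiff_of_subset hTU]; omega
  have hTT : TT.card = (n-4).choose (k-3) := by
    apply le_antisymm
    · have := card_sub_le (P := T) (Q := ∅) (Subset.refl (powersetCard k U)) (empty_subset _) hTU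
        (disjoint_empty_right _)
      rw [hT, card_empty, hUc, show n - 1 - 3 - 0 = n - 4 by omega] at this
      have hTs : TT = sub (powersetCard k U) T ∅ := by
        ext A; simp [TT, mem_sub]
      rw [hTs]; exact this
    · rw [← hUT, ← card_powersetCard]
      apply card_le_card_of_injOn (fun B => B ∪ T)
      · intro B hB
        have hB := mem_powersetCard.1 (mem_coe.1 hB)
        rw [subset_sdiff] at hB
        apply mem_coe.2
        rw [mem_filter, mem_powersetCard, card_union_of_disjoint hB.1.2]
        exact ⟨⟨union_subset hB.1.1 hTU, by omega⟩, subset_union_right⟩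
      · intro B hB B' hB' h
        have hB := mem_powersetCard.1 (mem_coe.1 hB)
        have hB' := mem_powersetCard.1 (mem_coe.1 hB')
        rw [subset_sdiff] at hB hB'
        have := congrArg (· \ T) h
        simp only [union_sdiff_right] at this
        rwa [sdiff_eq_self_of_disjoint hB.1.2, sdiff_eq_self_of_disjoint hB'.1.2] at this
  have hSc : (TT \ M).card + M.card = (n-4).choose (k-3) := by
    rw [card_sdiff_add_card_eq_card hMT, hTT]
  have hSne : (TT \ M).Nonempty := by
    rcases M.eq_empty_or_nonempty with h0 | ⟨A, hA⟩
    · rw [h0, sdiff_empty, ← card_pos, hTT]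
      exact Nat.choose_pos (by omega)
    obtain ⟨x, hxU, hxA, hxB⟩ := hx A hA
    have hAk := mem_powersetCard.1 (hM hA)
    have hxT : x ∉ T := fun h => hxA (hTM A hA h)
    have hcx : (U.erase x).card = n - 2 := by rw [card_erase_of_mem hxU]; omega
    obtain ⟨y, hy⟩ : ((U.erase x) \ A).Nonempty := by
      rw [← card_pos]
      have := le_card_sdiff A (U.erase x)
      omega
    rw [mem_sdiff] at hy
    obtain ⟨B, h1, h2, h3⟩ := exists_subsuperset_card_eq (s := insert y T) (t := U.erase x) (n := k)
      (insert_subset hy.1 (subset_erase.2 ⟨hTU, hxT⟩))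
      ((card_insert_le _ _).trans (by omega)) (by omega)
    rw [subset_erase] at h2
    refine ⟨B, mem_sdiff.2 ⟨mem_filter.2 ⟨mem_powersetCard.2 ⟨h2.1, h3⟩,
      (subset_insert _ _).trans h1⟩, fun hBM => ?_⟩⟩
    exact h2.2 (hxB B hBM (fun h => hy.2 (h ▸ h1 (mem_insert_self _ _))))
  have hE := lemmaE hk (by omega) hM ((sdiff_subset).trans (filter_subset _ _) : TT \ M ⊆ _)
    (fun A hA => (mem_sdiff.1 hA).2) T hTU hT hTM hx hSne
    (by rw [hUc, show n - 1 - 3 = n - 4 by omega]; omega)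
  have hcnt : ((powersetCard (k-1) U).filter (fun B => ¬ Disjoint T B)).card + (n-4).choose (k-1)
      = (n-1).choose (k-1) := by
    have := card_filter_add_card_filter_not (s := powersetCard (k-1) U) (fun B => Disjoint T B)
    rw [filter_disj, card_powersetCard, card_powersetCard, hUT, hUc] at this
    omega
  have hsub : (powersetCard (k-1) U).filter (fun B => ¬ Disjoint T B) ∪ tn U (k-1) M (TT \ M) ⊆
      (powersetCard (k-1) U).filter (fun B => ∀ A ∈ M, ¬ Disjoint A B) := by
    apply union_subset
    · intro B hB
      rw [mem_filter] at hB ⊢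
      exact ⟨hB.1, fun A hA hd => hB.2 (hd.mono_left (hTM A hA))⟩
    · intro B hB
      rw [tn, mem_filter, mem_nb] at hB
      rw [mem_filter, mem_powersetCard]
      exact ⟨hB.1.1, hB.2⟩
  have hdis : Disjoint ((powersetCard (k-1) U).filter (fun B => ¬ Disjoint T B))
      (tn U (k-1) M (TT \ M)) := by
    rw [disjoint_left]
    intro B hB hB'
    rw [tn, mem_filter, mem_nb] at hB'
    obtain ⟨⟨_, A, hA, hd⟩, _⟩ := hB'
    exact (mem_filter.1 hB).2 (hd.mono_left (mem_filter.1 (mem_sdiff.1 hA).1).2)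
  have hc := card_le_card hsub
  rw [card_union_of_disjoint hdis] at hc
  omega

lemma small_case {n k : ℕ} (hk : 5 ≤ k) (hn : 2 * k < n) {F M : Finset (Finset ℕ)}
    (hF : F ⊆ powersetCard k (Icc 1 n)) (hcr : Cr F F) (hMF : M ⊆ F.nonMemberSubfamily 1)
    (hM : M ⊆ powersetCard k ((Icc 1 n).erase 1)) (T : Finset ℕ) (hTU : T ⊆ (Icc 1 n).erase 1)
    (hT : T.card = 3) (hTM : ∀ A ∈ M, T ⊆ A)
    (hx : ∀ A ∈ M, ∃ x ∈ (Icc 1 n).erase 1, x ∉ A ∧ ∀ B ∈ M, B ≠ A → x ∈ B)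
    (hne : (F.nonMemberSubfamily 1 \ M).Nonempty)
    (hle : (F.nonMemberSubfamily 1).card ≤ (n-4).choose (k-3)) :
    F.card < (maxExt n k M).card := by
  have hM1 : ∀ A ∈ M, 1 ∉ A := fun A hA h1 =>
    (mem_erase.1 ((mem_powersetCard.1 (hM hA)).1 h1)).1 rfl
  have hge := maxExt_ge (n := n) (k := k) (by omega) (by omega) hM1
  have hUc : ((Icc 1 n).erase 1).card = n - 1 := by
    rw [card_erase_of_mem (mem_Icc.2 (by omega))]; simp
  have hnm := nonMem_sub hF 1
  have hm := mem_sub' hF 1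
  have hc1 := cr_mem_nonMem hcr 1
  have h4 := card_memberSubfamily_add_card_nonMemberSubfamily 1 F
  have h5 := card_sdiff_add_card_eq_card hMF
  unfold tr at hge
  generalize (Icc 1 n).erase 1 = U at *
  have hE := lemmaE hk (by omega) hM (sdiff_subset.trans hnm)
    (fun A hA => (mem_sdiff.1 hA).2) T hTU hT hTM hx hne
    (by rw [hUc, show n - 1 - 3 = n - 4 by omega]; omega)
  have hsub : F.memberSubfamily 1 ∪ tn U (k-1) M (F.nonMemberSubfamily 1 \ M) ⊆
      (powersetCard (k-1) U).filter (fun B => ∀ A ∈ M, ¬ Disjoint A B) := by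
    apply union_subset
    · intro B hB
      rw [mem_filter]
      exact ⟨hm hB, fun A hA => hc1 A (hMF hA) B hB⟩
    · intro B hB
      rw [tn, mem_filter, mem_nb] at hB
      rw [mem_filter, mem_powersetCard]
      exact ⟨hB.1.1, hB.2⟩
  have hdis : Disjoint (F.memberSubfamily 1) (tn U (k-1) M (F.nonMemberSubfamily 1 \ M)) := by
    rw [disjoint_left]
    intro B hB hB'
    rw [tn, mem_filter, mem_nb] at hB'
    obtain ⟨⟨_, A, hA, hd⟩, _⟩ := hB'
    exact hc1 A (mem_sdiff.1 hA).1 B hB hd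
  have hc := card_le_card hsub
  rw [card_union_of_disjoint hdis] at hc
  omega

end Div5

theorem stmt5 (n k t : ℕ) (hk : 5 ≤ k) (hn : 2 * k < n)
    (F : Finset (Finset ℕ)) (hF : F ⊆ Finset.powersetCard k (Finset.Icc 1 n))
    (hint : Intersecting F)
    (hdiv : diversity n F = (F.filter (fun A => 1 ∉ A)).card)
    (M : Finset (Finset ℕ)) (hM : M ⊆ F.filter (fun A => 1 ∉ A))
    (hmin : MinimalWrtCommonInt n M)
    (htM : (famInter n M).card = t) (ht : 3 ≤ t)
    (hcard : F.card = (maxExt n k M).card) :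
    Isomorphic n F (maxExt n k M) := by
  have hcr : Div5.Cr F F := by
    intro A hA B hB hd
    have := hint A hA B hB
    rw [Finset.disjoint_iff_inter_eq_empty] at hd
    rw [hd] at this
    exact absurd this (by simp)
  have hM1 : ∀ A ∈ M, 1 ∉ A := fun A hA => (Finset.mem_filter.1 (hM hA)).2
  have hMF : M ⊆ F.nonMemberSubfamily 1 := hM
  have hMk : M ⊆ Finset.powersetCard k ((Finset.Icc 1 n).erase 1) :=
    hMF.trans (Div5.nonMem_sub hF 1)
  have hUc : ((Finset.Icc 1 n).erase 1).card = n - 1 := by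
    rw [Finset.card_erase_of_mem (Finset.mem_Icc.2 (by omega))]; simp
  by_cases hne : (F.nonMemberSubfamily 1 \ M).Nonempty
  · exfalso
    obtain ⟨T, hTU, hTM, hT⟩ : ∃ T, T ⊆ (Finset.Icc 1 n).erase 1 ∧ (∀ A ∈ M, T ⊆ A) ∧
        T.card = 3 := by
      rcases M.eq_empty_or_nonempty with h0 | ⟨A, hA⟩
      · obtain ⟨T, h1, h2⟩ := Finset.exists_subset_card_eq
          (by omega : 3 ≤ ((Finset.Icc 1 n).erase 1).card)
        exact ⟨T, h1, by simp [h0], h2⟩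
      · obtain ⟨T, h1, h2⟩ := Finset.exists_subset_card_eq (by omega : 3 ≤ (famInter n M).card)
        refine ⟨T, ?_, ?_, h2⟩
        · intro y hy
          have := Finset.mem_filter.1 (h1 hy)
          exact Finset.mem_erase.2 ⟨fun h => hM1 A hA (h ▸ this.2 A hA), this.1⟩
        · intro B hB y hy
          exact (Finset.mem_filter.1 (h1 hy)).2 B hB
    have hx : ∀ A ∈ M, ∃ x ∈ (Finset.Icc 1 n).erase 1, x ∉ A ∧ ∀ B ∈ M, B ≠ A → x ∈ B := by
      intro A hA
      by_cases hB : ∃ B ∈ M, B ≠ A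
      · obtain ⟨B, hB, hBA⟩ := hB
        obtain ⟨x, h1, h2⟩ := Finset.exists_mem_notMem_of_card_lt_card (hmin A hA)
        have h1' := Finset.mem_filter.1 h1
        have hxo : ∀ B ∈ M, B ≠ A → x ∈ B := fun B hB hBA =>
          h1'.2 B (Finset.mem_erase.2 ⟨hBA, hB⟩)
        refine ⟨x, Finset.mem_erase.2 ⟨fun h => hM1 B hB (h ▸ hxo B hB hBA), h1'.1⟩, ?_, hxo⟩
        intro hxA
        apply h2
        refine Finset.mem_filter.2 ⟨h1'.1, fun B hB => ?_⟩
        by_cases hBA : B = A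
        · rw [hBA]; exact hxA
        · exact hxo B hB hBA
      · push Not at hB
        have hAk := Finset.mem_powersetCard.1 (hMk hA)
        obtain ⟨x, hx⟩ : (((Finset.Icc 1 n).erase 1) \ A).Nonempty := by
          rw [← Finset.card_pos, Finset.card_sdiff_of_subset hAk.1]; omega
        rw [Finset.mem_sdiff] at hx
        exact ⟨x, hx.1, hx.2, fun B hB' hBA => absurd (hB B hB') hBA⟩
    by_cases hle : (F.nonMemberSubfamily 1).card ≤ (n-4).choose (k-3)
    · have := Div5.small_case hk hn hF hcr hMF hMk T hTU hT hTM hx hne hle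
      omega
    · push Not at hle
      have hgt := Div5.maxExt_gt hk hn hMk T hTU hT hTM hx
      have hV : (Finset.Icc 1 n).card = n := by simp
      have hHB : Div5.HB n k F.card := by
        by_cases h2 : (F.nonMemberSubfamily 1).card ≤ (n-3).choose (k-2)
        · have := Div5.lemmaL (by omega) (by omega) hF hcr 1 (Finset.mem_Icc.2 (by omega))
            (by rw [hV]; exact hle.le) (by rw [hV]; exact h2)
          rwa [hV] at this
        · push Not at h2
          apply Div5.thmG' (by omega) hn F hF hcr
          intro p hp
          refine h2.trans_le ?_
          have hd : diversity n F ≤ (F.filter (fun A => p ∉ A)).card :=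
            Nat.sInf_le ⟨p, by simpa using hp, rfl⟩
          rw [hdiv] at hd
          exact hd
      unfold Div5.HB at hHB
      omega
  · have hAM : F.nonMemberSubfamily 1 ⊆ M := by
      rw [Finset.not_nonempty_iff_eq_empty, Finset.sdiff_eq_empty_iff_subset] at hne
      exact hne
    have hsub : F ⊆ maxExt n k M := by
      intro A hA
      unfold maxExt
      rw [Finset.mem_union, Finset.mem_filter]
      by_cases h1 : 1 ∈ A
      · exact Or.inr ⟨hF hA, h1, fun B hB => hint A hA B (Finset.mem_filter.1 (hM hB)).1⟩
      · exact Or.inl (hAM (Finset.mem_nonMemberSubfamily.2 ⟨hA, h1⟩))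
    have heq : F = maxExt n k M := Finset.eq_of_subset_of_card_le hsub hcard.ge
    refine ⟨1, fun x hx => by simpa using hx, ?_⟩
    rw [← heq]
    simp
end

section
/- Assume k ≥ 5, t ≥ 3 and 2k+1 ≤ n < 3k−t. Let F be an intersecting family of k-element subsets of [n] with γ(F) = |F(1̄)| and |∩_{F∈F(1̄)} F| ≤ t. If |F| = |J_{k−t+1}|, then F is isomorphic to J_i for some i with k−t+1 ≤ i ≤ k. -/
/-- `I_i = [i+1, k+i]`. -/
def Iset (k i : ℕ) : Finset ℕ := Finset.Icc (i + 1) (k + i)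

/-- The family `J_i = {I_1, I_i} ∪ {F ∈ C([n],k) : 1 ∈ F, F ∩ I_1 ≠ ∅, F ∩ I_i ≠ ∅}`. -/
def Jfam (n k i : ℕ) : Finset (Finset ℕ) :=
  {Iset k 1, Iset k i} ∪
    (Finset.powersetCard k (Finset.Icc 1 n)).filter
      (fun A => 1 ∈ A ∧ (A ∩ Iset k 1).Nonempty ∧ (A ∩ Iset k i).Nonempty)

namespace S9
open Finset
open scoped FinsetFamily

/-- all `r`-subsets of members of the family -/
def sh (r : ℕ) (C : Finset (Finset ℕ)) : Finset (Finset ℕ) :=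
  C.biUnion (fun X => X.powersetCard r)

lemma mem_sh {r : ℕ} {C : Finset (Finset ℕ)} {S : Finset ℕ} :
    S ∈ sh r C ↔ ∃ X ∈ C, S ⊆ X ∧ S.card = r := by
  simp [sh, mem_powersetCard]

lemma sh_mono {r : ℕ} {C D : Finset (Finset ℕ)} (h : C ⊆ D) : sh r C ⊆ sh r D :=
  biUnion_subset_biUnion_of_subset_left _ h

lemma exists_initSeg_card (N s a : ℕ) (ha : a ≤ N.choose s) :
    ∃ D : Finset (Finset (Fin N)), Colex.IsInitSeg D s ∧ D.card = a := by
  induction a with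
  | zero => exact ⟨∅, Colex.isInitSeg_empty, rfl⟩
  | succ a ih =>
    obtain ⟨D, hD, hDc⟩ := ih (by omega)
    have hsub : D ⊆ powersetCard s univ := fun X hX => by
      rw [mem_powersetCard]; exact ⟨subset_univ _, hD.1 hX⟩
    have hne : ((powersetCard s (univ : Finset (Fin N))) \ D).Nonempty := by
      rw [← card_pos, card_sdiff_of_subset hsub, card_powersetCard]
      simp; omega
    obtain ⟨X, hX, hmin⟩ := exists_min_image _ (fun X => toColex X) hne
    rw [mem_sdiff, mem_powersetCard] at hX
    refine ⟨insert X D, ⟨?_, ?_⟩, ?_⟩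
    · intro Y hY
      rw [mem_coe, mem_insert] at hY
      rcases hY with rfl | hY
      · exact hX.1.2
      · exact hD.1 hY
    · intro Y T hY hT
      rw [mem_insert] at hY ⊢
      right
      rcases hY with rfl | hY
      · by_contra hc
        have := hmin T (by rw [mem_sdiff, mem_powersetCard]; exact ⟨⟨subset_univ _, hT.2⟩, hc⟩)
        exact absurd hT.1 (not_lt.2 this)
      · exact hD.2 hY hT
    · rw [card_insert_of_notMem hX.2, hDc]

/-- the initial segment of all sets below `x` -/
lemma isInitSeg_below (N s x : ℕ) :
    Colex.IsInitSeg ((powersetCard s (univ : Finset (Fin N))).filter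
      (fun S : Finset (Fin N) => ∀ i ∈ S, (i : ℕ) < x)) s := by
  refine ⟨?_, ?_⟩
  · intro S hS
    simp only [coe_filter, mem_powersetCard, Set.mem_ofPred_eq] at hS
    exact hS.1.2
  · intro A B hA hB
    simp only [mem_filter, mem_powersetCard] at hA ⊢
    refine ⟨⟨subset_univ _, hB.2⟩, fun t ht => ?_⟩
    have : toColex (image Fin.val B) < toColex (image Fin.val A) := by
      rw [Colex.toColex_image_lt_toColex_image Fin.val_strictMono]; exact hB.1
    apply Colex.forall_lt_mono this.le _ t (mem_image.2 ⟨t, ht, rfl⟩)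
    intro b hb
    obtain ⟨c, hc, rfl⟩ := mem_image.1 hb
    exact hA.2 c hc

lemma kk (s r : ℕ) (hr : r ≤ s) (C : Finset (Finset ℕ)) (hC : ∀ X ∈ C, X.card = s) :
    ∃ D : Finset (Finset ℕ), (∀ X ∈ D, X.card = s) ∧ D.card = C.card ∧
      (sh r D).card ≤ (sh r C).card ∧
      ∀ x, D ⊆ powersetCard s (range x) ∨ powersetCard s (range x) ⊆ D := by
  classical
  -- ground set
  obtain ⟨N, hN⟩ : ∃ N, ∀ X ∈ C, X ⊆ range N := by
    refine ⟨(C.biUnion id).sup id + 1, fun X hX y hy => ?_⟩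
    rw [mem_range, Nat.lt_succ_iff]
    exact le_sup (f := id) (mem_biUnion.2 ⟨X, hX, hy⟩)
  let down : Finset ℕ → Finset (Fin N) := fun X => univ.filter (fun i => (i : ℕ) ∈ X)
  let up : Finset (Fin N) → Finset ℕ := fun X => X.map Fin.valEmbedding
  have upinj : Function.Injective up := map_injective _
  have hud : ∀ X, X ⊆ range N → up (down X) = X := by
    intro X hX
    ext y
    simp only [up, down, mem_map, mem_filter, mem_univ, true_and, Fin.valEmbedding_apply]
    constructor
    · rintro ⟨i, hi, rfl⟩; exact hi
    · intro hy; exact ⟨⟨y, mem_range.1 (hX hy)⟩, hy, rfl⟩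
  have hcardup : ∀ X, (up X).card = X.card := fun X => card_map _
  let C' := C.image down
  have hC'c : C'.card = C.card := by
    apply card_image_of_injOn
    intro X hX Y hY h
    rw [← hud X (hN X hX), ← hud Y (hN Y hY)]
    exact congrArg up h
  have hC's : (C' : Set (Finset (Fin N))).Sized s := by
    intro X hX
    obtain ⟨Y, hY, rfl⟩ := mem_image.1 (mem_coe.1 hX)
    rw [← hcardup, hud Y (hN Y hY), hC Y hY]
  obtain ⟨D', hD', hD'c⟩ := exists_initSeg_card N s C.card (by
    rw [← hC'c]
    simpa using hC's.card_le)
  have hkk := iterated_kk (k := s - r) hC's (hD'c.trans hC'c.symm).le hD'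
  refine ⟨D'.image up, ?_, ?_, ?_, ?_⟩
  · intro X hX
    obtain ⟨Y, hY, rfl⟩ := mem_image.1 hX
    rw [hcardup]; exact hD'.1 hY
  · rw [card_image_of_injective _ upinj, hD'c]
  · calc (sh r (D'.image up)).card ≤ ((∂^[s - r] D').image up).card := by
          apply card_le_card
          intro S hS
          obtain ⟨X, hX, hSX, hSc⟩ := mem_sh.1 hS
          obtain ⟨Y, hY, rfl⟩ := mem_image.1 hX
          obtain ⟨T, hT, rfl⟩ := subset_map_iff.1 hSX
          refine mem_image.2 ⟨T, ?_, rfl⟩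
          rw [mem_shadow_iterate_iff_exists_sdiff]
          refine ⟨Y, hY, hT, ?_⟩
          rw [card_map] at hSc
          rw [card_sdiff_of_subset hT, hD'.1 hY, hSc]
      _ = (∂^[s - r] D').card := card_image_of_injective _ upinj
      _ ≤ (∂^[s - r] C').card := hkk
      _ = ((∂^[s - r] C').image up).card := (card_image_of_injective _ upinj).symm
      _ ≤ (sh r C).card := by
          apply card_le_card
          intro S hS
          obtain ⟨T, hT, rfl⟩ := mem_image.1 hS
          rw [mem_shadow_iterate_iff_exists_sdiff] at hT
          obtain ⟨Y, hY, hTY, hc⟩ := hT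
          have hYs : Y.card = s := hC's hY
          obtain ⟨X, hX, rfl⟩ := mem_image.1 hY
          refine mem_sh.2 ⟨X, hX, ?_, ?_⟩
          · rw [← hud X (hN X hX)]; exact map_subset_map.2 hTY
          · rw [hcardup]
            rw [card_sdiff_of_subset hTY, hYs] at hc
            have := card_le_card hTY
            omega
  · intro x
    by_cases hx : x ≤ N
    · rcases hD'.total (isInitSeg_below N s x) with h | h
      · left
        intro X hX
        obtain ⟨Y, hY, rfl⟩ := mem_image.1 hX
        have := h hY
        rw [mem_filter, mem_powersetCard] at this
        rw [mem_powersetCard, hcardup]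
        refine ⟨?_, this.1.2⟩
        intro y hy
        obtain ⟨i, hi, rfl⟩ := mem_map.1 hy
        exact mem_range.2 (this.2 i hi)
      · right
        intro X hX
        rw [mem_powersetCard] at hX
        have hXN : X ⊆ range N := hX.1.trans (range_subset_range.2 hx)
        rw [← hud X hXN]
        refine mem_image_of_mem _ (h ?_)
        rw [mem_filter, mem_powersetCard]
        refine ⟨⟨subset_univ _, ?_⟩, ?_⟩
        · rw [← hcardup, hud X hXN, hX.2]
        · intro i hi
          simp only [down, mem_filter, mem_univ, true_and] at hi
          exact mem_range.1 (hX.1 hi)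
    · left
      intro X hX
      obtain ⟨Y, hY, rfl⟩ := mem_image.1 hX
      rw [mem_powersetCard, hcardup]
      refine ⟨?_, hD'.1 hY⟩
      intro y hy
      obtain ⟨i, hi, rfl⟩ := mem_map.1 hy
      simp only [Fin.valEmbedding_apply, mem_range]
      have := i.2
      omega

/-- the minimal shadow -/
noncomputable def phi (s r a : ℕ) : ℕ :=
  sInf {b | ∃ C : Finset (Finset ℕ), (∀ X ∈ C, X.card = s) ∧ C.card = a ∧ (sh r C).card = b}

lemma phi_le {s r : ℕ} (C : Finset (Finset ℕ)) (hC : ∀ X ∈ C, X.card = s) :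
    phi s r C.card ≤ (sh r C).card :=
  Nat.sInf_le ⟨C, hC, rfl, rfl⟩

lemma phi_spec (s r a : ℕ) (hs : 1 ≤ s) (hr : r ≤ s) :
    ∃ D : Finset (Finset ℕ), (∀ X ∈ D, X.card = s) ∧ D.card = a ∧ (sh r D).card = phi s r a ∧
      ∀ x, D ⊆ powersetCard s (range x) ∨ powersetCard s (range x) ⊆ D := by
  have hne : {b | ∃ C : Finset (Finset ℕ), (∀ X ∈ C, X.card = s) ∧ C.card = a ∧
      (sh r C).card = b}.Nonempty := by
    have h1 : a ≤ ((range (a + s)).powersetCard s).card := by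
      rw [card_powersetCard, card_range]
      induction a with
      | zero => simp
      | succ a ih =>
        obtain ⟨s', rfl⟩ : ∃ s', s = s' + 1 := ⟨s - 1, by omega⟩
        rw [show a + 1 + (s' + 1) = (a + (s' + 1)) + 1 by ring, Nat.choose_succ_succ']
        have : 0 < (a + (s' + 1)).choose s' := Nat.choose_pos (by omega)
        omega
    obtain ⟨C, hC, hCc⟩ := exists_subset_card_eq h1
    exact ⟨_, C, fun X hX => (mem_powersetCard.1 (hC hX)).2, hCc, rfl⟩
  obtain ⟨C, hC, hCc, hb⟩ := Nat.sInf_mem hne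
  obtain ⟨D, h1, h2, h3, h4⟩ := kk s r hr C hC
  refine ⟨D, h1, h2.trans hCc, le_antisymm ?_ ?_, h4⟩
  · exact h3.trans hb.le
  · have := phi_le (r := r) D h1
    rwa [h2, hCc] at this

/-- cascade step -/
lemma phi_step (s r x d : ℕ) (hr : r ≤ s) (hx : s + 1 ≤ x) (hd : d ≤ x.choose s) :
    x.choose (r + 1) + phi s r d ≤ phi (s + 1) (r + 1) (x.choose (s + 1) + d) := by
  obtain ⟨D, hD, hDc, hDp, hDi⟩ := phi_spec (s + 1) (r + 1) (x.choose (s + 1) + d) (by omega)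
    (by omega)
  rw [← hDp]
  have hlow : powersetCard (s + 1) (range x) ⊆ D := by
    rcases hDi x with h | h
    · have : D = powersetCard (s + 1) (range x) := by
        apply eq_of_subset_of_card_le h
        rw [card_powersetCard, card_range, hDc]; omega
      rw [this]
    · exact h
  have hup : D ⊆ powersetCard (s + 1) (range (x + 1)) := by
    rcases hDi (x + 1) with h | h
    · exact h
    · have : powersetCard (s + 1) (range (x + 1)) = D := by
        apply eq_of_subset_of_card_le h
        rw [card_powersetCard, card_range, hDc, Nat.choose_succ_succ']; omega
      rw [this]
  let R := D \ powersetCard (s + 1) (range x)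
  have hRc : R.card = d := by
    rw [card_sdiff_of_subset hlow, hDc, card_powersetCard, card_range]; omega
  have hR : ∀ X ∈ R, x ∈ X ∧ X ⊆ range (x + 1) ∧ X.card = s + 1 := by
    intro X hX
    rw [mem_sdiff] at hX
    have h1 := mem_powersetCard.1 (hup hX.1)
    refine ⟨?_, h1⟩
    by_contra hc
    apply hX.2
    rw [mem_powersetCard]
    refine ⟨fun y hy => ?_, h1.2⟩
    have := mem_range.1 (h1.1 hy)
    rw [mem_range]
    have : y ≠ x := fun h => hc (h ▸ hy)
    omega
  let E := R.image (fun X => X.erase x)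
  have hEc : E.card = d := by
    rw [← hRc]
    apply card_image_of_injOn
    intro X hX Y hY h
    have h1 := (hR X hX).1
    have h2 := (hR Y hY).1
    rw [← insert_erase h1, ← insert_erase h2]
    exact congrArg (insert x) h
  have hE : ∀ X ∈ E, X.card = s := by
    intro X hX
    obtain ⟨Y, hY, rfl⟩ := mem_image.1 hX
    rw [card_erase_of_mem (hR Y hY).1, (hR Y hY).2.2]; rfl
  have hphi : phi s r d ≤ (sh r E).card := by
    have := phi_le (r := r) E hE
    rwa [hEc] at this
  have hEx : ∀ S ∈ sh r E, x ∉ S := by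
    intro S hS hxS
    obtain ⟨X, hX, hSX, _⟩ := mem_sh.1 hS
    obtain ⟨Y, hY, rfl⟩ := mem_image.1 hX
    exact notMem_erase x Y (hSX hxS)
  let P := powersetCard (r + 1) (range x)
  let Q := (sh r E).image (insert x)
  have hQc : Q.card = (sh r E).card := by
    apply card_image_of_injOn
    intro S hS T hT h
    rw [← erase_insert (hEx S hS), ← erase_insert (hEx T hT)]
    exact congrArg (fun Z => Z.erase x) h
  have hdisj : Disjoint P Q := by
    rw [disjoint_left]
    intro S hS hS'
    obtain ⟨T, hT, rfl⟩ := mem_image.1 hS'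
    have := (mem_powersetCard.1 hS).1 (mem_insert_self x T)
    simp at this
  calc x.choose (r + 1) + phi s r d ≤ P.card + Q.card := by
        rw [hQc, card_powersetCard, card_range]; omega
    _ = (P ∪ Q).card := (card_union_of_disjoint hdisj).symm
    _ ≤ _ := by
        apply card_le_card
        apply union_subset
        · intro S hS
          have hS := mem_powersetCard.1 hS
          obtain ⟨X, hSX, hXx, hXc⟩ := exists_subsuperset_card_eq hS.1
            (n := s + 1) (by omega) (by rw [card_range]; omega)
          exact mem_sh.2 ⟨X, hlow (mem_powersetCard.2 ⟨hXx, hXc⟩), hSX, hS.2⟩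
        · intro S hS
          obtain ⟨T, hT, rfl⟩ := mem_image.1 hS
          obtain ⟨X, hX, hTX, hTc⟩ := mem_sh.1 hT
          obtain ⟨Y, hY, rfl⟩ := mem_image.1 hX
          refine mem_sh.2 ⟨Y, (mem_sdiff.1 hY).1, ?_, ?_⟩
          · rw [← insert_erase (hR Y hY).1]
            exact insert_subset_insert _ hTX
          · rw [card_insert_of_notMem (hEx T hT), hTc]

/-- normalized matching inside `[x]` -/
lemma phi_lym (s r x d : ℕ) (hs : 1 ≤ s) (hr : r ≤ s) (hx : s ≤ x) (hd : d ≤ x.choose s) :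
    d * x.choose r ≤ phi s r d * x.choose s := by
  obtain ⟨D, hD, hDc, hDp, hDi⟩ := phi_spec s r d hs hr
  rw [← hDp]
  have hup : D ⊆ powersetCard s (range x) := by
    rcases hDi x with h | h
    · exact h
    · have : powersetCard s (range x) = D := by
        apply eq_of_subset_of_card_le h
        rw [card_powersetCard, card_range, hDc]; omega
      rw [this]
  have hdc : D.card * s.choose r ≤ (sh r D).card * (x - r).choose (s - r) := by
    apply card_mul_le_card_mul (fun X S => S ⊆ X)
    · intro X hX
      have : powersetCard r X ⊆ bipartiteAbove (fun X S => S ⊆ X) (sh r D) X := by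
        intro S hS
        rw [mem_powersetCard] at hS
        rw [bipartiteAbove, mem_filter]
        exact ⟨mem_sh.2 ⟨X, hX, hS⟩, hS.1⟩
      have := card_le_card this
      rwa [card_powersetCard, hD X hX] at this
    · intro S hS
      obtain ⟨X, hX, hSX, hSc⟩ := mem_sh.1 hS
      have hSx : S ⊆ range x := hSX.trans (mem_powersetCard.1 (hup hX)).1
      have h1 : (powersetCard (s - r) (range x \ S)).card = (x - r).choose (s - r) := by
        rw [card_powersetCard, card_sdiff_of_subset hSx, card_range, hSc]
      rw [← h1]
      apply card_le_card_of_injOn (fun Y => Y \ S)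
      · intro Y hY
        simp only [bipartiteBelow, coe_filter, Set.mem_ofPred_eq] at hY
        simp only [mem_coe, mem_powersetCard]
        have hY' := mem_powersetCard.1 (hup hY.1)
        exact ⟨sdiff_subset_sdiff hY'.1 (Subset.refl _),
          by rw [card_sdiff_of_subset hY.2, hY'.2, hSc]⟩
      · intro Y hY Z hZ h
        simp only [bipartiteBelow, coe_filter, Set.mem_ofPred_eq] at hY hZ
        simp only at h
        rw [← union_sdiff_of_subset hY.2, ← union_sdiff_of_subset hZ.2, h]
  rw [hDc] at hdc
  have hid := Nat.choose_mul (n := x) hr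
  have hpos : 0 < s.choose r := Nat.choose_pos hr
  have hpos2 : 0 < (x - r).choose (s - r) := Nat.choose_pos (by omega)
  refine le_of_mul_le_mul_right ?_ hpos2
  calc d * x.choose r * (x - r).choose (s - r) = (d * s.choose r) * x.choose s := by
        rw [mul_assoc, ← hid]; ring
    _ ≤ ((sh r D).card * (x - r).choose (s - r)) * x.choose s := Nat.mul_le_mul_right _ hdc
    _ = _ := by ring

end S9

namespace S9
open Finset

lemma choose_mono_half (n p q : ℕ) (hpq : p ≤ q) (hq : 2 * q ≤ n) : n.choose p ≤ n.choose q := by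
  induction q, hpq using Nat.le_induction with
  | base => exact le_rfl
  | succ q hq' ih =>
    exact (ih (by omega)).trans (Nat.choose_le_succ_of_lt_half_left (by omega))

lemma choose_le_of_add_le (n p q : ℕ) (hpq : p ≤ q) (h : p + q ≤ n) :
    n.choose p ≤ n.choose q := by
  by_cases hq : 2 * q ≤ n
  · exact choose_mono_half n p q hpq hq
  · rw [← Nat.choose_symm (show q ≤ n by omega)]
    exact choose_mono_half n p (n - q) (by omega) (by omega)

lemma star_poly1 (j w : ℕ) : (2 * j + w + 5 + 1) ^ 3 * ((3 * j + 2 * w + 10 + 3) *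
      (3 * j + 2 * w + 10 - 2)) ≤
    (2 * j + w + 4) * (3 * j + 2 * w + 10 + 1) ^ 2 * (3 * j + 2 * w + 10) ^ 2 := by
  rw [show 3 * j + 2 * w + 10 - 2 = 3 * j + 2 * w + 8 by omega]
  zify
  rw [← sub_nonneg]
  ring_nf
  positivity

lemma star_poly2 (u : ℕ) : (u + 3) * (3 * u + 14) * (2 * u + 10) ^ 3 * (2 * u + 11) ^ 3 *
      (3 * u + 20) ≤
    (2 * u + 9) * (2 * u + 8) * (3 * u + 17) ^ 3 * (3 * u + 16) * (3 * u + 18) * (u + 4) ^ 2 := by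
  zify
  rw [← sub_nonneg]
  ring_nf
  positivity

lemma star_step1 (s sm z k J X X' X1 Y Y1 : ℕ) (hk : 0 < k) (hs : 0 < s) (hz : 0 < z)
    (hX1 : (z + 2) * X' = X1 * k) (hX2 : X * (z + 1) = X' * s) (hY : (s + 1) * Y = Y1 * k)
    (ih : s * s * sm * (z + 3) * (2 * Y) < X * J * (z + 1) * z)
    (hp : (s + 1) ^ 3 * ((z + 5) * z) ≤ sm * (z + 3) ^ 2 * (z + 2) ^ 2) :
    (s + 1) * (s + 1) * s * (z + 5) * (2 * Y1) < X1 * J * (z + 3) * (z + 2) := by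
  have hpos : 0 < k * s * z := by positivity
  refine lt_of_mul_lt_mul_right ?_ (Nat.zero_le (k * s * z))
  calc (s + 1) * (s + 1) * s * (z + 5) * (2 * Y1) * (k * s * z)
      = (s + 1) * (s + 1) * s * (z + 5) * 2 * s * z * (Y1 * k) := by ring
    _ = 2 * Y * s ^ 2 * ((s + 1) ^ 3 * ((z + 5) * z)) := by rw [← hY]; ring
    _ ≤ 2 * Y * s ^ 2 * (sm * (z + 3) ^ 2 * (z + 2) ^ 2) := Nat.mul_le_mul_left _ hp
    _ = (s * s * sm * (z + 3) * (2 * Y)) * ((z + 3) * (z + 2) ^ 2) := by ring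
    _ < (X * J * (z + 1) * z) * ((z + 3) * (z + 2) ^ 2) :=
        Nat.mul_lt_mul_of_pos_right ih (by positivity)
    _ = (X * (z + 1)) * (J * z * ((z + 3) * (z + 2) ^ 2)) := by ring
    _ = ((z + 2) * X') * (s * J * z * ((z + 3) * (z + 2))) := by rw [hX2]; ring
    _ = X1 * J * (z + 3) * (z + 2) * (k * s * z) := by rw [hX1]; ring

lemma star_step2 (s sm z k j X X' X'' X2 Y Y' Y2 : ℕ) (hk : 0 < k) (hs : 0 < s) (hz : 0 < z)
    (hX1 : X * (z + 1) = X' * s) (hX2 : X' * (z + 2) = X'' * (s + 1))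
    (hX3 : (z + 3) * X'' = X2 * k) (hY : Y * (s + 1) = Y' * (j + 2))
    (hY2 : (s + 2) * Y' = Y2 * k)
    (ih : s * s * sm * (z + 3) * (2 * Y) < X * (j + 1) * (z + 1) * z)
    (hp : (j + 1) * z * (s + 1) ^ 3 * (s + 2) ^ 3 * (z + 6) ≤
      s * sm * (z + 3) ^ 3 * (z + 2) * (z + 4) * (j + 2) ^ 2) :
    (s + 2) * (s + 2) * (s + 1) * (z + 6) * (2 * Y2) < X2 * (j + 2) * (z + 4) * (z + 3) := by
  refine lt_of_mul_lt_mul_right ?_ (Nat.zero_le (k * s * (s + 1) * (j + 2) * z * (j + 1)))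
  calc (s + 2) * (s + 2) * (s + 1) * (z + 6) * (2 * Y2) * (k * s * (s + 1) * (j + 2) * z * (j + 1))
      = (s + 2) * (s + 2) * (s + 1) * (z + 6) * 2 * s * (s + 1) * (j + 2) * z * (j + 1)
          * (Y2 * k) := by ring
    _ = (s + 2) ^ 3 * (s + 1) * (z + 6) * 2 * s * (s + 1) * z * (j + 1)
          * (Y' * (j + 2)) := by rw [← hY2]; ring
    _ = 2 * Y * s * ((j + 1) * z * (s + 1) ^ 3 * (s + 2) ^ 3 * (z + 6)) := by rw [← hY]; ring
    _ ≤ 2 * Y * s * (s * sm * (z + 3) ^ 3 * (z + 2) * (z + 4) * (j + 2) ^ 2) :=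
        Nat.mul_le_mul_left _ hp
    _ = (s * s * sm * (z + 3) * (2 * Y)) * ((z + 3) ^ 2 * (z + 2) * (z + 4) * (j + 2) ^ 2) := by
        ring
    _ < (X * (j + 1) * (z + 1) * z) * ((z + 3) ^ 2 * (z + 2) * (z + 4) * (j + 2) ^ 2) :=
        Nat.mul_lt_mul_of_pos_right ih (by positivity)
    _ = (X * (z + 1)) * ((j + 1) * z * (z + 3) ^ 2 * (z + 2) * (z + 4) * (j + 2) ^ 2) := by ring
    _ = (X' * (z + 2)) * (s * (j + 1) * z * (z + 3) ^ 2 * (z + 4) * (j + 2) ^ 2) := by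
        rw [hX1]; ring
    _ = ((z + 3) * X'') * ((s + 1) * s * (j + 1) * z * (z + 3) * (z + 4) * (j + 2) ^ 2) := by
        rw [hX2]; ring
    _ = _ := by rw [hX3]; ring

/-- The polynomial inequality behind the upper range. -/
lemma star_ineq (k : ℕ) (hk : 7 ≤ k) : ∀ s, k ≤ s → s ≤ 2 * k - 5 →
    s * s * (s - 1) * (s + k + 1) * (2 * s.choose (k - 1)) <
      (s + k - 2).choose (k - 1) * (s - k + 1) * (s + k - 1) * (s + k - 2) := by
  induction k, hk using Nat.le_induction with
  | base =>
    intro s h1 h2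
    interval_cases s <;> decide
  | succ k hk ih =>
    intro s' h1 h2
    by_cases h : s' ≤ 2 * k - 4
    · obtain ⟨s, rfl⟩ : ∃ s, s' = s + 1 := ⟨s' - 1, by omega⟩
      have ih' := ih s (by omega) (by omega)
      have hp := star_poly1 (s - k) (2 * k - 5 - s)
      rw [show 2 * (s - k) + (2 * k - 5 - s) + 5 = s by omega,
        show 2 * (s - k) + (2 * k - 5 - s) + 4 = s - 1 by omega,
        show 3 * (s - k) + 2 * (2 * k - 5 - s) + 10 = s + k by omega] at hp
      obtain ⟨z, hz⟩ : ∃ z, s + k = z + 2 := ⟨s + k - 2, by omega⟩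
      obtain ⟨q, rfl⟩ : ∃ q, k = q + 1 := ⟨k - 1, by omega⟩
      have hX1 := Nat.add_one_mul_choose_eq (z + 1) q
      have hX2 := Nat.choose_mul_succ_eq z q
      rw [show z + 1 - q = s by omega] at hX2
      have hY := Nat.add_one_mul_choose_eq s q
      rw [show s + (q + 1) = z + 2 by omega] at ih' hp
      rw [show s + 1 + (q + 1 + 1) = z + 4 by omega, show s + 1 - (q + 1 + 1) = s - (q + 1) by omega]
      exact star_step1 s (s - 1) z (q + 1) (s - (q + 1) + 1) _ _ _ _ _ (by omega) (by omega)
        (by omega) hX1 hX2 hY ih' hp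
    · obtain rfl : s' = 2 * k - 5 + 2 := by omega
      have ih' := ih (2 * k - 5) (by omega) (by omega)
      obtain ⟨u, rfl⟩ : ∃ u, k = u + 7 := ⟨k - 7, by omega⟩
      have hp := star_poly2 u
      rw [show 2 * (u + 7) - 5 = 2 * u + 9 by omega,
        show 2 * u + 9 + (u + 7) - 2 = 3 * u + 14 by omega,
        show 2 * u + 9 + (u + 7) - 1 = 3 * u + 14 + 1 by omega,
        show 2 * u + 9 + (u + 7) + 1 = 3 * u + 14 + 3 by omega,
        show 2 * u + 9 - (u + 7) = u + 2 by omega, show u + 7 - 1 = u + 6 by omega,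
        show 2 * u + 9 - 1 = 2 * u + 8 by omega] at ih'
      rw [show 2 * (u + 7) - 5 = 2 * u + 9 by omega,
        show 2 * u + 9 + 2 + (u + 7 + 1) - 2 = 3 * u + 14 + 3 by omega,
        show 2 * u + 9 + 2 + (u + 7 + 1) - 1 = 3 * u + 14 + 4 by omega,
        show 2 * u + 9 + 2 + (u + 7 + 1) + 1 = 3 * u + 14 + 6 by omega,
        show 2 * u + 9 + 2 - (u + 7 + 1) + 1 = u + 2 + 2 by omega,
        show u + 7 + 1 - 1 = u + 6 + 1 by omega,
        show 2 * u + 9 + 2 - 1 = 2 * u + 9 + 1 by omega]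
      have hX1 := Nat.choose_mul_succ_eq (3 * u + 14) (u + 6)
      rw [show 3 * u + 14 + 1 - (u + 6) = 2 * u + 9 by omega] at hX1
      have hX2 := Nat.choose_mul_succ_eq (3 * u + 14 + 1) (u + 6)
      rw [show 3 * u + 14 + 1 + 1 - (u + 6) = 2 * u + 9 + 1 by omega] at hX2
      have hX3 := Nat.add_one_mul_choose_eq (3 * u + 14 + 1 + 1) (u + 6)
      have hY := Nat.choose_mul_succ_eq (2 * u + 9) (u + 6)
      rw [show 2 * u + 9 + 1 - (u + 6) = u + 2 + 2 by omega] at hY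
      have hY2 := Nat.add_one_mul_choose_eq (2 * u + 9 + 1) (u + 6)
      exact star_step2 (2 * u + 9) (2 * u + 8) (3 * u + 14) (u + 6 + 1) (u + 2) _ _ _ _ _ _ _
        (by omega) (by omega) (by omega) hX1 hX2 hX3 hY hY2 ih' hp

/-- `alpha` inequality -/
lemma alpha_ineq (k s : ℕ) (hk : 5 ≤ k) (h1 : k ≤ s) (h2 : s ≤ 2 * k - 5) :
    s.choose (k - 1) + (s - 1) < s.choose (k - 2) := by
  obtain ⟨q, rfl⟩ : ∃ q, k = q + 2 := ⟨k - 2, by omega⟩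
  simp only [Nat.add_sub_cancel, show q + 2 - 1 = q + 1 by omega]
  have e := Nat.choose_succ_right_eq s q
  have hge : s.choose 2 ≤ s.choose q := by
    apply choose_le_of_add_le <;> omega
  have h22 : s.choose 2 * 2 = s * (s - 1) := by
    have := Nat.choose_succ_right_eq s 1
    simpa using this
  obtain ⟨v, hv⟩ : ∃ v, q + 1 = (s - q) + 2 + v := ⟨q + 1 - (s - q) - 2, by omega⟩
  obtain ⟨p, rfl⟩ : ∃ p, s = p + 1 := ⟨s - 1, by omega⟩
  simp only [Nat.add_sub_cancel] at *
  generalize (p + 1).choose (q + 1) = Y at *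
  generalize (p + 1).choose q = X at *
  have h3 : (p + 1) * p ≤ 2 * X := by omega
  have h4 : X * (q + 1) = Y * (q + 1) + X * (2 + v) := by rw [e, hv]; ring
  by_contra hc
  push Not at hc
  have h5 : X * (q + 1) ≤ (Y + p) * (q + 1) := Nat.mul_le_mul_right _ hc
  have h6 : 2 * X + X * v ≤ p * (q + 1) := by nlinarith
  have h7 : p * (q + 1) < (p + 1) * p := by nlinarith
  nlinarith [Nat.zero_le (X * v)]

end S9

namespace S9
open Finset

lemma choose_le_of_le_add (x r s : ℕ) (hrs : r ≤ s) (h : x ≤ r + s) :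
    x.choose s ≤ x.choose r := by
  by_cases hx : s ≤ x
  · rw [← Nat.choose_symm hx]
    exact choose_le_of_add_le x (x - s) r (by omega) (by omega)
  · rw [Nat.choose_eq_zero_of_lt (by omega)]; exact Nat.zero_le _

/-- the loss at the integer points -/
lemma loss_int (p q : ℕ) (hq : 2 ≤ q) (h1 : q + 3 ≤ p + 2) (h2 : p + 2 ≤ 2 * q + 1) (x : ℕ)
    (hx : p + 3 ≤ x) : x ≤ p + q + 3 →
    x.choose (p + 2) + 2 * (p + 2).choose (q + 2) < x.choose (q + 2) + 2 := by
  induction x, hx using Nat.le_induction with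
  | base =>
    intro _
    have := alpha_ineq (q + 3) (p + 2) (by omega) h1 (by omega)
    rw [show q + 3 - 1 = q + 2 by omega, show q + 3 - 2 = q + 1 by omega] at this
    rw [Nat.choose_succ_succ' (p + 2) (q + 1)]
    have h3 : (p + 3).choose (p + 2) = p + 3 := Nat.choose_succ_self_right (p + 2)
    rw [show q + 1 + 1 = q + 2 from rfl]
    omega
  | succ x hx ih =>
    intro hx2
    have := ih (by omega)
    rw [Nat.choose_succ_succ' x (p + 1), Nat.choose_succ_succ' x (q + 1)]
    have := choose_le_of_le_add x (q + 1) (p + 1) (by omega) (by omega)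
    rw [show p + 1 + 1 = p + 2 from rfl, show q + 1 + 1 = q + 2 from rfl]
    omega

/-- numeric core of the upper range: `c * rem > δ * M` -/
lemma top_ineq (p q c e : ℕ) (hq : 3 ≤ q) (h1 : q + 3 ≤ p + 2) (h2 : p + 2 ≤ 2 * q + 1)
    (hc : (p + q + 3).choose (p + 2) + c = (p + q + 3).choose (q + 2))
    (hdeg : (p + q + 6) * ((p + q + 3).choose (p + 2) + ((p + q + 2).choose (p + 1) + e)) +
      (p + 3) * (2 * (p + 2).choose (q + 2) - 2) ≤ (p + q + 5) * (p + q + 4).choose (p + 2)) :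
    e ≤ (p + q + 2).choose p ∧
    (2 * (p + 2).choose (q + 2) - 2) * (p + q + 2).choose p <
      c * ((p + q + 2).choose p - e) := by
  have hpas : (p + q + 4).choose (p + 2) = (p + q + 3).choose (p + 2) +
      ((p + q + 2).choose (p + 1) + (p + q + 2).choose p) := by
    rw [Nat.choose_succ_succ' (p + q + 3) (p + 1), Nat.choose_succ_succ' (p + q + 2) p]; ring
  obtain rfl | hq4 : q = 3 ∨ 4 ≤ q := by omega
  · have hp4 : 4 ≤ p := by omega
    have hp5 : p ≤ 5 := by omega
    interval_cases p
    · norm_num [Nat.choose] at hc hdeg ⊢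
      obtain rfl : c = 42 := by omega
      omega
    · norm_num [Nat.choose] at hc hdeg ⊢
      obtain rfl : c = 132 := by omega
      omega
  have hT : (p + q + 4).choose (p + 2) ≤ (p + q + 6) * ((p + q + 4).choose (p + 2)
      - ((p + q + 3).choose (p + 2) + ((p + q + 2).choose (p + 1) + e))) := by
    rw [Nat.mul_sub]
    have : (p + q + 6) * (p + q + 4).choose (p + 2) =
      (p + q + 5) * (p + q + 4).choose (p + 2) + (p + q + 4).choose (p + 2) := by ring
    omega
  have hTpos : 0 < (p + q + 4).choose (p + 2) := Nat.choose_pos (by omega)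
  have he : e ≤ (p + q + 2).choose p := by
    by_contra hcon
    rw [Nat.sub_eq_zero_of_le (by omega)] at hT
    omega
  refine ⟨he, ?_⟩
  have hrem : (p + q + 4).choose (p + 2)
      - ((p + q + 3).choose (p + 2) + ((p + q + 2).choose (p + 1) + e)) =
      (p + q + 2).choose p - e := by omega
  rw [hrem] at hT
  have hstar := star_ineq (q + 3) (by omega) (p + 2) h1 (by omega)
  rw [show p + 2 + (q + 3) - 2 = p + q + 3 by omega, show q + 3 - 1 = q + 2 by omega,
    show p + 2 - (q + 3) + 1 = p - q by omega, show p + 2 + (q + 3) - 1 = p + q + 4 by omega,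
    show p + 2 + (q + 3) + 1 = p + q + 6 by omega, show p + 2 - 1 = p + 1 by omega] at hstar
  -- binomial identities
  have hid1 := Nat.add_one_mul_choose_eq (p + q + 3) (p + 1)
  have hid2 := Nat.add_one_mul_choose_eq (p + q + 2) p
  have hid3 : c * (p + 2) = (p + q + 3).choose (q + 2) * (p - q) := by
    have e1 := Nat.choose_succ_right_eq (p + q + 3) (p + 1)
    have e2 : (p + q + 3).choose (p + 1) = (p + q + 3).choose (q + 2) := by
      rw [← Nat.choose_symm (show p + 1 ≤ p + q + 3 by omega)]
      congr 1; omega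
    rw [e2, show p + q + 3 - (p + 1) = q + 2 by omega] at e1
    obtain ⟨v, rfl⟩ : ∃ v, p = q + v := ⟨p - q, by omega⟩
    rw [show q + v - q = v by omega]
    rw [← hc] at e1 ⊢
    nlinarith
  rw [show p + q + 2 + 1 = p + q + 3 by omega] at hid2
  rw [show p + q + 3 + 1 = p + q + 4 by omega, show p + 1 + 1 = p + 2 by omega] at hid1
  generalize (p + q + 2).choose p = M at *
  generalize (p + q + 4).choose (p + 2) = T at *
  generalize (p + q + 3).choose (p + 1) = T' at *
  generalize (p + q + 3).choose (q + 2) = X at *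
  generalize hY : (p + 2).choose (q + 2) = Y at *
  generalize M - e = R at *
  have hMpos : 0 < M := by
    rcases Nat.eq_zero_or_pos M with h | h
    · subst h
      simp at hid2
      subst hid2
      simp at hid1
      omega
    · exact h
  have key : (2 * Y) * M < c * R := by
    refine lt_of_mul_lt_mul_right ?_ (Nat.zero_le ((p + q + 6) * (p + 2) * (p + 2) * (p + 1)))
    calc 2 * Y * M * ((p + q + 6) * (p + 2) * (p + 2) * (p + 1))
        = ((p + 2) * (p + 2) * (p + 1) * (p + q + 6) * (2 * Y)) * M := by ring
      _ < (X * (p - q) * (p + q + 4) * (p + q + 3)) * M := Nat.mul_lt_mul_of_pos_right hstar hMpos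
      _ = (X * (p - q)) * (p + q + 4) * ((p + q + 3) * M) := by ring
      _ = (c * (p + 2)) * (p + 1) * ((p + q + 4) * T') := by rw [hid2, hid3]; ring
      _ = (c * (p + 2) * (p + 2) * (p + 1)) * T := by rw [hid1]; ring
      _ ≤ (c * (p + 2) * (p + 2) * (p + 1)) * ((p + q + 6) * R) := Nat.mul_le_mul_left _ hT
      _ = _ := by ring
  exact lt_of_le_of_lt (Nat.mul_le_mul_right _ (Nat.sub_le _ _)) key

lemma phi_big (p q a : ℕ) (hq : 2 ≤ q) (h1 : q + 3 ≤ p + 2) (h2 : p + 2 ≤ 2 * q + 1)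
    (ha : p + 3 ≤ a)
    (hdeg : (p + q + 6) * a +
      (p + 3) * (2 * (p + 2).choose (q + 2) - 2) ≤ (p + q + 5) * (p + q + 4).choose (p + 2)) :
    a + 2 * (p + 2).choose (q + 2) < phi (p + 2) (q + 2) a + 2 := by
  by_cases hmid : a < (p + q + 3).choose (p + 2)
  · -- middle range
    let x := Nat.findGreatest (fun x => x.choose (p + 2) ≤ a) (p + q + 3)
    have hx0 : p + 3 ≤ x := Nat.le_findGreatest (by omega) (by
      show (p + 3).choose (p + 2) ≤ a
      rw [show (p + 3).choose (p + 2) = p + 3 from Nat.choose_succ_self_right (p + 2)]; exact ha)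
    have hxP : x.choose (p + 2) ≤ a :=
      Nat.findGreatest_spec (P := fun x => x.choose (p + 2) ≤ a) (m := p + 3) (by omega) (by
      show (p + 3).choose (p + 2) ≤ a
      rw [show (p + 3).choose (p + 2) = p + 3 from Nat.choose_succ_self_right (p + 2)]; exact ha)
    have hxle : x ≤ p + q + 3 := Nat.findGreatest_le _
    have hxlt : x < p + q + 3 := by
      rcases Nat.lt_or_ge x (p + q + 3) with h | h
      · exact h
      · have : x = p + q + 3 := le_antisymm hxle h
        rw [this] at hxP; omega
    have hx1 : a < (x + 1).choose (p + 2) := by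
      have := Nat.findGreatest_is_greatest (P := fun x => x.choose (p + 2) ≤ a) (k := x + 1)
        (n := p + q + 3) (Nat.lt_succ_self _) (by omega)
      simpa using this
    clear_value x
    obtain ⟨d, rfl⟩ : ∃ d, a = x.choose (p + 2) + d := ⟨_, (Nat.add_sub_of_le hxP).symm⟩
    rw [Nat.choose_succ_succ' x (p + 1), show p + 1 + 1 = p + 2 from rfl] at hx1
    have hst := phi_step (p + 1) (q + 1) x d (by omega) (by omega) (by omega)
    rw [show p + 1 + 1 = p + 2 from rfl, show q + 1 + 1 = q + 2 from rfl] at hst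
    have hly := phi_lym (p + 1) (q + 1) x d (by omega) (by omega) (by omega) (by omega)
    have hle := choose_le_of_le_add x (q + 1) (p + 1) (by omega) (by omega)
    have hpos : 0 < x.choose (p + 1) := Nat.choose_pos (by omega)
    have hphi : d ≤ phi (p + 1) (q + 1) d := by
      refine le_of_mul_le_mul_right ?_ hpos
      exact (Nat.mul_le_mul_left d hle).trans hly
    have := loss_int p q hq h1 h2 x hx0 hxle
    omega
  push Not at hmid
  obtain ⟨d, rfl⟩ : ∃ d, a = (p + q + 3).choose (p + 2) + d :=
    ⟨_, (Nat.add_sub_of_le hmid).symm⟩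
  have hc0 := loss_int p q hq h1 h2 (p + q + 3) (by omega) le_rfl
  have hY1 : 1 ≤ (p + 2).choose (q + 2) := Nat.choose_pos (by omega)
  have hpas : (p + q + 4).choose (p + 2) = (p + q + 3).choose (p + 2) +
      ((p + q + 2).choose (p + 1) + (p + q + 2).choose p) := by
    rw [Nat.choose_succ_succ' (p + q + 3) (p + 1), Nat.choose_succ_succ' (p + q + 2) p]; ring
  have hpas2 : (p + q + 3).choose (p + 1) =
      (p + q + 2).choose (p + 1) + (p + q + 2).choose p := by
    rw [Nat.choose_succ_succ' (p + q + 2) p]; ring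
  have hsym1 : (p + q + 2).choose (q + 1) = (p + q + 2).choose (p + 1) := by
    rw [← Nat.choose_symm (show q + 1 ≤ p + q + 2 by omega)]; congr 1; omega
  have hdle : d ≤ (p + q + 3).choose (p + 1) := by
    by_contra hcon
    have h3 : (p + q + 4).choose (p + 2) ≤ (p + q + 3).choose (p + 2) + d := by omega
    have h4 : (p + q + 6) * (p + q + 4).choose (p + 2) ≤
      (p + q + 6) * ((p + q + 3).choose (p + 2) + d) := Nat.mul_le_mul_left _ h3
    have hTpos : 0 < (p + q + 4).choose (p + 2) := Nat.choose_pos (by omega)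
    nlinarith
  have hst := phi_step (p + 1) (q + 1) (p + q + 3) d (by omega) (by omega) hdle
  rw [show p + 1 + 1 = p + 2 from rfl, show q + 1 + 1 = q + 2 from rfl] at hst
  by_cases hd : d ≤ (p + q + 2).choose (p + 1)
  · have hly := phi_lym (p + 1) (q + 1) (p + q + 2) d (by omega) (by omega) (by omega) hd
    rw [hsym1] at hly
    have hphi := le_of_mul_le_mul_right hly (Nat.choose_pos (show p + 1 ≤ p + q + 2 by omega))
    omega
  push Not at hd
  obtain ⟨e, rfl⟩ : ∃ e, d = (p + q + 2).choose (p + 1) + e :=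
    ⟨_, (Nat.add_sub_of_le hd.le).symm⟩
  have hele : e ≤ (p + q + 2).choose p := by omega
  have hst2 := phi_step p q (p + q + 2) e (by omega) (by omega) hele
  rw [hsym1] at hst2

  obtain rfl | hq3 : q = 2 ∨ 3 ≤ q := by omega
  · obtain rfl : p = 3 := by omega
    have he : e ≤ 19 := by
      norm_num [Nat.choose] at hdeg
      omega
    have hly := phi_lym 3 2 6 e (by omega) (by omega) (by omega)
      (le_trans he (by decide))
    norm_num [Nat.choose] at hly hst hst2 ⊢
    omega
  · obtain ⟨c, hc⟩ : ∃ c, (p + q + 3).choose (p + 2) + c = (p + q + 3).choose (q + 2) :=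
      ⟨(p + q + 3).choose (q + 2) - (p + q + 3).choose (p + 2), by omega⟩
    obtain ⟨he, hineq⟩ := top_ineq p q c e hq3 h1 h2 hc hdeg
    have hly := phi_lym p q (p + q + 2) e (by omega) (by omega) (by omega) he
    have hcM : (p + q + 2).choose p = (p + q + 2).choose q + c := by
      have e1 := Nat.choose_succ_succ' (p + q + 2) (p + 1)
      have e2 := Nat.choose_succ_succ' (p + q + 2) (q + 1)
      have e3 : (p + q + 2).choose (p + 1 + 1) = (p + q + 2).choose q := by
        rw [← Nat.choose_symm (show p + 1 + 1 ≤ p + q + 2 by omega)]; congr 1; omega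
      have e4 : (p + q + 2).choose (q + 1 + 1) = (p + q + 2).choose p := by
        rw [← Nat.choose_symm (show q + 1 + 1 ≤ p + q + 2 by omega)]; congr 1; omega
      rw [e3] at e1
      rw [e4] at e2
      rw [show p + q + 3 = p + q + 2 + 1 by omega, show p + 2 = p + 1 + 1 by omega,
        show q + 2 = q + 1 + 1 by omega] at hc
      omega
    have hMpos : 0 < (p + q + 2).choose p := Nat.choose_pos (by omega)
    have hgoal : e + (2 * (p + 2).choose (q + 2) - 2) < phi p q e + c := by
      refine lt_of_mul_lt_mul_right ?_ (Nat.zero_le ((p + q + 2).choose p))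
      obtain ⟨R, hR⟩ : ∃ R, (p + q + 2).choose p = e + R := ⟨_, (Nat.add_sub_of_le he).symm⟩
      rw [show (p + q + 2).choose p - e = R by omega] at hineq
      have hx : e * (p + q + 2).choose p + c * R =
          e * (p + q + 2).choose q + c * (p + q + 2).choose p := by
        have : e * (p + q + 2).choose p = e * (p + q + 2).choose q + e * c := by rw [hcM]; ring
        rw [this, hR]; ring
      rw [add_mul, add_mul]
      linarith
    omega

end S9

namespace S9
open Finset

lemma small_num (p q : ℕ) (hq : 2 ≤ q) (h1 : q + 1 ≤ p) (h2 : p + 1 ≤ 2 * q) :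
    p + (p + 1).choose (q + 2) < (p + 1).choose (q + 1) + (p - 1).choose (q - 1) ∧
    1 + (p + 1).choose (q + 2) < (p + 1).choose (q + 1) ∧
    1 < p.choose q ∧ p < p.choose q + (p - 1).choose (q - 1) := by
  obtain rfl | h3 : p = q + 1 ∨ q + 2 ≤ p := by omega
  · obtain ⟨q, rfl⟩ : ∃ j, q = j + 1 := ⟨q - 1, by omega⟩
    have e1 : (q + 1 + 1 + 1).choose (q + 1 + 2) = 1 := Nat.choose_self _
    have e2 : (q + 1 + 1 + 1).choose (q + 1 + 1) = q + 3 := Nat.choose_succ_self_right _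
    have e3 : (q + 1 + 1 - 1).choose (q + 1 - 1) = q + 1 := Nat.choose_succ_self_right _
    have e4 : (q + 1 + 1).choose (q + 1) = q + 2 := Nat.choose_succ_self_right _
    rw [e1, e2, e3, e4]
    omega
  · have hY := choose_le_of_add_le (p + 1) 2 (q + 1) (by omega) (by omega)
    have hU := choose_le_of_add_le p 2 q (by omega) (by omega)
    have hW : 0 < (p - 1).choose (q - 1) := Nat.choose_pos (by omega)
    have hZ := Nat.choose_succ_right_eq (p + 1) (q + 1)
    rw [show p + 1 - (q + 1) = p - q by omega, show q + 1 + 1 = q + 2 by rfl] at hZ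
    have c1 := Nat.triangle_succ p
    rw [Nat.choose_two_right] at hY hU
    have d1 : p * (p - 1) / 2 * 2 = p * (p - 1) := Nat.div_mul_cancel (Nat.even_mul_pred_self p).two_dvd
    have d2 : (p + 1) * (p + 1 - 1) / 2 * 2 = (p + 1) * (p + 1 - 1) :=
      Nat.div_mul_cancel (Nat.even_mul_pred_self (p + 1)).two_dvd
    have hUp : p < p.choose q := by
      obtain ⟨j, rfl⟩ : ∃ j, p = j + 5 := ⟨p - 5, by omega⟩
      rw [show j + 5 - 1 = j + 4 by omega] at *
      nlinarith
    have hD : p + (p + 1).choose (q + 2) < (p + 1).choose (q + 1) := by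
      generalize (p + 1).choose (q + 2) = Z at *
      generalize (p + 1).choose (q + 1) = Y at *
      have hY2 : (p + 1) * p ≤ 2 * Y := by
        rw [show p + 1 - 1 = p by omega] at *
        omega
      by_contra hcon
      push Not at hcon
      obtain ⟨w, rfl⟩ : ∃ w, p = q + w := ⟨p - q, by omega⟩
      rw [show q + w - q = w by omega] at hZ
      have h5 : w + 1 ≤ q := by omega
      have h6 : Y * (q + 2) ≤ (q + w) * (q + 2) + Y * w := by nlinarith
      have h7 : Y * 3 ≤ (q + w) * (q + 2) := by
        have : Y * (w + 3) ≤ Y * (q + 2) := Nat.mul_le_mul_left _ (by omega)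
        nlinarith
      have h8 : 3 * ((q + w + 1) * (q + w)) ≤ 2 * ((q + w) * (q + 2)) := by omega
      have h9 : 0 < q + w := by omega
      have h10 : (q + w) * (3 * (q + w + 1)) ≤ (q + w) * (2 * (q + 2)) := by nlinarith
      have := le_of_mul_le_mul_left h10 h9
      omega
    refine ⟨?_, ?_, ?_, ?_⟩ <;> omega

lemma newcard (C X : Finset ℕ) (D : Finset (Finset ℕ)) (r s : ℕ) (hC : C.card = s) (hX : X ⊆ C)
    (hXr : X.card ≤ r) (hD : ∀ Y ∈ D, ¬ X ⊆ Y) :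
    (s - X.card).choose (r - X.card) ≤ (powersetCard r C \ sh r D).card := by
  rw [← hC, ← card_sdiff_of_subset hX, ← card_powersetCard]
  refine card_le_card_of_injOn (fun T => T ∪ X) ?_ ?_
  · intro T hT
    have hT := mem_powersetCard.1 (mem_coe.1 hT)
    have hdis : Disjoint T X := disjoint_of_subset_left hT.1 sdiff_disjoint
    refine mem_coe.2 (mem_sdiff.2 ⟨mem_powersetCard.2 ⟨union_subset (hT.1.trans sdiff_subset) hX, ?_⟩, ?_⟩)
    · rw [card_union_of_disjoint hdis, hT.2]; omega
    · intro h
      obtain ⟨Y, hY, hs, -⟩ := mem_sh.1 h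
      exact hD Y hY (subset_union_right.trans hs)
  · intro T hT T' hT' h
    have hT := mem_powersetCard.1 (mem_coe.1 hT)
    have hT' := mem_powersetCard.1 (mem_coe.1 hT')
    have hdis : Disjoint T X := disjoint_of_subset_left hT.1 sdiff_disjoint
    have hdis' : Disjoint T' X := disjoint_of_subset_left hT'.1 sdiff_disjoint
    have h : T ∪ X = T' ∪ X := h
    rw [← union_sdiff_cancel_right hdis, h, union_sdiff_cancel_right hdis']

lemma newj (C : Finset ℕ) (D : Finset (Finset ℕ)) (r s j : ℕ) (hC : C.card = s)
    (hDs : ∀ Y ∈ D, Y.card = s) (hCD : C ∉ D) (hj : D.card ≤ j) (hjr : j ≤ r) (hrs : r ≤ s) :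
    (s - j).choose (r - j) ≤ (powersetCard r C \ sh r D).card := by
  have h : ∀ Y : Finset ℕ, ∃ x, Y ∈ D → x ∈ C ∧ x ∉ Y := by
    intro Y
    by_cases hY : Y ∈ D
    · have : ¬ C ⊆ Y := by
        intro hs
        have := eq_of_subset_of_card_le hs (by rw [hC, hDs Y hY])
        exact hCD (this ▸ hY)
      obtain ⟨x, hx, hx'⟩ := not_subset.1 this
      exact ⟨x, fun _ => ⟨hx, hx'⟩⟩
    · exact ⟨0, fun h => absurd h hY⟩
  choose f hf using h
  have h0 : D.image f ⊆ C := by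
    intro x hx
    obtain ⟨Y, hY, rfl⟩ := mem_image.1 hx
    exact (hf Y hY).1
  obtain ⟨X, hX1, hX2, hX3⟩ := exists_subsuperset_card_eq h0 (card_image_le.trans hj)
    (by rw [hC]; omega)
  have := newcard C X D r s hC hX2 (by omega) (fun Y hY hXY =>
    (hf Y hY).2 (hXY (hX1 (mem_image_of_mem f hY))))
  rwa [hX3] at this

lemma sh_insert (r : ℕ) (C : Finset ℕ) (D : Finset (Finset ℕ)) :
    (sh r (insert C D)).card = (sh r D).card + (powersetCard r C \ sh r D).card := by
  have : sh r (insert C D) = sh r D ∪ (powersetCard r C \ sh r D) := by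
    unfold sh
    rw [biUnion_insert, union_sdiff_self_eq_union, union_comm]
  rw [this, card_union_of_disjoint disjoint_sdiff]

lemma small_case (p q : ℕ) (hq : 2 ≤ q) (h1 : q + 1 ≤ p) (h2 : p + 1 ≤ 2 * q)
    (C : Finset (Finset ℕ)) (hC : ∀ X ∈ C, X.card = p + 2) (h3 : 3 ≤ C.card)
    (h4 : C.card ≤ p + 2) (hU : 2 * (p + 2) + 1 ≤ (C.biUnion id).card + (q + 2)) :
    C.card + 2 * (p + 2).choose (q + 2) < (sh (q + 2) C).card + 2 := by
  obtain ⟨n1, n2, n3, n4⟩ := small_num p q hq h1 h2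
  have hpas : (p + 2).choose (q + 2) = (p + 1).choose (q + 1) + (p + 1).choose (q + 2) :=
    Nat.choose_succ_succ' (p + 1) (q + 1)
  obtain ⟨C1, hC1, C2, hC2, h12⟩ := one_lt_card.1 (show 1 < C.card by omega)
  have hs0 : (sh (q + 2) {C1}).card = (p + 2).choose (q + 2) := by
    simp [sh, hC C1 hC1]
  have hs1 : (p + 1).choose (q + 1) ≤ (powersetCard (q + 2) C2 \ sh (q + 2) {C1}).card := by
    refine newj C2 {C1} (q + 2) (p + 2) 1 (hC _ hC2) ?_ ?_ (by simp) (by omega) (by omega)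
    · intro Y hY; rw [mem_singleton.1 hY]; exact hC _ hC1
    · simpa using h12.symm
  have hi1 := sh_insert (q + 2) C2 {C1}
  -- the fourth set
  have fourth : ∀ C3 ∈ C, C.card = 3 ∨ (sh (q + 2) (insert C3 (insert C2 {C1}))).card +
      (p - 1).choose (q - 1) ≤ (sh (q + 2) C).card := by
    intro C3 hC3
    obtain h | h : C.card = 3 ∨ 4 ≤ C.card := by omega
    · exact Or.inl h
    right
    have hle : (insert C3 (insert C2 {C1}) : Finset (Finset ℕ)).card ≤ 3 := card_le_three
    obtain ⟨C4, hC4, hC4'⟩ := exists_mem_notMem_of_card_lt_card (lt_of_le_of_lt hle h)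
    have hsub : (insert C3 (insert C2 {C1}) : Finset (Finset ℕ)) ⊆ C := by
      intro Y hY
      simp only [mem_insert, mem_singleton] at hY
      rcases hY with rfl | rfl | rfl <;> assumption
    have := newj C4 _ (q + 2) (p + 2) 3 (hC _ hC4) (fun Y hY => hC Y (hsub hY)) hC4' hle
      (by omega) (by omega)
    have hi := sh_insert (q + 2) C4 (insert C3 (insert C2 {C1}))
    have hm := card_le_card (sh_mono (r := q + 2) (insert_subset hC4 hsub))
    rw [show p + 2 - 3 = p - 1 by omega, show q + 2 - 3 = q - 1 by omega] at this
    omega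
  have third : ∀ C3 ∈ C, (sh (q + 2) (insert C3 (insert C2 {C1}))).card ≤ (sh (q + 2) C).card := by
    intro C3 hC3
    refine card_le_card (sh_mono ?_)
    intro Y hY
    simp only [mem_insert, mem_singleton] at hY
    rcases hY with rfl | rfl | rfl <;> assumption
  by_cases hfull : ∃ C3 ∈ C, ∃ v ∈ C3, v ∉ C1 ∪ C2
  · obtain ⟨C3, hC3, v, hv, hv'⟩ := hfull
    have hs2 := newcard C3 {v} (insert C2 {C1}) (q + 2) (p + 2) (hC _ hC3) (by simpa using hv)
      (by simp) (by
        intro Y hY hvY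
        simp only [mem_insert, mem_singleton] at hY
        rw [mem_union, not_or] at hv'
        rw [singleton_subset_iff] at hvY
        rcases hY with rfl | rfl
        · exact hv'.2 hvY
        · exact hv'.1 hvY)
    rw [card_singleton, show p + 2 - 1 = p + 1 by omega, show q + 2 - 1 = q + 1 by omega] at hs2
    have hi2 := sh_insert (q + 2) C3 (insert C2 {C1})
    have h5 := third C3 hC3
    rcases fourth C3 hC3 with h6 | h6 <;> omega
  · push Not at hfull
    have hsub : C.biUnion id ⊆ C1 ∪ C2 := by
      intro v hv
      obtain ⟨Y, hY, hvY⟩ := mem_biUnion.1 hv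
      exact hfull Y hY v hvY
    have hcu := card_le_card hsub
    have hci := card_union_add_card_inter C1 C2
    rw [hC _ hC1, hC _ hC2] at hci
    have hdis : powersetCard (q + 2) C2 \ sh (q + 2) {C1} = powersetCard (q + 2) C2 := by
      rw [Finset.sdiff_eq_self_iff_disjoint, disjoint_left]
      intro S hS hS'
      rw [mem_powersetCard] at hS
      obtain ⟨Y, hY, hSY, -⟩ := mem_sh.1 hS'
      rw [mem_singleton] at hY
      subst hY
      have := card_le_card (subset_inter hSY hS.1)
      omega
    rw [hdis, card_powersetCard, hC _ hC2] at hi1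
    have hle : (insert C2 {C1} : Finset (Finset ℕ)).card ≤ 2 := card_le_two
    obtain ⟨C3, hC3, hC3'⟩ := exists_mem_notMem_of_card_lt_card (lt_of_le_of_lt hle h3)
    have hs2 := newj C3 (insert C2 {C1}) (q + 2) (p + 2) 2 (hC _ hC3) (by
      intro Y hY
      simp only [mem_insert, mem_singleton] at hY
      rcases hY with rfl | rfl <;> exact hC _ (by assumption)) hC3' hle (by omega) (by omega)
    rw [show p + 2 - 2 = p by omega, show q + 2 - 2 = q by omega] at hs2
    have hi2 := sh_insert (q + 2) C3 (insert C2 {C1})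
    have h5 := third C3 hC3
    rcases fourth C3 hC3 with h6 | h6 <;> omega

end S9

namespace S9
open Finset

lemma perm_step (m : ℕ) : ∀ S T : Finset ℕ, S.card = T.card → (S \ T).card = m →
    ∃ π : Equiv.Perm ℕ, (∀ x, x ∉ S → x ∉ T → π x = x) ∧ S.image π = T := by
  induction m with
  | zero =>
    intro S T h h0
    have hST : S ⊆ T := sdiff_eq_empty_iff_subset.1 (card_eq_zero.1 h0)
    have := eq_of_subset_of_card_le hST h.ge
    exact ⟨1, fun _ _ _ => rfl, by subst this; simp⟩
  | succ m ih =>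
    intro S T h h0
    have h0' : (T \ S).card = m + 1 := by rw [← card_sdiff_comm h, h0]
    obtain ⟨x, hx⟩ := card_pos.1 (show 0 < (S \ T).card by omega)
    obtain ⟨y, hy⟩ := card_pos.1 (show 0 < (T \ S).card by omega)
    rw [mem_sdiff] at hx hy
    have himg : S.image (Equiv.swap x y) = insert y (S.erase x) := by
      ext z
      simp only [mem_image, mem_insert, mem_erase]
      constructor
      · rintro ⟨w, hw, rfl⟩
        by_cases hwx : w = x
        · subst hwx; left; simp
        · have hwy : w ≠ y := fun h => hy.2 (h ▸ hw)
          right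
          rw [Equiv.swap_apply_of_ne_of_ne hwx hwy]
          exact ⟨hwx, hw⟩
      · rintro (rfl | ⟨hzx, hz⟩)
        · exact ⟨x, hx.1, by simp⟩
        · have hwy : z ≠ y := fun h => hy.2 (h ▸ hz)
          exact ⟨z, hz, Equiv.swap_apply_of_ne_of_ne hzx hwy⟩
    have hc : (insert y (S.erase x)).card = T.card := by
      rw [← himg, card_image_of_injective _ (Equiv.injective _), h]
    have hd : (insert y (S.erase x) \ T) = (S \ T).erase x := by
      ext z
      simp only [mem_sdiff, mem_insert, mem_erase]
      constructor
      · rintro ⟨rfl | h1, h2⟩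
        · exact absurd hy.1 h2
        · exact ⟨h1.1, h1.2, h2⟩
      · rintro ⟨h1, h2, h3⟩
        exact ⟨Or.inr ⟨h1, h2⟩, h3⟩
    obtain ⟨π, hπ1, hπ2⟩ := ih (insert y (S.erase x)) T hc (by
      rw [hd, card_erase_of_mem (mem_sdiff.2 hx), h0]; omega)
    refine ⟨π * Equiv.swap x y, ?_, ?_⟩
    · intro z hzS hzT
      have hzx : z ≠ x := fun h => hzS (h ▸ hx.1)
      have hzy : z ≠ y := fun h => hzT (h ▸ hy.1)
      rw [Equiv.Perm.mul_apply, Equiv.swap_apply_of_ne_of_ne hzx hzy]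
      refine hπ1 z ?_ hzT
      simp only [mem_insert, mem_erase, not_or]
      exact ⟨hzy, fun h => hzS h.2⟩
    · rw [Equiv.Perm.coe_mul, ← image_image, himg, hπ2]

lemma image_fix (π : Equiv.Perm ℕ) (X : Finset ℕ) (h : ∀ x ∈ X, π x = x) : X.image π = X := by
  conv_rhs => rw [← image_id (s := X)]
  exact image_congr (fun x hx => h x hx)

/-- simultaneous transport of a pair of sets -/
lemma perm_pair (V A1 A2 B1 B2 : Finset ℕ) (hA1 : A1 ⊆ V) (hA2 : A2 ⊆ V) (hB1 : B1 ⊆ V)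
    (hB2 : B2 ⊆ V) (h1 : A1.card = B1.card) (h2 : A2.card = B2.card)
    (h3 : (A1 ∩ A2).card = (B1 ∩ B2).card) :
    ∃ σ : Equiv.Perm ℕ, (∀ x, x ∉ V → σ x = x) ∧ A1.image σ = B1 ∧ A2.image σ = B2 := by
  obtain ⟨π, hπ1, hπ2⟩ := perm_step _ A1 B1 h1 rfl
  have hπV : ∀ x, x ∉ V → π x = x := fun x hx => hπ1 x (fun h => hx (hA1 h)) (fun h => hx (hB1 h))
  set D := A2.image π with hD
  have hDc : D.card = A2.card := card_image_of_injective _ π.injective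
  have hDi : (B1 ∩ D).card = (A1 ∩ A2).card := by
    rw [← hπ2, hD, ← image_inter _ _ π.injective, card_image_of_injective _ π.injective]
  have hDV : D ⊆ V := by
    intro y hy
    obtain ⟨x, hx, rfl⟩ := mem_image.1 hy
    by_contra hcon
    have := hπV _ hcon
    have := π.injective this
    exact hcon (this.symm ▸ hA2 hx)
  obtain ⟨ρ, hρ1, hρ2⟩ := perm_step _ (B1 ∩ D) (B1 ∩ B2) (by omega) rfl
  have hs1 := card_sdiff_add_card_inter D B1
  have hs2 := card_sdiff_add_card_inter B2 B1
  rw [inter_comm] at hs1 hs2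
  obtain ⟨τ, hτ1, hτ2⟩ := perm_step _ (D \ B1) (B2 \ B1) (by omega) rfl
  have hρB1 : ∀ x, x ∉ B1 → ρ x = x := fun x hx =>
    hρ1 x (fun h => hx (mem_inter.1 h).1) (fun h => hx (mem_inter.1 h).1)
  have hτB1 : ∀ x, x ∈ B1 → τ x = x := fun x hx =>
    hτ1 x (fun h => (mem_sdiff.1 h).2 hx) (fun h => (mem_sdiff.1 h).2 hx)
  have hρimg : B1.image ρ = B1 := by
    refine eq_of_subset_of_card_le ?_ (by rw [card_image_of_injective _ ρ.injective])
    intro y hy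
    obtain ⟨x, hx, rfl⟩ := mem_image.1 hy
    by_contra hcon
    exact hcon ((ρ.injective (hρB1 _ hcon)).symm ▸ hx)
  refine ⟨τ * ρ * π, ?_, ?_, ?_⟩
  · intro x hx
    rw [Equiv.Perm.mul_apply, Equiv.Perm.mul_apply, hπV x hx, hρB1 x (fun h => hx (hB1 h))]
    exact hτ1 x (fun h => hx (hDV (mem_sdiff.1 h).1)) (fun h => hx (hB2 (mem_sdiff.1 h).1))
  · rw [Equiv.Perm.coe_mul, Equiv.Perm.coe_mul, ← image_image, hπ2, ← image_image, hρimg,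
      image_fix τ B1 hτB1]
  · rw [Equiv.Perm.coe_mul, Equiv.Perm.coe_mul, ← image_image, ← hD, ← image_image]
    have e : D = (B1 ∩ D) ∪ (D \ B1) := by
      rw [union_comm, inter_comm, sdiff_union_inter]
    rw [e, image_union, image_union, hρ2, image_fix ρ (D \ B1) (fun x hx =>
      hρB1 x (mem_sdiff.1 hx).2), hτ2, image_fix τ (B1 ∩ B2) (fun x hx =>
      hτB1 x (mem_inter.1 hx).1), union_comm, inter_comm, sdiff_union_inter]

/-- sets containing `1` correspond to `(k-1)`-subsets of `[2,n]` -/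
lemma card_star (n k : ℕ) (hk : 1 ≤ k) (hn : 1 ≤ n) (P : Finset ℕ → Prop) [DecidablePred P]
    (G : Finset (Finset ℕ)) (hG : ∀ A, A ∈ G ↔ A ∈ powersetCard k (Icc 1 n) ∧ 1 ∈ A ∧ P (A.erase 1)) :
    G.card = ((powersetCard (k - 1) (Icc 2 n)).filter P).card := by
  refine card_bij (fun A _ => A.erase 1) ?_ ?_ ?_
  · intro A hA
    obtain ⟨h1, h2, h3⟩ := (hG A).1 hA
    rw [mem_powersetCard] at h1
    refine mem_filter.2 ⟨mem_powersetCard.2 ⟨?_, ?_⟩, h3⟩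
    · intro x hx
      rw [mem_erase] at hx
      have := mem_Icc.1 (h1.1 hx.2)
      rw [mem_Icc]; omega
    · rw [card_erase_of_mem h2, h1.2]
  · intro A hA B hB h
    rw [← insert_erase ((hG A).1 hA).2.1, ← insert_erase ((hG B).1 hB).2.1, h]
  · intro S hS
    rw [mem_filter, mem_powersetCard] at hS
    have h1S : 1 ∉ S := fun h => by have := mem_Icc.1 (hS.1.1 h); omega
    refine ⟨insert 1 S, (hG _).2 ⟨mem_powersetCard.2 ⟨?_, ?_⟩, mem_insert_self _ _, ?_⟩, erase_insert h1S⟩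
    · intro x hx
      rcases mem_insert.1 hx with rfl | hx
      · rw [mem_Icc]; omega
      · have := mem_Icc.1 (hS.1.1 hx)
        rw [mem_Icc]; omega
    · rw [card_insert_of_notMem h1S, hS.1.2]; omega
    · rw [erase_insert h1S]; exact hS.2

lemma inter_erase_one (A B : Finset ℕ) (h : 1 ∉ B) : A.erase 1 ∩ B = A ∩ B := by
  ext x
  simp only [mem_inter, mem_erase]
  constructor
  · rintro ⟨⟨_, h2⟩, h3⟩; exact ⟨h2, h3⟩
  · rintro ⟨h2, h3⟩; exact ⟨⟨fun hx => h (hx ▸ h3), h2⟩, h3⟩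

lemma subset_sdiff_iff_inter (S V A : Finset ℕ) (hS : S ⊆ V) :
    ¬ (S ∩ A).Nonempty ↔ S ⊆ V \ A := by
  rw [not_nonempty_iff_eq_empty, ← disjoint_iff_inter_eq_empty, subset_sdiff]
  exact ⟨fun h => ⟨hS, h⟩, fun h => h.2⟩

lemma Jcard (n k t i : ℕ) (hk : 5 ≤ k) (ht : 3 ≤ t) (hn1 : 2 * k + 1 ≤ n)
    (hn2 : n + t < 3 * k) (hi1 : k - t + 1 ≤ i) (hi2 : i ≤ k) :
    (Jfam n k i).card + 2 * (n - 1 - k).choose (k - 1) = 2 + (n - 1).choose (k - 1) := by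
  unfold Jfam
  set A1 := Iset k 1 with hA1
  set A2 := Iset k i with hA2
  have a1 : A1 ⊆ Icc 2 n := by
    intro x hx; rw [hA1, Iset, mem_Icc] at hx; rw [mem_Icc]; omega
  have a2 : A2 ⊆ Icc 2 n := by
    intro x hx; rw [hA2, Iset, mem_Icc] at hx; rw [mem_Icc]; omega
  have c1 : A1.card = k := by rw [hA1, Iset, Nat.card_Icc]; omega
  have c2 : A2.card = k := by rw [hA2, Iset, Nat.card_Icc]; omega
  have o1 : 1 ∉ A1 := by rw [hA1, Iset, mem_Icc]; omega
  have o2 : 1 ∉ A2 := by rw [hA2, Iset, mem_Icc]; omega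
  have hne : A1 ≠ A2 := by
    intro h
    have : 2 ∈ A2 := by rw [← h, hA1, Iset, mem_Icc]; omega
    rw [hA2, Iset, mem_Icc] at this
    omega
  have hin : (A1 ∩ A2).card ≤ t := by
    have : A1 ∩ A2 ⊆ Icc (i + 1) (k + 1) := by
      intro x hx
      rw [mem_inter, hA1, hA2, Iset, Iset, mem_Icc, mem_Icc] at hx
      rw [mem_Icc]; omega
    have := card_le_card this
    rw [Nat.card_Icc] at this
    omega
  have hun := card_union_add_card_inter A1 A2
  have hV : (Icc 2 n).card = n - 1 := by rw [Nat.card_Icc]; omega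
  rw [card_union_of_disjoint, card_pair hne]
  · rw [card_star n k (by omega) (by omega) (fun S => (S ∩ A1).Nonempty ∧ (S ∩ A2).Nonempty)]
    · have hsplit := card_filter_add_card_filter_not (s := powersetCard (k - 1) (Icc 2 n))
        (fun S => (S ∩ A1).Nonempty ∧ (S ∩ A2).Nonempty)
      have hneg : (powersetCard (k - 1) (Icc 2 n)).filter
          (fun S => ¬ ((S ∩ A1).Nonempty ∧ (S ∩ A2).Nonempty)) =
          powersetCard (k - 1) (Icc 2 n \ A1) ∪ powersetCard (k - 1) (Icc 2 n \ A2) := by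
        ext S
        rw [mem_filter, mem_union, mem_powersetCard, mem_powersetCard, mem_powersetCard, not_and_or]
        constructor
        · rintro ⟨⟨h1, h2⟩, h3⟩
          rw [subset_sdiff_iff_inter _ _ _ h1, subset_sdiff_iff_inter _ _ _ h1] at h3
          exact h3.imp (fun h => ⟨h, h2⟩) (fun h => ⟨h, h2⟩)
        · rintro (⟨h1, h2⟩ | ⟨h1, h2⟩)
          · have h3 := h1.trans sdiff_subset
            exact ⟨⟨h3, h2⟩, Or.inl ((subset_sdiff_iff_inter _ _ _ h3).2 h1)⟩
          · have h3 := h1.trans sdiff_subset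
            exact ⟨⟨h3, h2⟩, Or.inr ((subset_sdiff_iff_inter _ _ _ h3).2 h1)⟩
      rw [hneg, card_union_of_disjoint, card_powersetCard, card_powersetCard, card_powersetCard,
        card_sdiff_of_subset a1, card_sdiff_of_subset a2, c1, c2, hV] at hsplit
      · omega
      · rw [disjoint_left]
        intro S h1 h2
        rw [mem_powersetCard] at h1 h2
        have hs : S ⊆ Icc 2 n \ (A1 ∪ A2) := by
          intro x hx
          have e1 := mem_sdiff.1 (h1.1 hx)
          have e2 := mem_sdiff.1 (h2.1 hx)
          rw [mem_sdiff, mem_union]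
          exact ⟨e1.1, fun h => h.elim e1.2 e2.2⟩
        have := card_le_card hs
        rw [card_sdiff_of_subset (union_subset a1 a2), hV] at this
        omega
    · intro A
      rw [mem_filter, inter_erase_one A A1 o1, inter_erase_one A A2 o2]
  · rw [disjoint_left]
    intro A h1 h2
    have h3 := (mem_filter.1 h2).2.1
    rcases mem_insert.1 h1 with rfl | h1
    · exact o1 h3
    · rw [mem_singleton] at h1; subst h1; exact o2 h3

lemma degree_bound (n k : ℕ) (F : Finset (Finset ℕ)) (hF : F ⊆ powersetCard k (Icc 1 n)) :
    n * diversity n F ≤ (n - k) * F.card := by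
  have h1 : ∀ i ∈ Icc 1 n, diversity n F ≤ (F.filter (fun A => i ∉ A)).card := by
    intro i hi
    refine Nat.sInf_le ⟨i, ?_, rfl⟩
    simpa using hi
  have h2 := sum_le_sum h1
  rw [sum_const, Nat.card_Icc, smul_eq_mul, Nat.add_sub_cancel] at h2
  refine h2.trans (le_of_eq ?_)
  simp_rw [card_filter]
  rw [sum_comm]
  have h3 : ∀ A ∈ F, ∑ i ∈ Icc 1 n, (if i ∉ A then 1 else 0) = n - k := by
    intro A hA
    have := mem_powersetCard.1 (hF hA)
    rw [← card_filter, filter_notMem_eq_sdiff, card_sdiff_of_subset this.1, this.2, Nat.card_Icc]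
    omega
  rw [sum_congr rfl h3, sum_const, smul_eq_mul, mul_comm]

lemma star_bound (n k : ℕ) (hk : 1 ≤ k) (hn : 1 ≤ n) (F : Finset (Finset ℕ))
    (hF : F ⊆ powersetCard k (Icc 1 n)) (hint : Intersecting F) :
    (F.filter (fun A => 1 ∈ A)).card +
      (sh (k - 1) ((F.filter (fun A => 1 ∉ A)).image (fun A => Icc 2 n \ A))).card
      ≤ (n - 1).choose (k - 1) := by
  set C := (F.filter (fun A => 1 ∉ A)).image (fun A => Icc 2 n \ A) with hC
  have hb : (F.filter (fun A => 1 ∈ A)).card =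
      ((F.filter (fun A => 1 ∈ A)).image (fun A => A.erase 1)).card := by
    rw [card_image_of_injOn]
    intro A hA B hB h
    have hA := (mem_filter.1 (mem_coe.1 hA)).2
    have hB := (mem_filter.1 (mem_coe.1 hB)).2
    have h : A.erase 1 = B.erase 1 := h
    rw [← insert_erase hA, ← insert_erase hB, h]
  have hV : (Icc 2 n).card = n - 1 := by rw [Nat.card_Icc]; omega
  rw [hb, ← hV, ← card_powersetCard, ← card_union_of_disjoint]
  · refine card_le_card (union_subset ?_ ?_)
    · intro S hS
      obtain ⟨A, hA, rfl⟩ := mem_image.1 hS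
      have hA := mem_filter.1 hA
      have h1 := mem_powersetCard.1 (hF hA.1)
      refine mem_powersetCard.2 ⟨?_, by rw [card_erase_of_mem hA.2, h1.2]⟩
      intro x hx
      rw [mem_erase] at hx
      have := mem_Icc.1 (h1.1 hx.2)
      rw [mem_Icc]; omega
    · intro S hS
      obtain ⟨X, hX, hSX, hc⟩ := mem_sh.1 hS
      obtain ⟨A, hA, rfl⟩ := mem_image.1 hX
      exact mem_powersetCard.2 ⟨hSX.trans sdiff_subset, hc⟩
  · rw [disjoint_left]
    intro S hS hS'
    obtain ⟨B, hB, rfl⟩ := mem_image.1 hS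
    obtain ⟨X, hX, hSX, hc⟩ := mem_sh.1 hS'
    obtain ⟨A, hA, rfl⟩ := mem_image.1 hX
    rw [mem_filter] at hA hB
    obtain ⟨x, hx⟩ := hint B hB.1 A hA.1
    rw [mem_inter] at hx
    have hx1 : x ≠ 1 := fun h => hA.2 (h ▸ hx.2)
    exact (mem_sdiff.1 (hSX (mem_erase.2 ⟨hx1, hx.1⟩))).2 hx.2

end S9

namespace S9
open Finset

lemma div_two (n k t : ℕ) (hk : 5 ≤ k) (ht : 3 ≤ t)
    (hn1 : 2 * k + 1 ≤ n) (hn2 : n + t < 3 * k)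
    (F : Finset (Finset ℕ)) (hF : F ⊆ Finset.powersetCard k (Finset.Icc 1 n))
    (hint : Intersecting F)
    (hdiv : diversity n F = (F.filter (fun A => 1 ∉ A)).card)
    (hinter : (famInter n (F.filter (fun A => 1 ∉ A))).card ≤ t)
    (hcard : F.card = (Jfam n k (k - t + 1)).card) :
    (F.filter (fun A => 1 ∉ A)).card = 2 := by
  have hJ := Jcard n k t (k - t + 1) hk ht hn1 hn2 le_rfl (by omega)
  have hdg := degree_bound n k F hF
  have hst := star_bound n k (by omega) (by omega) F hF hint
  have hsp := card_filter_add_card_filter_not (s := F) (fun A => 1 ∈ A)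
  rw [hdiv] at hdg
  rw [← hcard] at hJ
  set D := F.filter (fun A => 1 ∉ A) with hD
  set C := D.image (fun A => Icc 2 n \ A) with hC
  have hDV : ∀ A ∈ D, A ⊆ Icc 2 n ∧ A.card = k := by
    intro A hA
    have h1 := mem_filter.1 hA
    have h2 := mem_powersetCard.1 (hF h1.1)
    refine ⟨?_, h2.2⟩
    intro x hx
    have h3 := mem_Icc.1 (h2.1 hx)
    have : x ≠ 1 := fun h => h1.2 (h ▸ hx)
    rw [mem_Icc]; omega
  have hV : (Icc 2 n).card = n - 1 := by rw [Nat.card_Icc]; omega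
  have hCD : C.card = D.card := by
    rw [hC, card_image_of_injOn]
    intro A hA B hB h
    have h : Icc 2 n \ A = Icc 2 n \ B := h
    rw [← Finset.sdiff_sdiff_eq_self (hDV A hA).1, ← Finset.sdiff_sdiff_eq_self (hDV B hB).1, h]
  have hCs : ∀ X ∈ C, X.card = n - 1 - k := by
    intro X hX
    obtain ⟨A, hA, rfl⟩ := mem_image.1 hX
    rw [card_sdiff_of_subset (hDV A hA).1, hV, (hDV A hA).2]
  have hge : 2 ≤ D.card := by
    by_contra hcon
    obtain h0 | h0 : D.card = 0 ∨ D.card = 1 := by omega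
    · rw [card_eq_zero] at h0
      rw [h0, famInter] at hinter
      simp at hinter
      omega
    · obtain ⟨A, hA⟩ := card_eq_one.1 h0
      have hAD : A ∈ D := by rw [hA]; simp
      have h1 : A ⊆ famInter n D := by
        intro x hx
        rw [hA, famInter, mem_filter]
        have := mem_Icc.1 ((hDV A hAD).1 hx)
        refine ⟨by rw [mem_Icc]; omega, ?_⟩
        intro B hB
        rw [mem_singleton] at hB
        exact hB ▸ hx
      have := card_le_card h1
      rw [(hDV A hAD).2] at this
      omega
  have hU : n - 1 ≤ (C.biUnion id).card + t := by
    have h1 : Icc 2 n ⊆ C.biUnion id ∪ famInter n D := by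
      intro x hx
      rw [mem_union]
      by_cases h : ∀ A ∈ D, x ∈ A
      · right
        rw [famInter, mem_filter]
        rw [mem_Icc] at hx
        exact ⟨by rw [mem_Icc]; omega, h⟩
      · left
        push Not at h
        obtain ⟨A, hA, hxA⟩ := h
        exact mem_biUnion.2 ⟨_, mem_image_of_mem _ hA, mem_sdiff.2 ⟨hx, hxA⟩⟩
    have := (card_le_card h1).trans (card_union_le _ _)
    rw [hV] at this
    omega
  by_contra hne
  obtain ⟨q, rfl⟩ : ∃ q, k = q + 3 := ⟨k - 3, by omega⟩
  obtain ⟨p, rfl⟩ : ∃ p, n = p + q + 6 := ⟨n - q - 6, by omega⟩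
  rw [show p + q + 6 - 1 - (q + 3) = p + 2 by omega] at hCs hJ
  rw [show q + 3 - 1 = q + 2 by omega, show p + q + 6 - 1 = p + q + 5 by omega] at *
  rw [show p + q + 6 - (q + 3) = p + 3 by omega] at hdg
  rw [← hCD] at hdg hsp hne hge
  have hY1 : 1 ≤ (p + 2).choose (q + 2) := Nat.choose_pos (by omega)
  by_cases hsmall : C.card ≤ p + 2
  · have := small_case p q (by omega) (by omega) (by omega) C hCs (by omega) hsmall (by omega)
    omega
  · have hid := Nat.add_one_mul_choose_eq (p + q + 4) (p + 2)
    have hsy : (p + q + 5).choose (q + 2) = (p + q + 5).choose (p + 3) := by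
      rw [← Nat.choose_symm (show q + 2 ≤ p + q + 5 by omega)]; congr 1; omega
    rw [show p + q + 4 + 1 = p + q + 5 from rfl, show p + 2 + 1 = p + 3 from rfl, ← hsy] at hid
    have h5 := phi_big p q C.card (by omega) (by omega) (by omega) (by omega) (by
      rw [hid, show (p + q + 5).choose (q + 2) = F.card + (2 * (p + 2).choose (q + 2) - 2) by omega]
      calc _ ≤ (p + 3) * F.card + (p + 3) * (2 * (p + 2).choose (q + 2) - 2) :=
            Nat.add_le_add_right hdg _
        _ = _ := by ring)
    have h6 := phi_le (r := q + 2) C hCs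
    omega

end S9

theorem stmt9 (n k t : ℕ) (hk : 5 ≤ k) (ht : 3 ≤ t)
    (hn1 : 2 * k + 1 ≤ n) (hn2 : (n : ℤ) < 3 * (k : ℤ) - t)
    (F : Finset (Finset ℕ)) (hF : F ⊆ Finset.powersetCard k (Finset.Icc 1 n))
    (hint : Intersecting F)
    (hdiv : diversity n F = (F.filter (fun A => 1 ∉ A)).card)
    (hinter : (famInter n (F.filter (fun A => 1 ∉ A))).card ≤ t)
    (hcard : F.card = (Jfam n k (k - t + 1)).card) :
    ∃ i : ℕ, k - t + 1 ≤ i ∧ i ≤ k ∧ Isomorphic n F (Jfam n k i) := by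
  have hn3 : n + t < 3 * k := by omega
  have h2 := S9.div_two n k t hk ht hn1 hn3 F hF hint hdiv hinter hcard
  obtain ⟨A1, A2, hne, hD⟩ := Finset.card_eq_two.1 h2
  have hm1 : A1 ∈ F.filter (fun A => 1 ∉ A) := by rw [hD]; simp
  have hm2 : A2 ∈ F.filter (fun A => 1 ∉ A) := by rw [hD]; simp
  have hDV : ∀ A ∈ F.filter (fun A => 1 ∉ A), A ⊆ Finset.Icc 2 n ∧ A.card = k := by
    intro A hA
    have h1 := Finset.mem_filter.1 hA
    have h2 := Finset.mem_powersetCard.1 (hF h1.1)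
    refine ⟨?_, h2.2⟩
    intro x hx
    have h3 := Finset.mem_Icc.1 (h2.1 hx)
    have : x ≠ 1 := fun h => h1.2 (h ▸ hx)
    rw [Finset.mem_Icc]; omega
  have hF1 := (Finset.mem_filter.1 hm1).1
  have hF2 := (Finset.mem_filter.1 hm2).1
  have hpos : 1 ≤ (A1 ∩ A2).card := Finset.card_pos.2 (hint A1 hF1 A2 hF2)
  have hle : (A1 ∩ A2).card ≤ t := by
    refine le_trans (Finset.card_le_card ?_) hinter
    intro x hx
    rw [Finset.mem_inter] at hx
    have := Finset.mem_Icc.1 ((hDV A1 hm1).1 hx.1)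
    rw [hD, famInter, Finset.mem_filter]
    refine ⟨by rw [Finset.mem_Icc]; omega, ?_⟩
    intro B hB
    rw [Finset.mem_insert, Finset.mem_singleton] at hB
    rcases hB with rfl | rfl
    · exact hx.1
    · exact hx.2
  obtain ⟨i, hi⟩ : ∃ i, i + (A1 ∩ A2).card = k + 1 := ⟨k + 1 - (A1 ∩ A2).card, by omega⟩
  have hi1 : k - t + 1 ≤ i := by omega
  have hi2 : i ≤ k := by omega
  refine ⟨i, hi1, hi2, ?_⟩
  have hcI : ∀ j, (Iset k j).card = k := by
    intro j; rw [Iset, Nat.card_Icc]; omega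
  have hI : ∀ j, 1 ≤ j → j ≤ k → Iset k j ⊆ Finset.Icc 2 n := by
    intro j h1 h2 x hx
    rw [Iset, Finset.mem_Icc] at hx
    rw [Finset.mem_Icc]; omega
  obtain ⟨σ, hσ, hσ1, hσ2⟩ := S9.perm_pair (Finset.Icc 2 n) A1 A2 (Iset k 1) (Iset k i)
    (hDV A1 hm1).1 (hDV A2 hm2).1 (hI 1 le_rfl (by omega)) (hI i (by omega) hi2)
    (by rw [hcI, (hDV A1 hm1).2]) (by rw [hcI, (hDV A2 hm2).2]) (by
      have : Iset k 1 ∩ Iset k i = Finset.Icc (i + 1) (k + 1) := by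
        ext x
        rw [Finset.mem_inter, Iset, Iset, Finset.mem_Icc, Finset.mem_Icc, Finset.mem_Icc]
        omega
      rw [this, Nat.card_Icc]; omega)
  have hσo : σ 1 = 1 := hσ 1 (by rw [Finset.mem_Icc]; omega)
  have hσn : ∀ x ∈ Finset.Icc 1 n, σ x ∈ Finset.Icc 1 n := by
    intro x hx
    by_contra hcon
    have h1 : σ (σ x) = σ x := hσ _ (fun h => hcon (by
      rw [Finset.mem_Icc] at h ⊢; omega))
    have h3 := σ.injective h1
    rw [h3] at hcon
    exact hcon hx
  refine ⟨σ, hσn, ?_⟩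
  refine Finset.eq_of_subset_of_card_le ?_ ?_
  · intro X hX
    obtain ⟨A, hA, rfl⟩ := Finset.mem_image.1 hX
    have hAk := Finset.mem_powersetCard.1 (hF hA)
    rw [Jfam, Finset.mem_union]
    by_cases h1 : 1 ∈ A
    · right
      refine Finset.mem_filter.2 ⟨Finset.mem_powersetCard.2 ⟨?_, ?_⟩, ?_, ?_, ?_⟩
      · intro y hy
        obtain ⟨x, hx, rfl⟩ := Finset.mem_image.1 hy
        exact hσn x (hAk.1 hx)
      · rw [Finset.card_image_of_injective _ σ.injective, hAk.2]
      · exact Finset.mem_image.2 ⟨1, h1, hσo⟩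
      · rw [← hσ1, ← Finset.image_inter _ _ σ.injective]
        exact (hint A hA A1 hF1).image _
      · rw [← hσ2, ← Finset.image_inter _ _ σ.injective]
        exact (hint A hA A2 hF2).image _
    · left
      have : A ∈ F.filter (fun A => 1 ∉ A) := Finset.mem_filter.2 ⟨hA, h1⟩
      rw [hD, Finset.mem_insert, Finset.mem_singleton] at this
      rw [Finset.mem_insert, Finset.mem_singleton]
      rcases this with rfl | rfl
      · exact Or.inl hσ1
      · exact Or.inr hσ2
  · have e1 := S9.Jcard n k t i hk ht hn1 hn3 hi1 hi2
    have e2 := S9.Jcard n k t (k - t + 1) hk ht hn1 hn3 le_rfl (by omega)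
    rw [Finset.card_image_of_injective _ (Finset.image_injective σ.injective), hcard]
    omega
end
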